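/- Let P = B ∪ R be a bichromatic set of 2n points in the plane in general position with |B| = |R| = n. Then any two BR-matchings on P are 2n-compatible. In particular, the transformation graph of BR-matchings on P (one node per BR-matching, with an edge between two nodes if and only if the corresponding BR-matchings are compatible) is connected and has diameter at most 2n. -/

import Mathlib

open Finset
open scoped Classical

/-- Points in the plane. -/
abbrev Pt : Type := ℝ × ℝ

/-- A finite point set is in general position if no three distinct points are collinear. -/
def GenPos (S : Finset Pt) : Prop :=
  ∀ p ∈ S, ∀ q ∈ S, ∀ r ∈ S, p ≠ q → p ≠ r → q ≠ r →
    ¬ Collinear ℝ ({p, q, r} : Set Pt)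

/-- `M` is a plane perfect bichromatic (BR-) matching on the bichromatic point set `B ∪ R`:
each edge `e ∈ M` is a pair (blue endpoint, red endpoint); every blue point is the blue
endpoint of exactly one edge, every red point is the red endpoint of exactly one edge, and
the (closed) segments of distinct edges are disjoint. -/
def IsBRMatching (B R : Finset Pt) (M : Finset (Pt × Pt)) : Prop :=
  (∀ e ∈ M, e.1 ∈ B ∧ e.2 ∈ R) ∧
  (∀ b ∈ B, ∃! e, e ∈ M ∧ e.1 = b) ∧
  (∀ r ∈ R, ∃! e, e ∈ M ∧ e.2 = r) ∧
  (∀ e ∈ M, ∀ e' ∈ M, e ≠ e' →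
    segment ℝ e.1 e.2 ∩ segment ℝ e'.1 e'.2 = ∅)

/-- Two matchings are compatible if any two of their segments intersect in at most a
common endpoint (shared edges are allowed). -/
def Compatible (M M' : Finset (Pt × Pt)) : Prop :=
  ∀ e ∈ M, ∀ e' ∈ M', e = e' ∨
    segment ℝ e.1 e.2 ∩ segment ℝ e'.1 e'.2 ⊆
      {x : Pt | (x = e.1 ∨ x = e.2) ∧ (x = e'.1 ∨ x = e'.2)}

/-- `M` and `M'` are `t`-compatible: there is a transformation (sequence of BR-matchings
on `B ∪ R` in which consecutive matchings are compatible) of length `k ≤ t` between them. -/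
def TCompatible (B R : Finset Pt) (t : ℕ) (M M' : Finset (Pt × Pt)) : Prop :=
  ∃ k ≤ t, ∃ f : ℕ → Finset (Pt × Pt),
    f 0 = M ∧ f k = M' ∧ (∀ i ≤ k, IsBRMatching B R (f i)) ∧
    ∀ i < k, Compatible (f i) (f (i + 1))

/-- The line `{p | a * p.1 + b * p.2 = c}`. -/
def lineSet (a b c : ℝ) : Set Pt := {p : Pt | a * p.1 + b * p.2 = c}

/-- The line given by `a * x + b * y = c` is a ham-sandwich cut of the bichromatic point
set `B ∪ R` (with `|B| = |R| = n`): it contains no point of `B ∪ R`, and one of its open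
sides contains exactly `⌊n/2⌋` blue and `⌊n/2⌋` red points while the other open side
contains exactly `⌈n/2⌉` blue and `⌈n/2⌉` red points. -/
def IsHamSandwichCut (a b c : ℝ) (B R : Finset Pt) (n : ℕ) : Prop :=
  (a, b) ≠ ((0 : ℝ), (0 : ℝ)) ∧
  (∀ p ∈ B ∪ R, a * p.1 + b * p.2 ≠ c) ∧
  (((B.filter fun p => a * p.1 + b * p.2 < c).card = n / 2 ∧
    (R.filter fun p => a * p.1 + b * p.2 < c).card = n / 2 ∧
    (B.filter fun p => a * p.1 + b * p.2 > c).card = (n + 1) / 2 ∧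
    (R.filter fun p => a * p.1 + b * p.2 > c).card = (n + 1) / 2) ∨
   ((B.filter fun p => a * p.1 + b * p.2 < c).card = (n + 1) / 2 ∧
    (R.filter fun p => a * p.1 + b * p.2 < c).card = (n + 1) / 2 ∧
    (B.filter fun p => a * p.1 + b * p.2 > c).card = n / 2 ∧
    (R.filter fun p => a * p.1 + b * p.2 > c).card = n / 2))

/-- The edge `e` crosses the line `a * x + b * y = c`: its segment meets the line. -/
def Crosses (a b c : ℝ) (e : Pt × Pt) : Prop :=
  ∃ x ∈ segment ℝ e.1 e.2, a * x.1 + b * x.2 = c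

namespace BRPlane

/-- The cross product of two plane vectors. -/
def cr (a b : Pt) : ℝ := a.1 * b.2 - a.2 * b.1

@[simp] lemma cr_add_right (a b c : Pt) : cr a (b + c) = cr a b + cr a c := by
  simp only [cr, Prod.fst_add, Prod.snd_add]; ring

@[simp] lemma cr_add_left (a b c : Pt) : cr (a + b) c = cr a c + cr b c := by
  simp only [cr, Prod.fst_add, Prod.snd_add]; ring

@[simp] lemma cr_sub_right (a b c : Pt) : cr a (b - c) = cr a b - cr a c := by
  simp only [cr, Prod.fst_sub, Prod.snd_sub]; ring

@[simp] lemma cr_sub_left (a b c : Pt) : cr (a - b) c = cr a c - cr b c := by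
  simp only [cr, Prod.fst_sub, Prod.snd_sub]; ring

@[simp] lemma cr_smul_right (t : ℝ) (a b : Pt) : cr a (t • b) = t * cr a b := by
  simp only [cr, Prod.smul_fst, Prod.smul_snd, smul_eq_mul]; ring

@[simp] lemma cr_smul_left (t : ℝ) (a b : Pt) : cr (t • a) b = t * cr a b := by
  simp only [cr, Prod.smul_fst, Prod.smul_snd, smul_eq_mul]; ring

@[simp] lemma cr_neg_right (a b : Pt) : cr a (-b) = -cr a b := by
  simp only [cr, Prod.fst_neg, Prod.snd_neg]; ring

@[simp] lemma cr_neg_left (a b : Pt) : cr (-a) b = -cr a b := by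
  simp only [cr, Prod.fst_neg, Prod.snd_neg]; ring

@[simp] lemma cr_self (a : Pt) : cr a a = 0 := by simp only [cr]; ring

lemma cr_comm (a b : Pt) : cr a b = -cr b a := by simp only [cr]; ring

@[simp] lemma cr_zero_right (a : Pt) : cr a 0 = 0 := by simp [cr]

@[simp] lemma cr_zero_left (a : Pt) : cr 0 a = 0 := by simp [cr]

/-- Cramer's rule: every vector is a combination of two independent ones. -/
lemma eq_comb_of_cr_ne {d n : Pt} (h : cr d n ≠ 0) (v : Pt) :
    v = (cr v n / cr d n) • d + (cr d v / cr d n) • n := by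
  ext <;> simp only [Prod.fst_add, Prod.snd_add, Prod.smul_fst, Prod.smul_snd, smul_eq_mul] <;>
    field_simp <;> simp only [cr] <;> ring

lemma ne_zero_of_cr_left {a b : Pt} (h : cr a b ≠ 0) : a ≠ 0 := by
  rintro rfl; simp at h

/-- A vector parallel to a nonzero one is a multiple of it. -/
lemma exists_smul_of_cr_eq_zero {a b : Pt} (ha : a ≠ 0) (h : cr a b = 0) : ∃ t : ℝ, b = t • a := by
  by_cases h1 : a.1 = 0
  · have h2 : a.2 ≠ 0 := fun h2 => ha (Prod.ext h1 h2)
    refine ⟨b.2 / a.2, ?_⟩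
    have : a.2 * b.1 = 0 := by simp only [cr, h1] at h; linarith
    have hb : b.1 = 0 := by simpa [h2] using this
    ext
    · simp [h1, hb]
    · simp [h2]
  · refine ⟨b.1 / a.1, ?_⟩
    ext
    · simp [h1]
    · simp only [Prod.smul_snd, smul_eq_mul]; field_simp
      simp only [cr] at h; linarith

/-- A wall is a closed convex subset of a line. -/
structure IsWall (T : Set Pt) : Prop where
  closed : IsClosed T
  convex : Convex ℝ T
  line : ∃ a w : Pt, w ≠ 0 ∧ ∀ z ∈ T, cr w (z - a) = 0

/-- `T` contains an initial piece of the ray from `x` in direction `c`. -/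
def RayAt (T : Set Pt) (x c : Pt) : Prop := ∃ ε > 0, ∀ t : ℝ, 0 ≤ t → t ≤ ε → x + t • c ∈ T

/-- `Q` holds on a thin sector at `x`, bounded by the direction `d` and on the side of `n`. -/
def Germ (Q : Pt → Prop) (x d n : Pt) : Prop :=
  ∃ ε > 0, ∀ σ τ : ℝ, 0 < σ → σ < ε → 0 < τ → τ < ε * σ → Q (x + σ • d + τ • n)

lemma Germ.mono {Q Q' : Pt → Prop} {x d n : Pt} (h : Germ Q x d n) (hQ : ∀ z, Q z → Q' z) :
    Germ Q' x d n := by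
  obtain ⟨ε, hε, h⟩ := h
  exact ⟨ε, hε, fun σ τ a b c e => hQ _ (h σ τ a b c e)⟩

/-- A germ only depends on the ray spanned by `d` and on the side of `n`. -/
lemma Germ.congr {Q : Pt → Prop} {x d n d' n' : Pt} (h : Germ Q x d n) {γ : ℝ} (hγ : 0 < γ)
    (hd : d' = γ • d) (hs : 0 < cr d n * cr d n') : Germ Q x d' n' := by
  obtain ⟨ε, hε, h⟩ := h
  have hne : cr d n ≠ 0 := by rintro h0; simp [h0] at hs
  have hn' := eq_comb_of_cr_ne hne n'
  have hα : 0 < cr d n' / cr d n := by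
    have : cr d n' / cr d n = (cr d n * cr d n') / (cr d n) ^ 2 := by field_simp
    rw [this]; positivity
  set α := cr d n' / cr d n
  set β := cr n' n / cr d n
  have hβ : 0 ≤ |β| := abs_nonneg _
  refine ⟨min (γ / (2 * (|β| + 1))) (min (ε / (2 * γ)) (ε * γ / (2 * α))), by positivity, ?_⟩
  intro σ τ hσ hσ' hτ hτ'
  set m := min (γ / (2 * (|β| + 1))) (min (ε / (2 * γ)) (ε * γ / (2 * α)))
  have hm1 : m ≤ γ / (2 * (|β| + 1)) := min_le_left _ _
  have hm2 : m ≤ ε / (2 * γ) := (min_le_right _ _).trans (min_le_left _ _)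
  have hm3 : m ≤ ε * γ / (2 * α) := (min_le_right _ _).trans (min_le_right _ _)
  rw [le_div_iff₀ (by positivity)] at hm1 hm2 hm3
  have hτβ : |τ * β| ≤ σ * γ / 2 := by
    rw [abs_mul, abs_of_pos hτ]
    nlinarith [mul_le_mul_of_nonneg_right hm1 hσ.le]
  obtain ⟨hb1, hb2⟩ := abs_le.1 hτβ
  have hτα : τ * α < ε * (σ * γ / 2) := by
    nlinarith [mul_le_mul_of_nonneg_right hm3 hσ.le, mul_lt_mul_of_pos_right hτ' hα]
  have hσγ : σ * γ < ε / 2 := by nlinarith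
  have := h (σ * γ + τ * β) (τ * α) (by nlinarith [mul_pos hσ hγ]) (by nlinarith) (by positivity)
    (by nlinarith)
  convert this using 1
  rw [hd]
  conv_lhs => rw [hn']
  module

lemma Germ.congr_side {Q : Pt → Prop} {x d n n' : Pt} (h : Germ Q x d n)
    (hs : 0 < cr d n * cr d n') : Germ Q x d n' :=
  h.congr one_pos (one_smul _ _).symm hs

section Labels

variable {ι : Type*} {W : ι → Set Pt} {Q : Pt → Prop}

/-- `Q` is invariant along segments that avoid all the walls. -/
def ConstOff (W : ι → Set Pt) (Q : Pt → Prop) : Prop :=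
  ∀ z z' : Pt, (∀ y ∈ segment ℝ z z', ∀ i, y ∉ W i) → Q z → Q z'

lemma ConstOff.iff (hQ : ConstOff W Q) {z z' : Pt}
    (h : ∀ y ∈ segment ℝ z z', ∀ i, y ∉ W i) : Q z ↔ Q z' :=
  ⟨hQ z z' h, hQ z' z (by rwa [segment_symm])⟩

lemma ConstOff.not (hQ : ConstOff W Q) : ConstOff W (fun z => ¬ Q z) := by
  intro z z' h hz hz'
  exact hz ((hQ.iff h).2 hz')

lemma IsWall.sector_free {T : Set Pt} (hT : IsWall T) {x d n : Pt} (hdn : cr d n ≠ 0) :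
    ∃ ε > 0, ∀ σ τ : ℝ, 0 < σ → σ < ε → 0 < τ → τ < ε * σ → x + σ • d + τ • n ∉ T := by
  obtain ⟨a, w, hw, hl⟩ := hT.line
  have key : ∀ σ τ : ℝ, cr w (x + σ • d + τ • n - a) = cr w (x - a) + σ * cr w d + τ * cr w n := by
    intro σ τ; simp; ring
  set f0 := cr w (x - a)
  set f1 := cr w d
  set f2 := cr w n
  have h2 : 0 ≤ |f2| := abs_nonneg _
  have h1 : 0 ≤ |f1| := abs_nonneg _
  by_cases hf0 : f0 = 0
  · by_cases hf1 : f1 = 0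
    · have hf2 : f2 ≠ 0 := by
        intro hf2
        apply hw
        have := eq_comb_of_cr_ne hdn w
        rw [this]
        have e1 : cr d w = 0 := by rw [cr_comm]; simp [show cr w d = 0 from hf1]
        rw [show cr w n = 0 from hf2, e1]; simp
      refine ⟨1, one_pos, fun σ τ _ _ hτ _ hz => ?_⟩
      have := hl _ hz
      rw [key, hf0, hf1] at this
      have : τ * f2 = 0 := by linarith
      rcases mul_eq_zero.1 this with h | h
      · linarith
      · exact hf2 h
    · have hp : 0 < |f1| := abs_pos.2 hf1
      refine ⟨|f1| / (|f2| + 1), by positivity, fun σ τ hσ _ hτ hτ' hz => ?_⟩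
      have := hl _ hz
      rw [key, hf0] at this
      have e : σ * f1 = - (τ * f2) := by linarith
      have e2 : σ * |f1| = τ * |f2| := by
        rw [← abs_of_pos hσ, ← abs_mul, e, abs_neg, abs_mul, abs_of_pos hτ]
      have : τ * (|f2| + 1) < |f1| * σ := by
        rw [div_mul_eq_mul_div, lt_div_iff₀ (by positivity)] at hτ'
        exact hτ'
      nlinarith
  · have hp : 0 < |f0| := abs_pos.2 hf0
    refine ⟨min 1 (|f0| / (|f1| + |f2| + 1)), by positivity, fun σ τ hσ hσ' hτ hτ' hz => ?_⟩
    have := hl _ hz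
    rw [key] at this
    set m := min 1 (|f0| / (|f1| + |f2| + 1))
    have hm1 : m ≤ 1 := min_le_left _ _
    have hm2 : m ≤ |f0| / (|f1| + |f2| + 1) := min_le_right _ _
    rw [le_div_iff₀ (by positivity)] at hm2
    have e : f0 = - (σ * f1 + τ * f2) := by linarith
    have e2 : |f0| ≤ σ * |f1| + τ * |f2| := by
      rw [e, abs_neg]
      refine (abs_add_le _ _).trans ?_
      rw [abs_mul, abs_mul, abs_of_pos hσ, abs_of_pos hτ]
    have : τ < σ := by nlinarith
    nlinarith

variable [Finite ι]

/-- Finitely many properties that each hold for small parameters hold jointly. -/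
lemma exists_small {P : ι → ℝ → Prop} (h : ∀ i, ∃ ε > 0, ∀ δ, 0 < δ → δ ≤ ε → P i δ) :
    ∃ ε > 0, ∀ i, P i ε := by
  have : ∀ᶠ ε in nhdsWithin (0 : ℝ) (Set.Ioi 0), ∀ i, P i ε := by
    rw [Filter.eventually_all]
    intro i
    obtain ⟨ε, hε, h⟩ := h i
    filter_upwards [Ioc_mem_nhdsGT hε] with δ hδ using h δ hδ.1 hδ.2
  obtain ⟨ε, h1, h2⟩ := (this.and self_mem_nhdsWithin).exists
  exact ⟨ε, h2, h1⟩

lemma germ_or (hW : ∀ i, IsWall (W i)) (hQ : ConstOff W Q) (x : Pt) {d n : Pt}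
    (hdn : cr d n ≠ 0) : Germ Q x d n ∨ Germ (fun z => ¬ Q z) x d n := by
  obtain ⟨ε, hε, h⟩ := exists_small (ι := ι) (P := fun i δ => ∀ σ τ : ℝ, 0 < σ → σ < δ → 0 < τ →
      τ < δ * σ → x + σ • d + τ • n ∉ W i) (by
    intro i
    obtain ⟨ε, hε, h⟩ := (hW i).sector_free (x := x) hdn
    exact ⟨ε, hε, fun δ hδ hδε σ τ h1 h2 h3 h4 => h σ τ h1 (h2.trans_le hδε) h3
      (h4.trans_le (mul_le_mul_of_nonneg_right hδε h1.le))⟩)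
  have hseg : ∀ σ τ σ' τ' : ℝ, 0 < σ → σ < ε → 0 < τ → τ < ε * σ → 0 < σ' → σ' < ε → 0 < τ' →
      τ' < ε * σ' → (Q (x + σ • d + τ • n) ↔ Q (x + σ' • d + τ' • n)) := by
    intro σ τ σ' τ' h1 h2 h3 h4 h1' h2' h3' h4'
    apply hQ.iff
    rintro y ⟨a, b, ha, hb, hab, rfl⟩ i
    have := h i (a * σ + b * σ') (a * τ + b * τ')
    have e : a • (x + σ • d + τ • n) + b • (x + σ' • d + τ' • n) =
        x + (a * σ + b * σ') • d + (a * τ + b * τ') • n := by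
      have : x = (a + b) • x := by rw [hab, one_smul]
      conv_rhs => rw [this]
      module
    rw [e]
    have hb' : b = 1 - a := by linarith
    rcases ha.eq_or_lt with rfl | ha
    · have : b = 1 := by linarith
      subst this
      apply this <;> simpa
    · apply this
      · nlinarith [mul_nonneg hb h1'.le, mul_pos ha h1]
      · nlinarith [mul_nonneg hb (sub_nonneg.2 h2'.le), mul_pos ha (sub_pos.2 h2)]
      · nlinarith [mul_nonneg hb h3'.le, mul_pos ha h3]
      · nlinarith [mul_nonneg hb (sub_nonneg.2 h4'.le), mul_pos ha (sub_pos.2 h4)]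
  by_cases hq : Q (x + (ε / 2) • d + (ε * (ε / 2) / 2) • n)
  · left
    exact ⟨ε, hε, fun σ τ h1 h2 h3 h4 => (hseg _ _ _ _ (by positivity) (by linarith) (by positivity)
      (by nlinarith [mul_pos hε hε]) h1 h2 h3 h4).1 hq⟩
  · right
    exact ⟨ε, hε, fun σ τ h1 h2 h3 h4 hq' => hq ((hseg _ _ _ _ (by positivity) (by linarith)
      (by positivity) (by nlinarith [mul_pos hε hε]) h1 h2 h3 h4).2 hq')⟩

end Labels

lemma RayAt.mem {T : Set Pt} {x c : Pt} (h : RayAt T x c) : x ∈ T := by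
  obtain ⟨ε, hε, h⟩ := h
  simpa using h 0 le_rfl hε.le

lemma rayAt_of_convex {T : Set Pt} (hT : Convex ℝ T) {x c : Pt} {s : ℝ} (hs : 0 < s)
    (hx : x ∈ T) (hz : x + s • c ∈ T) : RayAt T x c := by
  refine ⟨s, hs, fun t h0 h1 => ?_⟩
  have := hT hx hz (a := 1 - t / s) (b := t / s) (by rw [sub_nonneg, div_le_one hs]; exact h1)
    (by positivity) (by ring)
  convert this using 1
  rw [smul_add, smul_smul, div_mul_cancel₀ _ hs.ne', ← add_assoc, ← add_smul]
  simp

/-- Two rays contained in one wall at the same point are parallel. -/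
lemma IsWall.cr_ray {T : Set Pt} (hT : IsWall T) {x c c' : Pt} (h : RayAt T x c)
    (h' : RayAt T x c') : cr c c' = 0 := by
  obtain ⟨a, w, hw, hl⟩ := hT.line
  have hx := hl _ h.mem
  obtain ⟨ε, hε, h⟩ := h
  obtain ⟨δ, hδ, h'⟩ := h'
  have e1 := hl _ (h ε hε.le le_rfl)
  have e2 := hl _ (h' δ hδ.le le_rfl)
  rw [add_sub_right_comm, cr_add_right, hx, cr_smul_right, zero_add] at e1 e2
  obtain ⟨s, rfl⟩ := exists_smul_of_cr_eq_zero hw ((mul_eq_zero.1 e1).resolve_left hε.ne')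
  obtain ⟨t, rfl⟩ := exists_smul_of_cr_eq_zero hw ((mul_eq_zero.1 e2).resolve_left hδ.ne')
  simp

lemma IsWall.small_ball {T : Set Pt} (hT : IsWall T) {x : Pt} (hx : x ∉ T) :
    ∃ ε > 0, ∀ z : Pt, |z.1 - x.1| < ε → |z.2 - x.2| < ε → z ∉ T := by
  obtain ⟨ε, hε, h⟩ := Metric.isOpen_iff.1 hT.closed.isOpen_compl x hx
  refine ⟨ε, hε, fun z h1 h2 => h ?_⟩
  rw [Metric.mem_ball, Prod.dist_eq, Real.dist_eq, Real.dist_eq]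
  exact max_lt h1 h2

section Labels

variable {ι : Type*} [Finite ι] {W : ι → Set Pt} {Q : Pt → Prop}

lemma exists_small_ball (hW : ∀ i, IsWall (W i)) (x : Pt) :
    ∃ ε > 0, ∀ i, x ∉ W i → ∀ z : Pt, |z.1 - x.1| < ε → |z.2 - x.2| < ε → z ∉ W i := by
  refine exists_small (P := fun i ε => x ∉ W i → ∀ z : Pt, |z.1 - x.1| < ε → |z.2 - x.2| < ε →
    z ∉ W i) fun i => ?_
  by_cases hx : x ∈ W i
  · exact ⟨1, one_pos, fun _ _ _ h => absurd hx h⟩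
  · obtain ⟨ε, hε, h⟩ := (hW i).small_ball hx
    exact ⟨ε, hε, fun δ _ hδ _ z h1 h2 => h z (h1.trans_le hδ) (h2.trans_le hδ)⟩

lemma comb_mem_small {d1 d2 : Pt} {ε : ℝ} (hε : 0 < ε) : ∃ η > 0, ∀ α β : ℝ, 0 ≤ α → α ≤ η →
    0 ≤ β → β ≤ η → |(α • d1 + β • d2).1| < ε ∧ |(α • d1 + β • d2).2| < ε := by
  set K := |d1.1| + |d2.1| + |d1.2| + |d2.2| + 1
  have h1 := abs_nonneg d1.1
  have h2 := abs_nonneg d2.1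
  have h3 := abs_nonneg d1.2
  have h4 := abs_nonneg d2.2
  have hK : 0 < K := by positivity
  refine ⟨ε / (2 * K), by positivity, fun α β ha ha' hb hb' => ?_⟩
  rw [le_div_iff₀ (by positivity)] at ha' hb'
  constructor
  · simp only [Prod.fst_add, Prod.smul_fst, smul_eq_mul]
    refine (abs_add_le _ _).trans_lt ?_
    rw [abs_mul, abs_mul, abs_of_nonneg ha, abs_of_nonneg hb]
    have : α * |d1.1| + β * |d2.1| ≤ ε / (2 * K) * K := by
      have : α ≤ ε / (2 * K) := by rw [le_div_iff₀ (by positivity)]; exact ha'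
      have : β ≤ ε / (2 * K) := by rw [le_div_iff₀ (by positivity)]; exact hb'
      have h0 : 0 ≤ ε / (2 * K) := by positivity
      calc α * |d1.1| + β * |d2.1| ≤ ε / (2 * K) * |d1.1| + ε / (2 * K) * |d2.1| := by gcongr
        _ ≤ _ := by rw [← mul_add]; gcongr; simp only [K]; linarith
    have e : ε / (2 * K) * K = ε / 2 := by field_simp
    linarith
  · simp only [Prod.snd_add, Prod.smul_snd, smul_eq_mul]
    refine (abs_add_le _ _).trans_lt ?_
    rw [abs_mul, abs_mul, abs_of_nonneg ha, abs_of_nonneg hb]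
    have : α * |d1.2| + β * |d2.2| ≤ ε / (2 * K) * K := by
      have : α ≤ ε / (2 * K) := by rw [le_div_iff₀ (by positivity)]; exact ha'
      have : β ≤ ε / (2 * K) := by rw [le_div_iff₀ (by positivity)]; exact hb'
      have h0 : 0 ≤ ε / (2 * K) := by positivity
      calc α * |d1.2| + β * |d2.2| ≤ ε / (2 * K) * |d1.2| + ε / (2 * K) * |d2.2| := by gcongr
        _ ≤ _ := by rw [← mul_add]; gcongr; simp only [K]; linarith
    have e : ε / (2 * K) * K = ε / 2 := by field_simp
    linarith

/-- If no wall leaves `x` strictly between two directions, the germs along them agree. -/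
lemma germ_wedge_of_free (hW : ∀ i, IsWall (W i)) (hQ : ConstOff W Q) {x d1 d2 : Pt}
    (h1 : Germ Q x d1 d2)
    (hfree : ∀ i, ∀ α β : ℝ, 0 < α → 0 < β → ¬ RayAt (W i) x (α • d1 + β • d2)) :
    ¬ Germ (fun z => ¬ Q z) x d2 d1 := by
  rintro ⟨δ, hδ, h2⟩
  obtain ⟨ε, hε, h1⟩ := h1
  obtain ⟨r, hr, hball⟩ := exists_small_ball hW x
  obtain ⟨η, hη, hsm⟩ := comb_mem_small (d1 := d1) (d2 := d2) hr
  have hfr : ∀ α β : ℝ, 0 < α → α ≤ η → 0 < β → β ≤ η → ∀ i, x + (α • d1 + β • d2) ∉ W i := by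
    intro α β ha ha' hb hb' i hi
    by_cases hx : x ∈ W i
    · exact hfree i α β ha hb (rayAt_of_convex (hW i).convex one_pos hx (by simpa using hi))
    · obtain ⟨e1, e2⟩ := hsm α β ha.le ha' hb.le hb'
      refine hball i hx _ ?_ ?_ hi <;> simpa
  set m := min (min ε δ) (min η 1)
  have hm : 0 < m := by positivity
  have m1 : m ≤ ε := (min_le_left _ _).trans (min_le_left _ _)
  have m2 : m ≤ δ := (min_le_left _ _).trans (min_le_right _ _)
  have m3 : m ≤ η := (min_le_right _ _).trans (min_le_left _ _)
  have m4 : m ≤ 1 := (min_le_right _ _).trans (min_le_right _ _)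
  have ha := h1 (m / 2) (m / 2 * m / 2) (by positivity) (by linarith) (by positivity) (by nlinarith)
  have hb := h2 (m / 2) (m / 2 * m / 2) (by positivity) (by linarith) (by positivity) (by nlinarith)
  refine hb ((hQ.iff ?_).1 ha)
  rintro y ⟨a, b, h3, h4, h5, rfl⟩ i
  have e : a • (x + (m / 2) • d1 + (m / 2 * m / 2) • d2) + b • (x + (m / 2) • d2 +
      (m / 2 * m / 2) • d1) = x + ((a * (m / 2) + b * (m / 2 * m / 2)) • d1 +
      (a * (m / 2 * m / 2) + b * (m / 2)) • d2) := by
    have : x = (a + b) • x := by rw [h5, one_smul]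
    conv_rhs => rw [this]
    module
  rw [e]
  have hmm : m / 2 * m / 2 ≤ m / 2 := by nlinarith
  have hmm0 : 0 < m / 2 * m / 2 := by positivity
  have ha' : a = 1 - b := by linarith
  apply hfr
  · nlinarith
  · nlinarith
  · nlinarith
  · nlinarith

/-- A label change inside a wedge at `x` happens at a wall leaving `x` inside the wedge. -/
lemma exists_ray_of_germ_wedge (hW : ∀ i, IsWall (W i)) (hQ : ConstOff W Q) {x : Pt} {d1 d2 : Pt}
    (hd : cr d1 d2 ≠ 0) (h1 : Germ (fun z => ¬ Q z) x d1 d2) (h2 : Germ Q x d2 d1) :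
    ∃ i, ∃ α β : ℝ, 0 < α ∧ 0 < β ∧ RayAt (W i) x (α • d1 + β • d2) ∧
      Germ (fun z => ¬ Q z) x (α • d1 + β • d2) d1 ∧ Germ Q x (α • d1 + β • d2) d2 := by
  induction hk : {i | ∃ α β : ℝ, 0 < α ∧ 0 < β ∧ RayAt (W i) x (α • d1 + β • d2)}.ncard
    using Nat.strong_induction_on generalizing d1 d2 with
  | _ k ih =>
  by_cases hfree : ∀ i, ∀ α β : ℝ, 0 < α → 0 < β → ¬ RayAt (W i) x (α • d1 + β • d2)
  · exact absurd (h2.mono fun z hz => not_not.2 hz) (germ_wedge_of_free hW hQ.not h1 hfree)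
  push Not at hfree
  obtain ⟨i, α, β, ha, hb, hray⟩ := hfree
  have hc1 : cr (α • d1 + β • d2) d1 ≠ 0 := by
    simp [hb.ne', cr_comm d2 d1, hd]
  have hc2 : cr (α • d1 + β • d2) d2 ≠ 0 := by
    simp [ha.ne', hd]
  have hsq : 0 < cr d1 d2 * cr d1 d2 := mul_self_pos.2 hd
  set c := α • d1 + β • d2 with hc
  rcases germ_or hW hQ x hc1 with g1 | g1
  · obtain ⟨j, α', β', ha', hb', hr', k1, k2⟩ := ih _ (by
      rw [← hk]
      apply Set.ncard_lt_ncard _ (Set.toFinite _)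
      refine ⟨?_, fun hsub => ?_⟩
      · rintro j ⟨α', β', ha', hb', hr⟩
        refine ⟨α' + β' * α, β' * β, by positivity, by positivity, ?_⟩
        convert hr using 1
        rw [hc]; module
      · obtain ⟨α', β', ha', hb', hr⟩ := hsub ⟨α, β, ha, hb, hray⟩
        have := (hW i).cr_ray hr hray
        rw [hc] at this
        simp [cr_comm d2 d1] at this
        have e : (α' * β) * cr d1 d2 = 0 := by linarith
        simp [ha'.ne', hb.ne', hd] at e) (d1 := d1) (d2 := c) (by simp [hc, hb.ne', hd])
      (h1.congr_side (by simp [hc]; rw [mul_left_comm]; positivity)) g1 rfl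
    have e : α' • d1 + β' • c = (α' + β' * α) • d1 + (β' * β) • d2 := by rw [hc]; module
    rw [e] at hr' k1 k2
    refine ⟨j, _, _, by positivity, by positivity, hr', k1, k2.congr_side ?_⟩
    have : cr ((α' + β' * α) • d1 + (β' * β) • d2) c * cr ((α' + β' * α) • d1 + (β' * β) • d2) d2 =
        (α' * β * (α' + β' * α)) * (cr d1 d2 * cr d1 d2) := by
      simp only [hc, cr, Prod.fst_add, Prod.snd_add, Prod.smul_fst, Prod.smul_snd, smul_eq_mul]
      ring
    rw [this]; positivity
  rcases germ_or hW hQ x hc2 with g2 | g2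
  · exact ⟨i, α, β, ha, hb, hray, g1, g2⟩
  · obtain ⟨j, α', β', ha', hb', hr', k1, k2⟩ := ih _ (by
      rw [← hk]
      apply Set.ncard_lt_ncard _ (Set.toFinite _)
      refine ⟨?_, fun hsub => ?_⟩
      · rintro j ⟨α', β', ha', hb', hr⟩
        refine ⟨α' * α, α' * β + β', by positivity, by positivity, ?_⟩
        convert hr using 1
        rw [hc]; module
      · obtain ⟨α', β', ha', hb', hr⟩ := hsub ⟨α, β, ha, hb, hray⟩
        have := (hW i).cr_ray hr hray
        rw [hc] at this
        simp [cr_comm d2 d1] at this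
        have e : (β' * α) * cr d1 d2 = 0 := by linarith
        simp [hb'.ne', ha.ne', hd] at e) (d1 := c) (d2 := d2) hc2
      g2 (h2.congr_side (by simp [hc, cr_comm d2 d1]; rw [mul_left_comm]; positivity)) rfl
    have e : α' • c + β' • d2 = (α' * α) • d1 + (α' * β + β') • d2 := by rw [hc]; module
    rw [e] at hr' k1 k2
    refine ⟨j, _, _, by positivity, by positivity, hr', k1.congr_side ?_, k2⟩
    have : cr ((α' * α) • d1 + (α' * β + β') • d2) c * cr ((α' * α) • d1 + (α' * β + β') • d2) d1 =
        (β' * α * (α' * β + β')) * (cr d1 d2 * cr d1 d2) := by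
      simp only [hc, cr, Prod.fst_add, Prod.snd_add, Prod.smul_fst, Prod.smul_snd, smul_eq_mul]
      ring
    rw [this]; positivity

end Labels

/-- A wall not leaving the open segment `p + (a, b) • d` towards `n` avoids a thin lens over it. -/
lemma IsWall.lens_free {T : Set Pt} (hT : IsWall T) {p d n : Pt} (hdn : cr d n ≠ 0) {a b : ℝ}
    (hab : a < b)
    (hfree : ∀ s c, a < s → s < b → 0 < cr d n * cr d c → ¬ RayAt T (p + s • d) c) :
    ∃ ε > 0, ∀ t s : ℝ, 0 < s → s < ε * (t - a) → s < ε * (b - t) → p + t • d + s • n ∉ T := by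
  obtain ⟨a0, w, hw, hl⟩ := hT.line
  have key : ∀ t s : ℝ, p + t • d + s • n ∈ T →
      cr w (p - a0) + t * cr w d + s * cr w n = 0 := by
    intro t s h
    have := hl _ h
    rw [← this]; simp; ring
  set f0 := cr w (p - a0)
  set f1 := cr w d with hf1
  set f2 := cr w n with hf2
  have hba : 0 < b - a := sub_pos.2 hab
  by_cases h1 : f1 = 0
  · have h2 : f2 ≠ 0 := by
      intro h2
      obtain ⟨x, rfl⟩ := exists_smul_of_cr_eq_zero hw h1
      obtain ⟨y, rfl⟩ := exists_smul_of_cr_eq_zero hw h2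
      simp at hdn
    rw [h1] at key
    by_cases h0 : f0 = 0
    · refine ⟨1, one_pos, fun t s hs _ _ hm => ?_⟩
      have := key t s hm
      rw [h0] at this
      have : s * f2 = 0 := by linarith
      simp [hs.ne', h2] at this
    · refine ⟨|f0| / |f2| / (b - a), by positivity, fun t s hs h3 h4 hm => ?_⟩
      have := key t s hm
      have e : |f0| = s * |f2| := by
        rw [show f0 = -(s * f2) by linarith, abs_neg, abs_mul, abs_of_pos hs]
      have hE : |f0| / |f2| = s := by rw [e]; field_simp
      rw [hE] at h3 h4
      have h5 : s / (b - a) * (b - a) = s := by field_simp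
      have : s / (b - a) > 0 := by positivity
      nlinarith
  · set κ := -(f2 / f1) with hκ
    set t0 := -(f0 / f1) with ht0
    have key' : ∀ t s : ℝ, p + t • d + s • n ∈ T → t = t0 + κ * s := by
      intro t s h
      have := key t s h
      rw [hκ, ht0]; field_simp; linarith
    have hk := neg_abs_le κ
    have hk' := le_abs_self κ
    have hk0 := abs_nonneg κ
    rcases le_or_gt t0 a with hta | hta
    · refine ⟨1 / (|κ| + 1), by positivity, fun t s hs h3 h4 hm => ?_⟩
      have := key' t s hm
      rw [div_mul_eq_mul_div, one_mul, lt_div_iff₀ (by positivity)] at h3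
      nlinarith
    rcases le_or_gt b t0 with htb | htb
    · refine ⟨1 / (|κ| + 1), by positivity, fun t s hs h3 h4 hm => ?_⟩
      have := key' t s hm
      rw [div_mul_eq_mul_div, one_mul, lt_div_iff₀ (by positivity)] at h4
      nlinarith
    have hz : ∀ t s : ℝ, p + t • d + s • n ∈ T → p + t0 • d + s • (κ • d + n) ∈ T := by
      intro t s h
      have := key' t s h
      rw [this] at h
      convert h using 1
      module
    by_cases hx : p + t0 • d ∈ T
    · refine ⟨1, one_pos, fun t s hs _ _ hm => ?_⟩
      refine hfree t0 (κ • d + n) hta htb ?_ (rayAt_of_convex hT.convex hs hx (hz t s hm))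
      simpa using mul_self_pos.2 hdn
    · obtain ⟨ε, hε, hb⟩ := hT.small_ball hx
      obtain ⟨η, hη, hsm⟩ := comb_mem_small (d1 := κ • d + n) (d2 := 0) hε
      refine ⟨η / (b - a), by positivity, fun t s hs h3 h4 hm => ?_⟩
      have h5 : η / (b - a) * (b - a) = η := by field_simp
      have h6 : η / (b - a) > 0 := by positivity
      obtain ⟨e1, e2⟩ := hsm s 0 hs.le (by nlinarith) le_rfl hη.le
      simp only [smul_zero, add_zero] at e1 e2
      refine hb _ ?_ ?_ (hz t s hm)
      · rw [Prod.fst_add]; simpa using e1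
      · rw [Prod.snd_add]; simpa using e2

section Labels

variable {ι : Type*} [Finite ι] {W : ι → Set Pt} {Q : Pt → Prop}

/-- If no wall leaves an open segment towards `n`, the germs at its two ends agree. -/
lemma germ_segment_of_free (hW : ∀ i, IsWall (W i)) (hQ : ConstOff W Q) {p d n : Pt}
    (hdn : cr d n ≠ 0) {a b : ℝ} (hab : a < b)
    (hfree : ∀ i s c, a < s → s < b → 0 < cr d n * cr d c → ¬ RayAt (W i) (p + s • d) c)
    (h1 : Germ (fun z => ¬ Q z) (p + a • d) d n) : ¬ Germ Q (p + b • d) (-d) n := by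
  rintro ⟨δ, hδ, h2⟩
  obtain ⟨γ, hγ, h1⟩ := h1
  obtain ⟨ε, hε, hf⟩ := exists_small (ι := ι) (P := fun i ε => ∀ t s : ℝ, 0 < s →
      s < ε * (t - a) → s < ε * (b - t) → p + t • d + s • n ∉ W i) (by
    intro i
    obtain ⟨ε, hε, h⟩ := (hW i).lens_free hdn hab (hfree i)
    refine ⟨ε, hε, fun δ hδ hδε t s h0 h1 h2 => h t s h0 ?_ ?_⟩
    · have : 0 < t - a := by by_contra! h; nlinarith
      nlinarith
    · have : 0 < b - t := by by_contra! h; nlinarith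
      nlinarith)
  have hba : 0 < b - a := sub_pos.2 hab
  obtain ⟨m, hm, m1, m2, m3⟩ : ∃ m > 0, m < γ ∧ m < δ ∧ m < (b - a) / 2 :=
    ⟨min (min γ δ) ((b - a) / 2) / 2, by positivity,
      by have := min_le_left (min γ δ) ((b - a) / 2); have := min_le_left γ δ
         have : 0 < min (min γ δ) ((b - a) / 2) := by positivity
         linarith,
      by have := min_le_left (min γ δ) ((b - a) / 2); have := min_le_right γ δ
         have : 0 < min (min γ δ) ((b - a) / 2) := by positivity
         linarith,
      by have := min_le_right (min γ δ) ((b - a) / 2)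
         have : 0 < min (min γ δ) ((b - a) / 2) := by positivity
         linarith⟩
  obtain ⟨s, hs, s1, s2, s3⟩ : ∃ s > 0, s < γ * m ∧ s < δ * m ∧ s < ε * m := by
    have h0 : 0 < min (min (γ * m) (δ * m)) (ε * m) := by positivity
    have := min_le_left (min (γ * m) (δ * m)) (ε * m)
    have := min_le_left (γ * m) (δ * m)
    have := min_le_right (γ * m) (δ * m)
    have := min_le_right (min (γ * m) (δ * m)) (ε * m)
    exact ⟨min (min (γ * m) (δ * m)) (ε * m) / 2, by positivity, by linarith, by linarith,
      by linarith⟩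
  have ha := h1 m s hm m1 hs s1
  have hb := h2 m s hm m2 hs s2
  refine ha ((hQ.iff ?_).2 hb)
  rintro y ⟨u, v, hu, hv, huv, rfl⟩ i
  have e : u • (p + a • d + m • d + s • n) + v • (p + b • d + m • -d + s • n) =
      p + (a + m + v * (b - a - 2 * m)) • d + s • n := by
    have hu' : u = 1 - v := by linarith
    rw [hu']; module
  have hv1 : v ≤ 1 := by linarith
  have hm2 : 0 < b - a - 2 * m := by linarith
  rw [e]
  apply hf i _ _ hs
  · have : 0 ≤ v * (b - a - 2 * m) := by positivity
    nlinarith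
  · have : v * (b - a - 2 * m) ≤ b - a - 2 * m := by nlinarith
    nlinarith

/-- A label change along one side of a segment happens at a wall leaving the segment there. -/
lemma exists_ray_of_germ_line (hW : ∀ i, IsWall (W i)) (hQ : ConstOff W Q) {p d n : Pt}
    (hdn : cr d n ≠ 0) {a b : ℝ} (hab : a < b)
    (h1 : Germ (fun z => ¬ Q z) (p + a • d) d n) (h2 : Germ Q (p + b • d) (-d) n) :
    ∃ s c i, a < s ∧ s < b ∧ 0 < cr d n * cr d c ∧ RayAt (W i) (p + s • d) c ∧
      Germ (fun z => ¬ Q z) (p + s • d) c (-d) ∧ Germ Q (p + s • d) c d := by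
  induction hk : {i | ∃ s c, a < s ∧ s < b ∧ 0 < cr d n * cr d c ∧
      RayAt (W i) (p + s • d) c}.ncard using Nat.strong_induction_on generalizing a b with
  | _ k ih =>
  by_cases hfree : ∀ i s c, a < s → s < b → 0 < cr d n * cr d c → ¬ RayAt (W i) (p + s • d) c
  · exact absurd h2 (germ_segment_of_free hW hQ hdn hab hfree h1)
  push Not at hfree
  obtain ⟨i, s, c, has, hsb, hc, hray⟩ := hfree
  have hdc : cr d c ≠ 0 := by rintro h; simp [h] at hc
  have hcd : cr c d ≠ 0 := by rw [cr_comm]; simpa using hdc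
  have huniq : ∀ s' c', s' ≠ s → cr d c' ≠ 0 → ¬ RayAt (W i) (p + s' • d) c' := by
    intro s' c' hne hc' hr
    have hx := hray.mem
    obtain ⟨a0, w, hw, hl⟩ := (hW i).line
    obtain ⟨ε, hε, hr'⟩ := hr
    have e1 := hl _ hx
    have e2 := hl _ (hr' 0 le_rfl hε.le)
    have e3 := hl _ (hr' ε hε.le le_rfl)
    simp at e1 e2 e3
    have e4 : (s' - s) * cr w d = 0 := by linarith
    have e5 : ε * cr w c' = 0 := by linarith
    obtain ⟨x, rfl⟩ := exists_smul_of_cr_eq_zero hw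
      ((mul_eq_zero.1 e4).resolve_left (sub_ne_zero.2 hne))
    obtain ⟨y, rfl⟩ := exists_smul_of_cr_eq_zero hw ((mul_eq_zero.1 e5).resolve_left hε.ne')
    simp at hdc hc'
  have hlt : ∀ a' b', a ≤ a' → b' ≤ b → ¬ (a' < s ∧ s < b') →
      {i | ∃ s c, a' < s ∧ s < b' ∧ 0 < cr d n * cr d c ∧ RayAt (W i) (p + s • d) c}.ncard < k := by
    intro a' b' h3 h4 h5
    rw [← hk]
    refine Set.ncard_lt_ncard ⟨?_, fun hsub => ?_⟩ (Set.toFinite _)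
    · rintro j ⟨s', c', h6, h7, h8⟩
      exact ⟨s', c', by linarith, by linarith, h8⟩
    · obtain ⟨s', c', h6, h7, h8, h9⟩ := hsub ⟨s, c, has, hsb, hc, hray⟩
      refine huniq s' c' ?_ ?_ h9
      · rintro rfl; exact h5 ⟨h6, h7⟩
      · rintro h; simp [h] at h8
  rcases germ_or hW hQ (p + s • d) (d := -d) (n := n) (by simpa using hdn) with g1 | g1
  · obtain ⟨s', c', j, h3, h4, h5⟩ := ih _ (hlt a s le_rfl hsb.le (by simp)) has h1 g1 rfl
    exact ⟨s', c', j, h3, h4.trans hsb, h5⟩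
  rcases germ_or hW hQ (p + s • d) hdn with g2 | g2
  swap
  · obtain ⟨s', c', j, h3, h4, h5⟩ := ih _ (hlt s b has.le le_rfl (by simp)) hsb g2 h2 rfl
    exact ⟨s', c', j, has.trans h3, h4, h5⟩
  have hsq : 0 < cr d c * cr d c := mul_self_pos.2 hdc
  rcases germ_or hW hQ (p + s • d) (d := c) (n := -d) (by simpa using hcd) with g3 | g3
  · obtain ⟨j, α, β, ha, hb, hr, k1, k2⟩ := exists_ray_of_germ_wedge hW hQ (x := p + s • d)
      (d1 := -d) (d2 := c) (by simpa using hdc) (g1.congr_side (by simpa using hc)) g3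
    refine ⟨s, _, j, has, hsb, ?_, hr, k1, k2.congr_side ?_⟩
    · have : cr d n * cr d (α • -d + β • c) = β * (cr d n * cr d c) := by simp; ring
      rw [this]; positivity
    · have : cr (α • -d + β • c) c * cr (α • -d + β • c) d = α * β * (cr d c * cr d c) := by
        simp only [cr, Prod.fst_add, Prod.snd_add, Prod.smul_fst, Prod.smul_snd, smul_eq_mul,
          Prod.fst_neg, Prod.snd_neg]
        ring
      rw [this]; positivity
  rcases germ_or hW hQ (p + s • d) hcd with g4 | g4
  · exact ⟨s, c, i, has, hsb, hc, hray, g3, g4⟩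
  · obtain ⟨j, α, β, ha, hb, hr, k1, k2⟩ := exists_ray_of_germ_wedge hW hQ (x := p + s • d)
      (d1 := c) (d2 := d) hcd g4 (g2.congr_side hc)
    refine ⟨s, _, j, has, hsb, ?_, hr, k1.congr_side ?_, k2⟩
    · have : cr d n * cr d (α • c + β • d) = α * (cr d n * cr d c) := by simp; ring
      rw [this]; positivity
    · have : cr (α • c + β • d) c * cr (α • c + β • d) (-d) = α * β * (cr d c * cr d c) := by
        simp only [cr, Prod.fst_add, Prod.snd_add, Prod.smul_fst, Prod.smul_snd, smul_eq_mul,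
          Prod.fst_neg, Prod.snd_neg]
        ring
      rw [this]; positivity

/-- A label change along one side of a segment happens at a wall leaving the segment there. -/
lemma exists_ray_of_germ_segment (hW : ∀ i, IsWall (W i)) (hQ : ConstOff W Q) {p q n : Pt}
    (hdn : cr (q - p) n ≠ 0)
    (h1 : Germ (fun z => ¬ Q z) p (q - p) n) (h2 : Germ Q q (p - q) n) :
    ∃ x ∈ openSegment ℝ p q, ∃ c i, 0 < cr (q - p) n * cr (q - p) c ∧ RayAt (W i) x c ∧
      Germ (fun z => ¬ Q z) x c (p - q) ∧ Germ Q x c (q - p) := by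
  obtain ⟨s, c, i, h3, h4, h5, h6, h7, h8⟩ := exists_ray_of_germ_line hW hQ (p := p) hdn one_pos
    (by simpa using h1) (by simpa using h2)
  refine ⟨p + s • (q - p), ?_, c, i, h5, h6, by simpa using h7, h8⟩
  exact ⟨1 - s, s, by linarith, h3, by ring, by module⟩

end Labels

/-- The part of a line with parameters in `I`. -/
def linePart (o w : Pt) (I : Set ℝ) : Set Pt := (fun t : ℝ => o + t • w) '' I

lemma isWall_linePart {o w : Pt} {I : Set ℝ} (hw : w ≠ 0) (hc : IsClosed I) (hI : Convex ℝ I) :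
    IsWall (linePart o w I) where
  closed := ((Homeomorph.addLeft o).isClosedEmbedding.comp
    (isClosedEmbedding_smul_left hw)).isClosedMap _ hc
  convex := by
    rintro _ ⟨s, hs, rfl⟩ _ ⟨t, ht, rfl⟩ a b ha hb hab
    refine ⟨_, hI hs ht ha hb hab, ?_⟩
    have : a = 1 - b := by linarith
    simp only [this, smul_eq_mul]
    module
  line := ⟨o, w, hw, by rintro _ ⟨t, _, rfl⟩; simp⟩

lemma linePart_ray {o w : Pt} {I : Set ℝ} (hw : w ≠ 0) {x c : Pt}
    (h : RayAt (linePart o w I) x c) : ∃ t ∈ I, ∃ γ : ℝ, x = o + t • w ∧ c = γ • w ∧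
      ∃ ε > 0, ∀ s, 0 ≤ s → s ≤ ε → t + s * γ ∈ I := by
  obtain ⟨t, ht, hx⟩ := h.mem
  obtain ⟨ε, hε, h⟩ := h
  have hinj : ∀ a b : ℝ, a • w = b • w → a = b := fun a b hab => smul_left_injective ℝ hw hab
  obtain ⟨t', ht', hx'⟩ := h ε hε.le le_rfl
  simp only at hx hx'
  have hc : c = ((t' - t) / ε) • w := by
    have e : ε • c = (t' - t) • w := by
      rw [← hx] at hx'
      have : ε • c = (o + t • w + ε • c) - o - t • w := by abel
      rw [this, ← hx']; module
    rw [div_eq_inv_mul, mul_smul, ← e, smul_smul, inv_mul_cancel₀ hε.ne', one_smul]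
  refine ⟨t, ht, _, hx.symm, hc, ε, hε, fun s h0 h1 => ?_⟩
  obtain ⟨t'', ht'', hx''⟩ := h s h0 h1
  have : t'' = t + s * ((t' - t) / ε) := by
    apply hinj
    simp only at hx''
    rw [← hx, hc] at hx''
    have e : t'' • w = (o + t'' • w) - o := by abel
    rw [e, hx'']; module
  rwa [← this]

lemma segment_eq_linePart (p q : Pt) : segment ℝ p q = linePart p (q - p) (Set.Icc 0 1) := by
  rw [segment_eq_image']; rfl

/-- Rotation by a quarter turn. -/
def quarter (d : Pt) : Pt := (-d.2, d.1)

lemma cr_quarter {d : Pt} (hd : d ≠ 0) : 0 < cr d (quarter d) := by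
  have : cr d (quarter d) = d.1 ^ 2 + d.2 ^ 2 := by simp only [cr, quarter]; ring
  rw [this]
  by_cases h : d.1 = 0
  · have : d.2 ≠ 0 := fun h2 => hd (Prod.ext h h2)
    positivity
  · positivity

lemma quarter_smul (t : ℝ) (d : Pt) : quarter (t • d) = t • quarter d := by
  ext <;> simp [quarter]

/-- A system of arms `o k + t • w k` (`0 ≤ t`, and `t ≤ 1` if `fin k`) with labels `τ`, an edge
`r b` crossing the vertical line `z.1 = c` and a labelling `lam` of the plane, as produced by a
hypothetical situation in which no admissible pair is visible. -/
structure Chase (κ : Type) where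
  o : κ → Pt
  w : κ → Pt
  τ : κ → Prop
  fin : κ → Prop
  r : Pt
  b : Pt
  ou : Pt
  c : ℝ
  lam : Pt → Prop

namespace Chase

variable {κ : Type} (C : Chase κ)

def range (k : κ) : Set ℝ := {t | 0 ≤ t ∧ (C.fin k → t ≤ 1)}

def arm (k : κ) : Set Pt := linePart (C.o k) (C.w k) (C.range k)

def inter (k : κ) : Set Pt := linePart (C.o k) (C.w k) {t | 0 < t ∧ (C.fin k → t < 1)}

def tip (k : κ) : Pt := C.o k + C.w k

def wall : Option (Option κ) → Set Pt
  | none => {z | z.1 = C.c}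
  | some none => segment ℝ C.r C.b
  | some (some k) => C.arm k

def Cross (z : Pt) : Prop := z.1 = C.c ∧ (z ∈ segment ℝ C.r C.b ∨ ∃ k, z ∈ C.inter k)

def Anch (k : κ) : Prop := C.fin k ∧ (C.tip k).1 = C.c

structure Valid : Prop where
  hw : ∀ k, C.w k ≠ 0
  arm_int : ∀ j k z, j ≠ k → z ∈ C.arm j → z ∈ C.inter k → C.fin j ∧ z = C.tip j
  arm_u : ∀ j z, z ∈ C.arm j → z ∈ openSegment ℝ C.r C.b → C.fin j ∧ z = C.tip j
  u_int : ∀ k z, z ∈ segment ℝ C.r C.b → z ∉ C.inter k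
  fin_side : ∀ k, C.Anch k → (C.o k).1 < C.c ∧ C.τ k ∨ C.c < (C.o k).1 ∧ ¬ C.τ k
  int_side : ∀ k z, z ∈ C.inter k → z.1 = C.c →
    C.c < (C.o k).1 ∧ C.τ k ∨ (C.o k).1 < C.c ∧ ¬ C.τ k
  o_off : ∀ k, (C.o k).1 ≠ C.c
  arm_arm : ∀ j k z, j ≠ k → z ∈ C.arm j → z ∈ C.arm k → z.1 ≠ C.c
  arm_seg : ∀ k z, z ∈ C.arm k → z ∈ segment ℝ C.r C.b → z.1 ≠ C.c
  r_left : C.r.1 < C.c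
  b_right : C.c < C.b.1
  ou_mem : C.ou ∈ openSegment ℝ C.r C.b
  ou_on : C.ou.1 = C.c
  below : ∃ k z, z ∈ C.inter k ∧ z.1 = C.c ∧ z.2 < C.ou.2
  const : ConstOff C.wall C.lam
  gate : ∀ x : Pt, x.1 = C.c → (∀ k, x ∉ C.arm k) → x ∉ segment ℝ C.r C.b →
    (∀ v, C.Anch v → ∃ z, C.Cross z ∧
      (x.2 < z.2 ∧ z.2 < (C.tip v).2 ∨ (C.tip v).2 < z.2 ∧ z.2 < x.2)) →
    ∀ z z' : Pt, C.c < z.1 → z'.1 < C.c → x ∈ segment ℝ z z' →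
      (∀ y ∈ segment ℝ z z', (∀ k, y ∉ C.arm k) ∧ y ∉ segment ℝ C.r C.b) → C.lam z → C.lam z'
  germ_o : ∀ k d n, cr d n ≠ 0 → C.τ k → Germ C.lam (C.o k) d n
  germ_o' : ∀ k d n, cr d n ≠ 0 → ¬ C.τ k → Germ (fun z => ¬ C.lam z) (C.o k) d n
  germ_r : ∀ d n, cr d n ≠ 0 → Germ C.lam C.r d n
  germ_b : ∀ d n, cr d n ≠ 0 → Germ (fun z => ¬ C.lam z) C.b d n

/-- The label is `0` and `1` on the two sides of the arm at its tip, in the positive sense. -/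
def Plus (k : κ) : Prop :=
  C.fin k ∧ Germ (fun z => ¬ C.lam z) (C.tip k) (-C.w k) (-quarter (C.w k)) ∧
    Germ C.lam (C.tip k) (-C.w k) (quarter (C.w k))

def Child (k : κ) : Prop := C.Plus k ∧ (C.tip k).1 ≠ C.c

variable {C}

lemma inter_subset (k : κ) : C.inter k ⊆ C.arm k := by
  rintro _ ⟨t, ⟨h1, h2⟩, rfl⟩
  exact ⟨t, ⟨h1.le, fun h => (h2 h).le⟩, rfl⟩

lemma arm_cases {k : κ} {z : Pt} (hz : z ∈ C.arm k) :
    z = C.o k ∨ z ∈ C.inter k ∨ C.fin k ∧ z = C.tip k := by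
  obtain ⟨t, ⟨h1, h2⟩, rfl⟩ := hz
  rcases h1.eq_or_lt with rfl | h1
  · left; simp
  by_cases hf : C.fin k
  · rcases (h2 hf).eq_or_lt with rfl | h3
    · right; right; exact ⟨hf, by simp [tip]⟩
    · right; left; exact ⟨t, ⟨h1, fun _ => h3⟩, rfl⟩
  · right; left; exact ⟨t, ⟨h1, fun h => absurd h hf⟩, rfl⟩

/-- An arm meets the vertical line in at most one point. -/
lemma eq_of_mem_arm {k : κ} (ho : (C.o k).1 ≠ C.c) {z z' : Pt} (hz : z ∈ C.arm k)
    (hz' : z' ∈ C.arm k) (h : z.1 = C.c) (h' : z'.1 = C.c) : z = z' := by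
  obtain ⟨t, _, rfl⟩ := hz
  obtain ⟨t', _, rfl⟩ := hz'
  simp at h h'
  have : (t - t') * (C.w k).1 = 0 := by linarith
  rcases mul_eq_zero.1 this with h0 | h0
  · rw [sub_eq_zero.1 h0]
  · rw [h0] at h; simp at h; exact absurd h ho

section
variable (hC : C.Valid)
include hC

lemma Valid.tip_not_inter (k : κ) (hk : C.fin k) : C.tip k ∉ C.inter k := by
  rintro ⟨t, ⟨_, h2⟩, h⟩
  have : t • C.w k = (1 : ℝ) • C.w k := by
    rw [one_smul]; simpa [tip] using h
  have := smul_left_injective ℝ (hC.hw k) this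
  linarith [h2 hk]

lemma Valid.inter_unique {j k : κ} {z : Pt} (hj : z ∈ C.inter j) (hk : z ∈ C.inter k) : j = k := by
  by_contra hne
  obtain ⟨h1, rfl⟩ := hC.arm_int j k z hne (inter_subset _ hj) hk
  exact hC.tip_not_inter j h1 hj

lemma Valid.arm_cross_unique {k : κ} {z z' : Pt} (hz : z ∈ C.arm k) (hz' : z' ∈ C.arm k)
    (h : z.1 = C.c) (h' : z'.1 = C.c) : z = z' :=
  eq_of_mem_arm (hC.o_off k) hz hz' h h'

lemma Valid.not_anch_of_inter {k : κ} {z : Pt} (hz : z ∈ C.inter k) (h : z.1 = C.c) :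
    ¬ C.Anch k := by
  rintro ⟨hf, ht⟩
  have htip : C.tip k ∈ C.arm k := ⟨1, ⟨by simp, fun _ => by simp⟩, by simp [tip]⟩
  have := hC.arm_cross_unique (inter_subset _ hz) htip h ht
  exact hC.tip_not_inter k hf (this ▸ hz)

lemma Valid.u_cross_unique {z : Pt} (hz : z ∈ segment ℝ C.r C.b) (h : z.1 = C.c) : z = C.ou := by
  obtain ⟨a, b, _, _, hab, rfl⟩ := hz
  obtain ⟨a', b', _, _, hab', he⟩ := hC.ou_mem
  have h1 := hC.ou_on
  have h2 := hC.r_left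
  have h3 := hC.b_right
  rw [← he] at h1 ⊢
  obtain rfl : a = 1 - b := by linarith
  obtain rfl : a' = 1 - b' := by linarith
  simp at h h1
  have : (b - b') * (C.b.1 - C.r.1) = 0 := by linarith
  rcases mul_eq_zero.1 this with h0 | h0
  · rw [sub_eq_zero.1 h0]
  · linarith

lemma Valid.rb_ne : C.b - C.r ≠ 0 := by
  intro h
  have := congrArg Prod.fst h
  have h2 := hC.r_left
  have h3 := hC.b_right
  simp at this; linarith

lemma Valid.isWall (i) : IsWall (C.wall i) := by
  match i with
  | none =>
    refine ⟨isClosed_eq continuous_fst continuous_const, ?_, (C.c, 0), (0, 1), by simp, ?_⟩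
    · intro x hx y hy a b _ _ hab
      simp only [wall, Set.mem_ofPred_eq] at hx hy ⊢
      simp [hx, hy, ← add_mul, hab]
    · intro z hz
      simp only [wall, Set.mem_ofPred_eq] at hz
      simp [cr, hz]
  | some none =>
    rw [wall, segment_eq_linePart]
    exact isWall_linePart hC.rb_ne isClosed_Icc (convex_Icc _ _)
  | some (some k) =>
    refine isWall_linePart (hC.hw k) ?_ ?_
    · by_cases h : C.fin k
      · have : C.range k = Set.Icc 0 1 := by ext; simp [range, h]
        rw [this]; exact isClosed_Icc
      · have : C.range k = Set.Ici 0 := by ext; simp [range, h]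
        rw [this]; exact isClosed_Ici
    · by_cases h : C.fin k
      · have : C.range k = Set.Icc 0 1 := by ext; simp [range, h]
        rw [this]; exact convex_Icc _ _
      · have : C.range k = Set.Ici 0 := by ext; simp [range, h]
        rw [this]; exact convex_Ici _

variable [Finite κ]

/-- A label change along one side of a segment produces an arm ending there. -/
lemma Valid.walk {p q : Pt} (hpq : p ≠ q)
    (hfree : ∀ x ∈ openSegment ℝ p q, ∀ k, x ∈ C.arm k → cr (C.w k) (q - p) ≠ 0 →
      C.fin k ∧ x = C.tip k)
    (hu : ∀ x ∈ openSegment ℝ p q, x ∈ segment ℝ C.r C.b → cr (C.b - C.r) (q - p) = 0)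
    (hl : (∀ x ∈ openSegment ℝ p q, x.1 ≠ C.c) ∨ (q - p).1 = 0)
    (h1 : Germ (fun z => ¬ C.lam z) p (q - p) (quarter (q - p)))
    (h2 : Germ C.lam q (p - q) (quarter (q - p))) :
    ∃ j, C.Plus j ∧ C.tip j ∈ openSegment ℝ p q ∧ 0 < cr (q - p) (-C.w j) := by
  have hd : q - p ≠ 0 := sub_ne_zero.2 hpq.symm
  have hn := cr_quarter hd
  obtain ⟨x, hx, c, i, hc, hr, g1, g2⟩ := exists_ray_of_germ_segment hC.isWall hC.const hn.ne' h1 h2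
  replace hc : 0 < cr (q - p) c := pos_of_mul_pos_right hc hn.le
  match i with
  | none =>
    have hx1 : x.1 = C.c := hr.mem
    rcases hl with hl | hl
    · exact absurd hx1 (hl x hx)
    · obtain ⟨ε, hε, h⟩ := hr
      have : (x + ε • c).1 = C.c := h ε hε.le le_rfl
      simp [hx1, hε.ne'] at this
      simp [cr, hl, this] at hc
  | some none =>
    have hm := hu x hx hr.mem
    rw [wall, segment_eq_linePart] at hr
    obtain ⟨t, ht, γ, _, rfl, _⟩ := linePart_ray hC.rb_ne hr
    rw [cr_smul_right, cr_comm, hm] at hc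
    simp at hc
  | some (some k) =>
    have hm := hfree x hx k hr.mem
    obtain ⟨t, ht, γ, hxt, rfl, ε, hε, hs⟩ := linePart_ray (hC.hw k) hr
    rw [cr_smul_right] at hc
    obtain ⟨hf, rfl⟩ := hm (by rw [cr_comm]; intro h; rw [neg_eq_zero] at h; simp [h] at hc)
    have ht1 : t = 1 := by
      have : t • C.w k = (1 : ℝ) • C.w k := by
        rw [one_smul]; simpa [tip] using hxt.symm
      exact smul_left_injective ℝ (hC.hw k) this
    have hγ : γ < 0 := by
      have := (hs ε hε.le le_rfl).2 hf
      rw [ht1] at this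
      have : γ ≤ 0 := by nlinarith
      refine lt_of_le_of_ne this ?_
      rintro rfl; simp at hc
    have hg : 0 < (-γ)⁻¹ := by rw [inv_pos]; linarith
    have e : -C.w k = (-γ)⁻¹ • (γ • C.w k) := by
      rw [smul_smul]
      have : (-γ)⁻¹ * γ = -1 := by
        have : γ ≠ 0 := hγ.ne
        field_simp
      rw [this]; simp
    have hq := cr_quarter (hC.hw k)
    have h3 : cr (C.w k) (q - p) = - cr (q - p) (C.w k) := cr_comm _ _
    have h4 : cr (C.w k) (p - q) = cr (q - p) (C.w k) := by
      rw [← neg_sub q p, cr_neg_right, h3, neg_neg]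
    have h5 : cr (q - p) (C.w k) < 0 := by by_contra! h; nlinarith
    refine ⟨k, ⟨hf, g1.congr hg e ?_, g2.congr hg e ?_⟩, hx, by simpa using h5⟩
    · rw [cr_smul_left, cr_smul_left, cr_neg_right, h4]
      nlinarith [mul_pos (mul_pos_of_neg_of_neg hγ hγ) (mul_pos_of_neg_of_neg h5 (neg_lt_zero.2 hq))]
    · rw [cr_smul_left, cr_smul_left, h3]
      nlinarith [mul_pos (mul_pos_of_neg_of_neg hγ hγ) (mul_pos_of_neg_of_neg h5 (neg_lt_zero.2 hq))]

end

end Chase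

/-- Germs on the two sides of a wedge agree if all walls through the vertex are vertical or
parallel to `g`. -/
lemma germ_corner {ι : Type*} [Finite ι] {W : ι → Set Pt} {Q : Pt → Prop}
    (hW : ∀ i, IsWall (W i)) (hQ : ConstOff W Q) {x g e : Pt} (hg : g.1 ≠ 0) (he : e.1 = 0)
    (he' : e ≠ 0) (hx : ∀ i c, RayAt (W i) x c → c.1 = 0 ∨ cr g c = 0) :
    (Germ Q x e g → Germ Q x g e) ∧ (Germ Q x g e → Germ Q x e g) := by
  have he2 : e.2 ≠ 0 := fun h => he' (Prod.ext he h)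
  have hcr : cr g e ≠ 0 := by simp [cr, he, hg, he2]
  have hcr' : cr e g ≠ 0 := by rw [cr_comm]; simpa using hcr
  have hfree : ∀ i, ∀ α β : ℝ, 0 < α → 0 < β → ¬ RayAt (W i) x (α • e + β • g) := by
    intro i α β ha hb hr
    rcases hx i _ hr with h | h
    · simp [he, hb.ne', hg] at h
    · simp [ha.ne', hcr] at h
  have hfree' : ∀ i, ∀ α β : ℝ, 0 < α → 0 < β → ¬ RayAt (W i) x (α • g + β • e) := by
    intro i α β ha hb hr
    exact hfree i β α hb ha (by rwa [add_comm])
  constructor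
  · intro h
    exact (germ_or hW hQ x hcr).resolve_right (germ_wedge_of_free hW hQ h hfree)
  · intro h
    exact (germ_or hW hQ x hcr').resolve_right (germ_wedge_of_free hW hQ h hfree')

lemma germ_scale {Q : Pt → Prop} {x d n : Pt} (h : Germ Q x d n) (hd : cr d n ≠ 0) {γ γ' : ℝ}
    (hγ : 0 < γ) (hγ' : 0 < γ') : Germ Q x (γ • d) (γ' • n) := by
  refine h.congr hγ rfl ?_
  have := mul_self_pos.2 hd
  simp only [cr_smul_right]
  nlinarith [mul_pos hγ hγ', mul_pos (mul_pos hγ hγ') this]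

namespace Chase

variable {κ : Type} {C : Chase κ} (hC : C.Valid)
include hC

/-- The walls through a point of an arm on the vertical line. -/
lemma Valid.ray_arm {k : κ} {x : Pt} (hx : x ∈ C.arm k) (hx1 : x.1 = C.c) (i) (c : Pt)
    (hr : RayAt (C.wall i) x c) : c.1 = 0 ∨ cr (C.w k) c = 0 := by
  match i with
  | none =>
    obtain ⟨ε, hε, h⟩ := hr
    have : (x + ε • c).1 = C.c := h ε hε.le le_rfl
    left
    simpa [hx1, hε.ne'] using this
  | some none => exact absurd hx1 (hC.arm_seg k x hx hr.mem)
  | some (some j) =>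
    right
    by_cases hj : j = k
    · subst hj
      obtain ⟨_, _, γ, _, rfl, _⟩ := linePart_ray (hC.hw j) hr
      simp
    · exact absurd hx1 (hC.arm_arm j k x hj hr.mem hx)

/-- The walls through the crossing point of the edge with the vertical line. -/
lemma Valid.ray_ou (i) (c : Pt) (hr : RayAt (C.wall i) C.ou c) :
    c.1 = 0 ∨ cr (C.b - C.r) c = 0 := by
  match i with
  | none =>
    obtain ⟨ε, hε, h⟩ := hr
    have : (C.ou + ε • c).1 = C.c := h ε hε.le le_rfl
    left
    simpa [hC.ou_on, hε.ne'] using this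
  | some none =>
    right
    rw [wall, segment_eq_linePart] at hr
    obtain ⟨_, _, γ, _, rfl, _⟩ := linePart_ray hC.rb_ne hr
    simp
  | some (some j) =>
    exact absurd hC.ou_on (hC.arm_seg j _ hr.mem (openSegment_subset_segment _ _ _ hC.ou_mem))

variable [Finite κ]

/-- A label change along a part of an arm off the vertical line produces a child there. -/
lemma Valid.walk_arm {k : κ} {s t : ℝ} (hst : s ≠ t) (hs : 0 ≤ s) (ht : 0 ≤ t)
    (hs' : C.fin k → s ≤ 1) (ht' : C.fin k → t ≤ 1)
    (hoff : ∀ x ∈ openSegment ℝ (C.o k + s • C.w k) (C.o k + t • C.w k), x.1 ≠ C.c)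
    (h1 : Germ (fun z => ¬ C.lam z) (C.o k + s • C.w k) ((t - s) • C.w k)
      ((t - s) • quarter (C.w k)))
    (h2 : Germ C.lam (C.o k + t • C.w k) ((s - t) • C.w k) ((t - s) • quarter (C.w k))) :
    ∃ j, C.Child j ∧ C.tip j ∈ C.inter k ∧
      C.tip j ∈ openSegment ℝ (C.o k + s • C.w k) (C.o k + t • C.w k) := by
  have hsub : ∀ x ∈ openSegment ℝ (C.o k + s • C.w k) (C.o k + t • C.w k), x ∈ C.inter k := by
    rintro x ⟨a, b, ha, hb, hab, rfl⟩
    refine ⟨a * s + b * t, ⟨?_, fun hf => ?_⟩, ?_⟩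
    · rcases hs.eq_or_lt with rfl | hs
      · have : 0 < t := lt_of_le_of_ne ht hst
        positivity
      · positivity
    · have e1 := hs' hf
      have e2 := ht' hf
      rcases e1.eq_or_lt with rfl | e1
      · have : t < 1 := lt_of_le_of_ne e2 hst.symm
        nlinarith
      · nlinarith
    · have : a = 1 - b := by linarith
      simp only [this]; module
  have e : C.o k + t • C.w k - (C.o k + s • C.w k) = (t - s) • C.w k := by module
  have e' : C.o k + s • C.w k - (C.o k + t • C.w k) = (s - t) • C.w k := by module
  obtain ⟨j, hj, hm, _⟩ := hC.walk (p := C.o k + s • C.w k) (q := C.o k + t • C.w k)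
    (by
      intro h
      rw [← sub_eq_zero, e'] at h
      simp [hC.hw k, sub_eq_zero, hst] at h)
    (fun x hx j hj hne => hC.arm_int j k x (by rintro rfl; simp [e] at hne) hj (hsub x hx))
    (fun x hx hu => absurd (hsub x hx) (hC.u_int k x hu)) (Or.inl hoff)
    (by rwa [e, quarter_smul]) (by rwa [e, e', quarter_smul])
  exact ⟨j, ⟨hj, hoff _ hm⟩, hsub _ hm, hm⟩

lemma Valid.child_of_left {v : κ} (htip : (C.tip v).1 ≤ C.c)
    (ho : (C.o v).1 < C.c) (hτ : C.τ v)
    (h : Germ (fun z => ¬ C.lam z) (C.tip v) (-C.w v) (-quarter (C.w v))) :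
    ∃ Y, C.Child Y ∧ C.tip Y ∈ C.inter v ∧ (C.tip Y).1 < C.c := by
  have hq := cr_quarter (hC.hw v)
  have hlt : ∀ x ∈ openSegment ℝ (C.o v + (1 : ℝ) • C.w v) (C.o v + (0 : ℝ) • C.w v),
      x.1 < C.c := by
    rintro x ⟨a, b, ha, hb, hab, rfl⟩
    simp [tip] at htip ⊢
    have h1 : a * C.c + b * C.c = C.c := by rw [← add_mul, hab, one_mul]
    linarith [mul_le_mul_of_nonneg_left htip ha.le, mul_lt_mul_of_pos_left ho hb]
  obtain ⟨Y, h1, h2, h3⟩ := hC.walk_arm (k := v) (s := 1) (t := 0) (by simp) (by simp) le_rfl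
    (by simp) (by simp) (fun x hx => (hlt x hx).ne) (by simpa [tip] using h)
    (by simpa using hC.germ_o v (C.w v) (-quarter (C.w v)) (by simpa using hq.ne') hτ)
  exact ⟨Y, h1, h2, hlt _ h3⟩

lemma Valid.child_of_right {v : κ} (htip : C.c ≤ (C.tip v).1)
    (ho : C.c < (C.o v).1) (hτ : ¬ C.τ v)
    (h : Germ C.lam (C.tip v) (-C.w v) (quarter (C.w v))) :
    ∃ Y, C.Child Y ∧ C.tip Y ∈ C.inter v ∧ C.c < (C.tip Y).1 := by
  have hq := cr_quarter (hC.hw v)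
  have hlt : ∀ x ∈ openSegment ℝ (C.o v + (0 : ℝ) • C.w v) (C.o v + (1 : ℝ) • C.w v),
      C.c < x.1 := by
    rintro x ⟨a, b, ha, hb, hab, rfl⟩
    simp [tip] at htip ⊢
    have h1 : a * C.c + b * C.c = C.c := by rw [← add_mul, hab, one_mul]
    linarith [mul_le_mul_of_nonneg_left htip hb.le, mul_lt_mul_of_pos_left ho ha]
  obtain ⟨Y, h1, h2, h3⟩ := hC.walk_arm (k := v) (s := 0) (t := 1) (by simp) le_rfl (by simp)
    (by simp) (by simp) (fun x hx => (hlt x hx).ne')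
    (by simpa using hC.germ_o' v (C.w v) (quarter (C.w v)) (by simpa using hq.ne') hτ)
    (by simpa [tip] using h)
  exact ⟨Y, h1, h2, hlt _ h3⟩

/-- A child whose arm does not cross the vertical line has a child. -/
lemma Valid.child_of_child {v : κ} (hv : C.Child v) (hoff : ∀ x ∈ C.inter v, x.1 ≠ C.c) :
    ∃ Y, C.Child Y ∧ C.tip Y ∈ C.inter v := by
  have hq := cr_quarter (hC.hw v)
  obtain ⟨⟨hf, g1, g2⟩, _⟩ := hv
  have hoff' : ∀ x ∈ openSegment ℝ (C.o v + (0 : ℝ) • C.w v) (C.o v + (1 : ℝ) • C.w v),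
      x.1 ≠ C.c := by
    rintro x ⟨a, b, ha, hb, hab, rfl⟩
    refine hoff _ ⟨b, ⟨hb, fun _ => by linarith⟩, ?_⟩
    have : a = 1 - b := by linarith
    simp only [this]; module
  by_cases hτ : C.τ v
  · obtain ⟨Y, h1, h2, h3⟩ := hC.walk_arm (k := v) (s := 1) (t := 0) (by simp) (by simp) le_rfl
      (by simp) (by simp) (by rwa [openSegment_symm]) (by simpa [tip] using g1)
      (by simpa using hC.germ_o v (C.w v) (-quarter (C.w v)) (by simpa using hq.ne') hτ)
    exact ⟨Y, h1, h2⟩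
  · obtain ⟨Y, h1, h2, h3⟩ := hC.walk_arm (k := v) (s := 0) (t := 1) (by simp) le_rfl (by simp)
      (by simp) (by simp) hoff'
      (by simpa using hC.germ_o' v (C.w v) (quarter (C.w v)) (by simpa using hq.ne') hτ)
      (by simpa [tip] using g2)
    exact ⟨Y, h1, h2⟩

/-- A child on the left part of a crossing arm. -/
lemma Valid.child_left {k : κ} {x : Pt} (hx : x ∈ C.inter k) (hx1 : x.1 = C.c)
    (hk : ¬ C.τ k ∨ C.Child k) (hl : Germ C.lam x (0, 1) (-1, 0)) :
    ∃ Y, C.Child Y ∧ C.tip Y ∈ C.inter k ∧ (C.tip Y).1 < C.c := by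
  have hq := cr_quarter (hC.hw k)
  have hrays := hC.ray_arm (inter_subset _ hx) hx1
  have hside := hC.int_side k x hx hx1
  obtain ⟨t, ⟨ht0, ht1⟩, rfl⟩ := id hx
  simp only [Prod.fst_add, Prod.smul_fst, smul_eq_mul] at hx1
  simp only at hl hrays
  have hcorner : ∀ γ γ' : ℝ, γ * (C.w k).1 < 0 → γ * γ' < 0 →
      Germ C.lam (C.o k + t • C.w k) (γ • C.w k) (γ' • quarter (C.w k)) := by
    intro γ γ' hγ hγ'
    have hγ0 : γ ≠ 0 := by rintro rfl; simp at hγ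
    have h1 := (germ_corner hC.isWall hC.const (x := C.o k + t • C.w k) (g := γ • C.w k)
      (e := (0, 1)) (by simpa using hγ.ne) rfl (by simp) (by
        intro i c hr
        rcases hrays i c hr with h | h
        · exact Or.inl h
        · right; simp [h])).1 (hl.congr_side (by simp [cr]; linarith))
    refine h1.congr_side ?_
    simp only [cr_smul_left, cr_smul_right]
    have : γ * cr (C.w k) (0, 1) = γ * (C.w k).1 := by simp [cr]
    rw [this]
    nlinarith [mul_pos (mul_pos_of_neg_of_neg hγ hγ') hq]
  rcases hside with ⟨ho, hτ⟩ | ⟨ho, hτ⟩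
  · have hch := hk.resolve_left (not_not.2 hτ)
    obtain ⟨⟨hf, g1, g2⟩, _⟩ := hch
    have ht1 := ht1 hf
    have hw1 : (C.w k).1 < 0 := by
      by_contra! h
      nlinarith
    have hlt : ∀ x ∈ openSegment ℝ (C.o k + (1 : ℝ) • C.w k) (C.o k + t • C.w k),
        x.1 < C.c := by
      rintro x ⟨a, b, ha, hb, hab, rfl⟩
      simp
      have : b = 1 - a := by linarith
      subst this
      nlinarith [mul_pos ha (sub_pos.2 ht1), mul_pos (mul_pos ha (sub_pos.2 ht1)) (neg_pos.2 hw1)]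
    obtain ⟨Y, h1, h2, h3⟩ := hC.walk_arm (k := k) (s := 1) (t := t) ht1.ne' (by simp) ht0.le
      (by simp) (fun _ => ht1.le) (fun x hx => (hlt x hx).ne)
      (by
        have := germ_scale g1 (by simpa using hq.ne') (sub_pos.2 ht1) (sub_pos.2 ht1)
        convert this using 1
        · simp [tip]
        · module
        · module)
      (hcorner _ _ (by nlinarith) (by nlinarith))
    exact ⟨Y, h1, h2, hlt _ h3⟩
  · have hw1 : 0 < (C.w k).1 := by
      by_contra! h
      nlinarith
    have hlt : ∀ x ∈ openSegment ℝ (C.o k + (0 : ℝ) • C.w k) (C.o k + t • C.w k),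
        x.1 < C.c := by
      rintro x ⟨a, b, ha, hb, hab, rfl⟩
      simp
      have : b = 1 - a := by linarith
      subst this
      nlinarith [mul_pos ha ht0, mul_pos (mul_pos ha ht0) hw1]
    obtain ⟨Y, h1, h2, h3⟩ := hC.walk_arm (k := k) (s := 0) (t := t) ht0.ne le_rfl ht0.le
      (by simp) (fun h => (ht1 h).le) (fun x hx => (hlt x hx).ne)
      (by
        have := germ_scale (hC.germ_o' k (C.w k) (quarter (C.w k)) hq.ne' hτ) hq.ne' ht0 ht0
        simpa using this)
      (hcorner _ _ (by nlinarith) (by nlinarith))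
    exact ⟨Y, h1, h2, hlt _ h3⟩

/-- A child on the right part of a crossing arm. -/
lemma Valid.child_right {k : κ} {x : Pt} (hx : x ∈ C.inter k) (hx1 : x.1 = C.c)
    (hk : C.τ k ∨ C.Child k) (hl : Germ (fun z => ¬ C.lam z) x (0, 1) (1, 0)) :
    ∃ Y, C.Child Y ∧ C.tip Y ∈ C.inter k ∧ C.c < (C.tip Y).1 := by
  have hq := cr_quarter (hC.hw k)
  have hrays := hC.ray_arm (inter_subset _ hx) hx1
  have hside := hC.int_side k x hx hx1
  obtain ⟨t, ⟨ht0, ht1⟩, rfl⟩ := id hx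
  simp only [Prod.fst_add, Prod.smul_fst, smul_eq_mul] at hx1
  simp only at hl hrays
  have hcorner : ∀ γ γ' : ℝ, 0 < γ * (C.w k).1 → 0 < γ * γ' →
      Germ (fun z => ¬ C.lam z) (C.o k + t • C.w k) (γ • C.w k) (γ' • quarter (C.w k)) := by
    intro γ γ' hγ hγ'
    have h1 := (germ_corner hC.isWall hC.const.not (x := C.o k + t • C.w k) (g := γ • C.w k)
      (e := (0, 1)) (by simpa using hγ.ne') rfl (by simp) (by
        intro i c hr
        rcases hrays i c hr with h | h
        · exact Or.inl h
        · right; simp [h])).1 (hl.congr_side (by simp [cr]; linarith))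
    refine h1.congr_side ?_
    simp only [cr_smul_left, cr_smul_right]
    have : γ * cr (C.w k) (0, 1) = γ * (C.w k).1 := by simp [cr]
    rw [this]
    nlinarith [mul_pos (mul_pos hγ hγ') hq]
  rcases hside with ⟨ho, hτ⟩ | ⟨ho, hτ⟩
  · have hw1 : (C.w k).1 < 0 := by
      by_contra! h
      nlinarith
    have hlt : ∀ x ∈ openSegment ℝ (C.o k + t • C.w k) (C.o k + (0 : ℝ) • C.w k),
        C.c < x.1 := by
      rintro x ⟨a, b, ha, hb, hab, rfl⟩
      simp
      have : a = 1 - b := by linarith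
      subst this
      nlinarith [mul_pos hb ht0, mul_pos (mul_pos hb ht0) (neg_pos.2 hw1)]
    obtain ⟨Y, h1, h2, h3⟩ := hC.walk_arm (k := k) (s := t) (t := 0) ht0.ne' ht0.le le_rfl
      (fun h => (ht1 h).le) (by simp) (fun x hx => (hlt x hx).ne')
      (hcorner _ _ (by nlinarith) (by nlinarith))
      (by
        have := germ_scale (hC.germ_o k (C.w k) (-quarter (C.w k)) (by simpa using hq.ne') hτ)
          (by simpa using hq.ne') ht0 ht0
        simpa using this)
    exact ⟨Y, h1, h2, hlt _ h3⟩
  · have hch := hk.resolve_left hτ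
    obtain ⟨⟨hf, g1, g2⟩, _⟩ := hch
    have ht1 := ht1 hf
    have hw1 : 0 < (C.w k).1 := by
      by_contra! h
      nlinarith
    have hlt : ∀ x ∈ openSegment ℝ (C.o k + t • C.w k) (C.o k + (1 : ℝ) • C.w k),
        C.c < x.1 := by
      rintro x ⟨a, b, ha, hb, hab, rfl⟩
      simp
      have : a = 1 - b := by linarith
      subst this
      nlinarith [mul_pos hb (sub_pos.2 ht1), mul_pos (mul_pos hb (sub_pos.2 ht1)) hw1]
    obtain ⟨Y, h1, h2, h3⟩ := hC.walk_arm (k := k) (s := t) (t := 1) ht1.ne ht0.le (by simp)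
      (fun _ => ht1.le) (by simp) (fun x hx => (hlt x hx).ne')
      (hcorner _ _ (by nlinarith) (by nlinarith))
      (by
        have := germ_scale g2 (by simpa using hq.ne') (sub_pos.2 ht1) (sub_pos.2 ht1)
        convert this using 1
        · simp [tip]
        · module)
    exact ⟨Y, h1, h2, hlt _ h3⟩

end Chase

namespace Chase

variable {κ : Type} {C : Chase κ}

/-- No crossing of the vertical line has height strictly between `s` and `t`. -/
def NoCross (C : Chase κ) (s t : ℝ) : Prop := ∀ z, C.Cross z → ¬ (s < z.2 ∧ z.2 < t)

/-- `w` is responsible for `Y`: the arm of `Y` ends on `w`, or on an arm anchored on the vertical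
line just above the crossing point of `w`. -/
def Host (C : Chase κ) (Y w : κ) : Prop :=
  ∃ v, C.tip Y ∈ C.inter v ∧ (v = w ∧ ¬ C.Anch w ∨
    C.Anch v ∧ ∃ x ∈ C.inter w, x.1 = C.c ∧ x.2 < (C.tip v).2 ∧ C.NoCross x.2 (C.tip v).2)

lemma tip_arm {v : κ} : C.tip v ∈ C.arm v := ⟨1, ⟨by simp, fun _ => by simp⟩, by simp [tip]⟩

variable (hC : C.Valid)
include hC

lemma Valid.host_unique {Y w w' : κ} (h : C.Host Y w) (h' : C.Host Y w') : w = w' := by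
  obtain ⟨v, hv, h⟩ := h
  obtain ⟨v', hv', h'⟩ := h'
  obtain rfl := hC.inter_unique hv hv'
  rcases h with ⟨rfl, h⟩ | ⟨h, x, hx, hx1, hx2, hx3⟩ <;>
    rcases h' with ⟨rfl, h'⟩ | ⟨h', x', hx', hx1', hx2', hx3'⟩
  · rfl
  · exact absurd h' h
  · exact absurd h h'
  · have e : x = x' := by
      refine Prod.ext (hx1.trans hx1'.symm) (le_antisymm ?_ ?_)
      · by_contra! h
        exact hx3' x ⟨hx1, Or.inr ⟨_, hx⟩⟩ ⟨h, hx2⟩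
      · by_contra! h
        exact hx3 x' ⟨hx1', Or.inr ⟨_, hx'⟩⟩ ⟨h, hx2'⟩
    subst e
    exact hC.inter_unique hx hx'

variable [Finite κ]

/-- A label change along the vertical line between crossings. -/
lemma Valid.walk_vertical {p q : Pt} (hpq : p.2 ≠ q.2) (hp : p.1 = C.c) (hq : q.1 = C.c)
    (hno : ∀ x ∈ openSegment ℝ p q, ¬ C.Cross x)
    (h1 : Germ (fun z => ¬ C.lam z) p (q - p) (quarter (q - p)))
    (h2 : Germ C.lam q (p - q) (quarter (q - p))) :
    ∃ j, C.Plus j ∧ C.tip j ∈ openSegment ℝ p q ∧ 0 < cr (q - p) (-C.w j) := by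
  have hon : ∀ x ∈ openSegment ℝ p q, x.1 = C.c := by
    rintro x ⟨a, b, _, _, hab, rfl⟩
    simp [hp, hq, ← add_mul, hab]
  refine hC.walk (by rintro rfl; exact hpq rfl) ?_ ?_ (Or.inr (by simp [hp, hq])) h1 h2
  · intro x hx k hk _
    rcases arm_cases hk with rfl | h | h
    · exact absurd (hon _ hx) (hC.o_off k)
    · exact absurd ⟨hon _ hx, Or.inr ⟨k, h⟩⟩ (hno x hx)
    · exact h
  · intro x hx h
    exact absurd ⟨hon _ hx, Or.inl h⟩ (hno x hx)

/-- The left side of the vertical line between two points. -/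
lemma Valid.anch_left {p q : Pt} (hpq : p.2 < q.2) (hp : p.1 = C.c) (hq : q.1 = C.c)
    (hno : C.NoCross p.2 q.2) (h1 : Germ (fun z => ¬ C.lam z) p (0, 1) (-1, 0))
    (h2 : Germ C.lam q (0, -1) (-1, 0)) :
    ∃ v, C.Anch v ∧ p.2 < (C.tip v).2 ∧ (C.tip v).2 < q.2 ∧
      ∃ Y, C.Child Y ∧ C.tip Y ∈ C.inter v ∧ (C.tip Y).1 < C.c := by
  have hd : 0 < q.2 - p.2 := sub_pos.2 hpq
  have e : q - p = (q.2 - p.2) • ((0, 1) : Pt) := by ext <;> simp [hp, hq]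
  have e' : p - q = (q.2 - p.2) • ((0, -1) : Pt) := by ext <;> simp [hp, hq]
  have e'' : quarter (q - p) = (q.2 - p.2) • ((-1, 0) : Pt) := by
    rw [e, quarter_smul]; simp [quarter]
  have hmem : ∀ x ∈ openSegment ℝ p q, x.1 = C.c ∧ p.2 < x.2 ∧ x.2 < q.2 := by
    rintro x ⟨a, b, ha, hb, hab, rfl⟩
    have : a = 1 - b := by linarith
    subst this
    refine ⟨by simp [hp, hq]; ring, ?_, ?_⟩ <;> simp <;> nlinarith
  obtain ⟨v, ⟨hf, g1, g2⟩, hv, hs⟩ := hC.walk_vertical hpq.ne hp hq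
    (fun x hx hc => hno x hc (hmem x hx).2)
    (by rw [e'', e]; exact germ_scale h1 (by simp [cr]) hd hd)
    (by rw [e'', e']; exact germ_scale h2 (by simp [cr]) hd hd)
  obtain ⟨hv1, hv2, hv3⟩ := hmem _ hv
  have hw : 0 < (C.w v).1 := by
    rw [e] at hs
    simp [cr] at hs
    by_contra! h
    nlinarith
  have ho : (C.o v).1 < C.c := by
    simp [tip] at hv1; linarith
  have hτ : C.τ v := by
    rcases hC.fin_side v ⟨hf, hv1⟩ with h | h
    · exact h.2
    · linarith [h.1]
  exact ⟨v, ⟨hf, hv1⟩, hv2, hv3, hC.child_of_left hv1.le ho hτ g1⟩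

/-- The right side of the vertical line between two points. -/
lemma Valid.anch_right {p q : Pt} (hpq : p.2 < q.2) (hp : p.1 = C.c) (hq : q.1 = C.c)
    (hno : C.NoCross p.2 q.2) (h1 : Germ C.lam p (0, 1) (1, 0))
    (h2 : Germ (fun z => ¬ C.lam z) q (0, -1) (1, 0)) :
    ∃ v, C.Anch v ∧ p.2 < (C.tip v).2 ∧ (C.tip v).2 < q.2 ∧
      ∃ Y, C.Child Y ∧ C.tip Y ∈ C.inter v ∧ C.c < (C.tip Y).1 := by
  have hd : 0 < q.2 - p.2 := sub_pos.2 hpq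
  have e : q - p = (q.2 - p.2) • ((0, 1) : Pt) := by ext <;> simp [hp, hq]
  have e' : p - q = (q.2 - p.2) • ((0, -1) : Pt) := by ext <;> simp [hp, hq]
  have e'' : quarter (p - q) = (q.2 - p.2) • ((1, 0) : Pt) := by
    rw [e', quarter_smul]; simp [quarter]
  have hmem : ∀ x ∈ openSegment ℝ q p, x.1 = C.c ∧ p.2 < x.2 ∧ x.2 < q.2 := by
    rintro x ⟨a, b, ha, hb, hab, rfl⟩
    have : a = 1 - b := by linarith
    subst this
    refine ⟨by simp [hp, hq]; ring, ?_, ?_⟩ <;> simp <;> nlinarith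
  obtain ⟨v, ⟨hf, g1, g2⟩, hv, hs⟩ := hC.walk_vertical hpq.ne' hq hp
    (fun x hx hc => hno x hc (hmem x hx).2)
    (by rw [e'', e']; exact germ_scale h2 (by simp [cr]) hd hd)
    (by rw [e'', e]; exact germ_scale h1 (by simp [cr]) hd hd)
  obtain ⟨hv1, hv2, hv3⟩ := hmem _ hv
  have hw : (C.w v).1 < 0 := by
    rw [e'] at hs
    simp [cr] at hs
    by_contra! h
    nlinarith
  have ho : C.c < (C.o v).1 := by
    simp [tip] at hv1; linarith
  have hτ : ¬ C.τ v := by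
    rcases hC.fin_side v ⟨hf, hv1⟩ with h | h
    · linarith [h.1]
    · exact h.2
  exact ⟨v, ⟨hf, hv1⟩, hv2, hv3, hC.child_of_right hv1.ge ho hτ g2⟩

/-- If the labels above a crossing point violate the gate condition, an arm is anchored there. -/
lemma Valid.exists_anch {k : κ} {x : Pt} (hx : x ∈ C.inter k) (hx1 : x.1 = C.c)
    (h1 : Germ (fun z => ¬ C.lam z) x (0, 1) (-1, 0)) (h2 : Germ C.lam x (0, 1) (1, 0)) :
    ∃ v, C.Anch v ∧ x.2 < (C.tip v).2 ∧ C.NoCross x.2 (C.tip v).2 := by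
  by_contra! hcon
  have hxa := inter_subset _ hx
  obtain ⟨ε1, hε1, h1⟩ := h1
  obtain ⟨ε2, hε2, h2⟩ := h2
  obtain ⟨ε3, hε3, h3⟩ := exists_small_ball hC.isWall x
  -- heights of crossings above `x`
  obtain ⟨ε4, hε4, h4⟩ : ∃ ε > 0, ∀ z, C.Cross z → x.2 < z.2 → x.2 + ε ≤ z.2 := by
    obtain ⟨ε, hε, h⟩ := exists_small (ι := Option κ) (P := fun i ε => ∀ z : Pt, z.1 = C.c →
        (match i with | none => z ∈ segment ℝ C.r C.b | some k => z ∈ C.arm k) →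
        x.2 < z.2 → x.2 + ε ≤ z.2) (by
      intro i
      by_cases hi : ∃ z : Pt, z.1 = C.c ∧
          (match i with | none => z ∈ segment ℝ C.r C.b | some k => z ∈ C.arm k) ∧ x.2 < z.2
      · obtain ⟨z, hz1, hz2, hz3⟩ := hi
        refine ⟨z.2 - x.2, by linarith, fun δ _ hδ z' hz1' hz2' hz3' => ?_⟩
        have : z' = z := by
          match i with
          | none => rw [hC.u_cross_unique hz2 hz1, hC.u_cross_unique hz2' hz1']
          | some k => exact hC.arm_cross_unique hz2' hz2 hz1' hz1
        rw [this]; linarith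
      · push Not at hi
        exact ⟨1, one_pos, fun δ _ _ z h1 h2 h3 => absurd (hi z h1 h2) (not_le.2 h3)⟩)
    refine ⟨ε, hε, ?_⟩
    rintro z ⟨hz1, hz2 | ⟨j, hz2⟩⟩ hz3
    · exact h none z hz1 hz2 hz3
    · exact h (some j) z hz1 (inter_subset _ hz2) hz3
  obtain ⟨σ, hσ, s1, s2, s3, s4⟩ : ∃ σ > 0, σ < ε1 ∧ σ < ε2 ∧ σ < ε3 ∧ σ < ε4 := by
    refine ⟨min (min ε1 ε2) (min ε3 ε4) / 2, by positivity, ?_, ?_, ?_, ?_⟩ <;>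
    · have : 0 < min (min ε1 ε2) (min ε3 ε4) := by positivity
      have := min_le_left (min ε1 ε2) (min ε3 ε4)
      have := min_le_right (min ε1 ε2) (min ε3 ε4)
      have := min_le_left ε1 ε2
      have := min_le_right ε1 ε2
      have := min_le_left ε3 ε4
      have := min_le_right ε3 ε4
      linarith
  set y : Pt := x + σ • (0, 1) with hy
  have hy1 : y.1 = C.c := by simp [hy, hx1]
  have hy2 : y.2 = x.2 + σ := by simp [hy]
  have hyx : y ≠ x := by intro h; rw [h] at hy2; linarith
  have hyw : ∀ i, i ≠ none → y ∉ C.wall i := by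
    intro i hi hyi
    have hxi : x ∈ C.wall i := by
      by_contra hxi
      exact h3 i hxi y (by simpa [hy] using hε3) (by rw [hy2]; simp [abs_of_pos hσ, s3]) hyi
    match i with
    | none => exact hi rfl
    | some none => exact hC.u_int k x hxi hx
    | some (some j) => exact hyx (hC.arm_cross_unique hyi hxi hy1 hx1)
  obtain ⟨ε5, hε5, h5⟩ := exists_small_ball hC.isWall y
  obtain ⟨τ, hτ, t1, t2, t3⟩ : ∃ τ > 0, τ < ε1 * σ ∧ τ < ε2 * σ ∧ τ < ε5 := by
    refine ⟨min (min (ε1 * σ) (ε2 * σ)) ε5 / 2, by positivity, ?_, ?_, ?_⟩ <;>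
    · have : 0 < min (min (ε1 * σ) (ε2 * σ)) ε5 := by positivity
      have := min_le_left (min (ε1 * σ) (ε2 * σ)) ε5
      have := min_le_right (min (ε1 * σ) (ε2 * σ)) ε5
      have := min_le_left (ε1 * σ) (ε2 * σ)
      have := min_le_right (ε1 * σ) (ε2 * σ)
      linarith
  have hl := h1 σ τ hσ s1 hτ t1
  have hr := h2 σ τ hσ s2 hτ t2
  refine hl (hC.gate y hy1 (fun j => hyw (some (some j)) (by simp)) (hyw (some none) (by simp))
    ?_ (x + σ • (0, 1) + τ • (1, 0)) (x + σ • (0, 1) + τ • (-1, 0)) ?_ ?_ ?_ ?_ hr)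
  · intro v hv
    rcases lt_trichotomy (C.tip v).2 x.2 with h | h | h
    · exact ⟨x, ⟨hx1, Or.inr ⟨k, hx⟩⟩, Or.inr ⟨h, by rw [hy2]; linarith⟩⟩
    · exfalso
      have e : C.tip v = x := Prod.ext (hv.2.trans hx1.symm) h
      have : v = k := by
        by_contra hne
        exact hC.arm_arm v k x hne (e ▸ tip_arm) hxa hx1
      subst this
      exact hC.not_anch_of_inter hx hx1 hv
    · have := hcon v hv h
      simp only [NoCross] at this
      push Not at this
      obtain ⟨z, hz, hz1, hz2⟩ := this
      exact ⟨z, hz, Or.inl ⟨by rw [hy2]; linarith [h4 z hz hz1], hz2⟩⟩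
  · simp [hx1, hτ]
  · simp [hx1, hτ]
  · exact ⟨1 / 2, 1 / 2, by norm_num, by norm_num, by norm_num, by rw [hy]; ext <;> simp <;> ring⟩
  · intro z hz
    have hzz : |z.1 - y.1| < ε5 ∧ z.2 = y.2 := by
      obtain ⟨a, b, ha, hb, hab, rfl⟩ := hz
      have : a = 1 - b := by linarith
      subst this
      constructor
      · rw [hy, abs_lt]; simp; constructor <;> nlinarith
      · rw [hy]; simp; ring
    have h6 : |z.2 - y.2| < ε5 := by rw [hzz.2]; simpa using hε5
    exact ⟨fun j => h5 (some (some j)) (hyw _ (by simp)) z hzz.1 h6,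
      h5 (some none) (hyw _ (by simp)) z hzz.1 h6⟩

/-- Every child is responsible for another child. -/
lemma Valid.exists_hosted {k : κ} (hk : C.Child k) : ∃ Y, C.Child Y ∧ C.Host Y k := by
  by_cases hoff : ∀ x ∈ C.inter k, x.1 ≠ C.c
  · obtain ⟨Y, h1, h2⟩ := hC.child_of_child hk hoff
    exact ⟨Y, h1, k, h2, Or.inl ⟨rfl, fun h => hk.2 h.2⟩⟩
  push Not at hoff
  obtain ⟨x, hx, hx1⟩ := hoff
  have hna := hC.not_anch_of_inter hx hx1
  have hup : cr ((0, 1) : Pt) (-1, 0) ≠ 0 := by simp [cr]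
  have hup' : cr ((0, 1) : Pt) (1, 0) ≠ 0 := by simp [cr]
  rcases germ_or hC.isWall hC.const x hup with g1 | g1
  · obtain ⟨Y, h1, h2, _⟩ := hC.child_left hx hx1 (Or.inr hk) g1
    exact ⟨Y, h1, k, h2, Or.inl ⟨rfl, hna⟩⟩
  rcases germ_or hC.isWall hC.const x hup' with g2 | g2
  swap
  · obtain ⟨Y, h1, h2, _⟩ := hC.child_right hx hx1 (Or.inr hk) g2
    exact ⟨Y, h1, k, h2, Or.inl ⟨rfl, hna⟩⟩
  obtain ⟨v, hv, hxv, hno⟩ := hC.exists_anch hx hx1 g1 g2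
  have hq := cr_quarter (hC.hw v)
  have htip := hv.2
  rw [tip, Prod.fst_add] at htip
  have fin : ∀ v', C.Anch v' → x.2 < (C.tip v').2 → (C.tip v').2 ≤ (C.tip v).2 →
      ∀ Y, C.tip Y ∈ C.inter v' → C.Host Y k := by
    intro v' hv' h3 h4 Y hY
    exact ⟨v', hY, Or.inr ⟨hv', x, hx, hx1, h3, fun z hz h => hno z hz ⟨h.1, h.2.trans_le h4⟩⟩⟩
  rcases hC.fin_side v hv with ⟨ho, hτ⟩ | ⟨ho, hτ⟩
  · have hdown : cr ((0, -1) : Pt) (-1, 0) ≠ 0 := by simp [cr]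
    have hw : 0 < (C.w v).1 := by linarith
    rcases germ_or hC.isWall hC.const (C.tip v) hdown with g3 | g3
    · obtain ⟨v', hv', h3, h4, Y, hY, hY', _⟩ := hC.anch_left hxv hx1 hv.2 hno g1 g3
      exact ⟨Y, hY, fin v' hv' h3 h4.le Y hY'⟩
    · obtain ⟨Y, hY, hY', _⟩ := hC.child_of_left hv.2.le ho hτ (by
        have := (germ_corner hC.isWall hC.const.not (x := C.tip v) (g := -C.w v) (e := (0, -1))
          (by simpa using hw.ne') rfl (by simp) (by
            intro i c hr
            rcases hC.ray_arm tip_arm hv.2 i c hr with h | h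
            · exact Or.inl h
            · right; simp [h])).1 (g3.congr_side (by simp [cr]; linarith))
        refine this.congr_side ?_
        have e : cr (-C.w v) (0, -1) = (C.w v).1 := by simp [cr]
        rw [e]; simp; positivity)
      exact ⟨Y, hY, fin v hv hxv le_rfl Y hY'⟩
  · have hdown : cr ((0, -1) : Pt) (1, 0) ≠ 0 := by simp [cr]
    have hw : (C.w v).1 < 0 := by linarith
    rcases germ_or hC.isWall hC.const (C.tip v) hdown with g3 | g3
    swap
    · obtain ⟨v', hv', h3, h4, Y, hY, hY', _⟩ := hC.anch_right hxv hx1 hv.2 hno g2 g3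
      exact ⟨Y, hY, fin v' hv' h3 h4.le Y hY'⟩
    · obtain ⟨Y, hY, hY', _⟩ := hC.child_of_right hv.2.ge ho hτ (by
        have := (germ_corner hC.isWall hC.const (x := C.tip v) (g := -C.w v) (e := (0, -1))
          (by simpa using hw.ne) rfl (by simp) (by
            intro i c hr
            rcases hC.ray_arm tip_arm hv.2 i c hr with h | h
            · exact Or.inl h
            · right; simp [h])).1 (g3.congr_side (by simp [cr]; linarith))
        refine this.congr_side ?_
        have e : cr (-C.w v) (0, -1) = (C.w v).1 := by simp [cr]
        rw [e, cr_neg_left]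
        nlinarith)
      exact ⟨Y, hY, fin v hv hxv le_rfl Y hY'⟩

lemma Valid.host_of_child : (∀ Y, C.Child Y → ∃ k, C.Child k ∧ C.Host Y k) ∧
    ∀ Y Y' k, C.Child Y → C.Child Y' → C.Host Y k → C.Host Y' k → Y = Y' := by
  choose f hf using fun k : {k // C.Child k} => hC.exists_hosted k.2
  let g : {k // C.Child k} → {k // C.Child k} := fun k => ⟨f k, (hf k).1⟩
  have hg : Function.Injective g := by
    intro k k' h
    have h1 := (hf k).2
    have h2 := (hf k').2
    have : f k = f k' := congrArg Subtype.val h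
    rw [← this] at h2
    exact Subtype.ext (hC.host_unique h1 h2)
  have hs := Finite.surjective_of_injective hg
  have key : ∀ Y, C.Child Y → ∃ k : {k // C.Child k}, f k = Y := by
    intro Y hY
    obtain ⟨k, hk⟩ := hs ⟨Y, hY⟩
    exact ⟨k, congrArg Subtype.val hk⟩
  refine ⟨fun Y hY => ?_, fun Y Y' k hY hY' h h' => ?_⟩
  · obtain ⟨k, rfl⟩ := key Y hY
    exact ⟨k, k.2, (hf k).2⟩
  · obtain ⟨j, rfl⟩ := key Y hY
    obtain ⟨j', rfl⟩ := key Y' hY'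
    have e1 := hC.host_unique h (hf j).2
    have e2 := hC.host_unique h' (hf j').2
    rw [Subtype.ext (e1.symm.trans e2)]

lemma Valid.no_child_u {Y : κ} (hY : C.Child Y) (h : C.tip Y ∈ segment ℝ C.r C.b) : False := by
  obtain ⟨k, _, v, hv, _⟩ := hC.host_of_child.1 Y hY
  exact hC.u_int v _ h hv

/-- Along the halves of the crossing edge the labels below do not change. -/
lemma Valid.walk_u {p q : Pt} {γ : ℝ} (hγ : 0 < γ) (hpq : q - p = γ • (C.r - C.b))
    (hp : p ∈ segment ℝ C.r C.b) (hq : q ∈ segment ℝ C.r C.b)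
    (hoff : ∀ x ∈ openSegment ℝ p q, x.1 ≠ C.c)
    (h1 : Germ (fun z => ¬ C.lam z) p (C.r - C.b) (0, -1))
    (h2 : Germ C.lam q (C.b - C.r) (0, -1)) : False := by
  have hr := hC.r_left
  have hbr := hC.b_right
  have hsub := (openSegment_subset_segment ℝ p q).trans ((convex_segment C.r C.b).segment_subset hp hq)
  have hopen : ∀ x ∈ openSegment ℝ p q, x ∈ openSegment ℝ C.r C.b := by
    intro x hx
    obtain ⟨a, b, ha, hb, hab, rfl⟩ := hx
    obtain ⟨s, t, hs, ht, hst, rfl⟩ := hp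
    obtain ⟨s', t', hs', ht', hst', rfl⟩ := hq
    have e1 := congrArg Prod.fst hpq
    obtain rfl : s = 1 - t := by linarith
    obtain rfl : s' = 1 - t' := by linarith
    simp at e1
    have e2 : t - t' = γ := by
      have : (t - t' - γ) * (C.b.1 - C.r.1) = 0 := by linarith
      rcases mul_eq_zero.1 this with h | h
      · linarith
      · linarith
    have : a = 1 - b := by linarith
    subst this
    refine ⟨(1 - b) * (1 - t) + b * (1 - t'), (1 - b) * t + b * t', by nlinarith, by nlinarith,
      by ring, by module⟩
  have hne : C.r - C.b ≠ 0 := by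
    rw [← neg_sub]; exact neg_ne_zero.2 hC.rb_ne
  have hq := cr_quarter hne
  have hpq' : p - q = γ • (C.b - C.r) := by
    rw [← neg_sub, hpq, ← smul_neg, neg_sub]
  have hrb : 0 < C.b.1 - C.r.1 := by linarith
  obtain ⟨Y, hY, hm, _⟩ := hC.walk (p := p) (q := q)
    (by
      rintro rfl
      rw [sub_self] at hpq
      exact (smul_ne_zero hγ.ne' hne) hpq.symm)
    (fun x hx k hk _ => hC.arm_u k x hk (hopen x hx))
    (fun x _ _ => by
      rw [hpq, cr_smul_right, ← neg_sub C.r C.b, cr_neg_left, cr_self]; simp) (Or.inl hoff)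
    (by
      rw [hpq, quarter_smul]
      refine germ_scale (h1.congr_side ?_) hq.ne' hγ hγ
      have : cr (C.r - C.b) (0, -1) = C.b.1 - C.r.1 := by simp [cr]
      rw [this]; positivity)
    (by
      rw [hpq', hpq, quarter_smul]
      have e : cr (C.b - C.r) (quarter (C.r - C.b)) = - cr (C.r - C.b) (quarter (C.r - C.b)) := by
        rw [← neg_sub C.r C.b, cr_neg_left]
      refine germ_scale (h2.congr_side ?_) (by rw [e]; exact neg_ne_zero.2 hq.ne') hγ hγ
      have : cr (C.b - C.r) (0, -1) = -(C.b.1 - C.r.1) := by simp [cr]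
      rw [this, e]; nlinarith)
  exact hC.no_child_u ⟨hY, hoff _ hm⟩ (hsub hm)

/-- The labels just below the crossing edge. -/
lemma Valid.labels_u : Germ C.lam C.ou (0, -1) (-1, 0) ∧
    Germ (fun z => ¬ C.lam z) C.ou (0, -1) (1, 0) := by
  obtain ⟨a, b, ha, hb, hab, he⟩ := hC.ou_mem
  have hm := openSegment_subset_segment ℝ _ _ hC.ou_mem
  have hou := hC.ou_on
  have hr := hC.r_left
  have hbr := hC.b_right
  have hq : cr (C.b - C.r) (0, -1) ≠ 0 := by
    have : cr (C.b - C.r) (0, -1) = -(C.b.1 - C.r.1) := by simp [cr]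
    rw [this]; linarith
  have hq' : cr (C.r - C.b) (0, -1) ≠ 0 := by
    rw [← neg_sub C.b C.r, cr_neg_left]; exact neg_ne_zero.2 hq
  have ea : C.ou - C.b = a • (C.r - C.b) := by
    have : b = 1 - a := by linarith
    rw [← he, this]; module
  have eb : C.r - C.ou = b • (C.r - C.b) := by
    have : a = 1 - b := by linarith
    rw [← he, this]; module
  constructor
  · refine (germ_or hC.isWall hC.const C.ou (by simp [cr])).resolve_right fun h => ?_
    refine hC.walk_u hb eb hm (left_mem_segment _ _ _) ?_ ?_ (hC.germ_r _ _ hq)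
    · rintro x ⟨s, t, hs, ht, hst, rfl⟩
      have : s = 1 - t := by linarith
      subst this
      simp [hou]
      nlinarith
    · refine (germ_corner hC.isWall hC.const.not (g := C.r - C.b) (e := (0, -1)) ?_ rfl (by simp)
        ?_).1 (h.congr_side ?_)
      · simp; linarith
      · intro i c hrc
        refine (hC.ray_ou i c hrc).imp_right fun h => ?_
        rw [← neg_sub, cr_neg_left, h, neg_zero]
      · simp [cr]; linarith
  · refine (germ_or hC.isWall hC.const C.ou (by simp [cr])).resolve_left fun h => ?_
    refine hC.walk_u ha ea (right_mem_segment _ _ _) hm ?_ (hC.germ_b _ _ hq') ?_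
    · rintro x ⟨s, t, hs, ht, hst, rfl⟩
      have : s = 1 - t := by linarith
      subst this
      simp [hou]
      nlinarith
    · refine (germ_corner hC.isWall hC.const (g := C.b - C.r) (e := (0, -1)) ?_ rfl (by simp)
        hC.ray_ou).1 (h.congr_side ?_)
      · simp; linarith
      · simp [cr]; linarith

/-- The hypothetical situation is impossible. -/
theorem Valid.false : False := by
  -- the highest arm crossing below the edge
  obtain ⟨k, x, hx, hx1, hx2, hno⟩ : ∃ k x, x ∈ C.inter k ∧ x.1 = C.c ∧ x.2 < C.ou.2 ∧
      C.NoCross x.2 C.ou.2 := by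
    have hfin : {k | ∃ z, z ∈ C.inter k ∧ z.1 = C.c ∧ z.2 < C.ou.2}.Finite := Set.toFinite _
    have hne : hfin.toFinset.Nonempty := by
      obtain ⟨k, z, h⟩ := hC.below
      exact ⟨k, hfin.mem_toFinset.2 ⟨z, h⟩⟩
    have hex : ∀ k, ∃ z : Pt, k ∈ hfin.toFinset → z ∈ C.inter k ∧ z.1 = C.c ∧ z.2 < C.ou.2 := by
      intro k
      by_cases hk : k ∈ hfin.toFinset
      · obtain ⟨z, hz⟩ := hfin.mem_toFinset.1 hk
        exact ⟨z, fun _ => hz⟩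
      · exact ⟨0, fun h => absurd h hk⟩
    choose f hf using hex
    obtain ⟨k, hk, hmax⟩ := Finset.exists_max_image _ (fun k => (f k).2) hne
    refine ⟨k, f k, (hf k hk).1, (hf k hk).2.1, (hf k hk).2.2, ?_⟩
    rintro z ⟨hz1, hz | ⟨j, hz⟩⟩ ⟨h1, h2⟩
    · rw [hC.u_cross_unique hz hz1] at h2; exact lt_irrefl _ h2
    · have hj : j ∈ hfin.toFinset := hfin.mem_toFinset.2 ⟨z, hz, hz1, h2⟩
      have h3 := hmax j hj
      have := hC.arm_cross_unique (inter_subset _ hz) (inter_subset _ (hf j hj).1) hz1 (hf j hj).2.1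
      rw [← this] at h3
      linarith
  obtain ⟨u1, u2⟩ := hC.labels_u
  have hna := hC.not_anch_of_inter hx hx1
  have left : (¬ C.τ k ∨ C.Child k) → ∃ Y, C.Child Y ∧ C.Host Y k ∧ (C.tip Y).1 < C.c := by
    intro hk
    rcases germ_or hC.isWall hC.const x (d := (0, 1)) (n := (-1, 0)) (by simp [cr]) with g | g
    · obtain ⟨Y, h1, h2, h3⟩ := hC.child_left hx hx1 hk g
      exact ⟨Y, h1, ⟨k, h2, Or.inl ⟨rfl, hna⟩⟩, h3⟩
    · obtain ⟨v, hv, h1, h2, Y, h3, h4, h5⟩ := hC.anch_left hx2 hx1 hC.ou_on hno g u1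
      exact ⟨Y, h3, ⟨v, h4, Or.inr ⟨hv, x, hx, hx1, h1, fun z hz h => hno z hz
        ⟨h.1, h.2.trans h2⟩⟩⟩, h5⟩
  have right : (C.τ k ∨ C.Child k) → ∃ Y, C.Child Y ∧ C.Host Y k ∧ C.c < (C.tip Y).1 := by
    intro hk
    rcases germ_or hC.isWall hC.const x (d := (0, 1)) (n := (1, 0)) (by simp [cr]) with g | g
    · obtain ⟨v, hv, h1, h2, Y, h3, h4, h5⟩ := hC.anch_right hx2 hx1 hC.ou_on hno g u2
      exact ⟨Y, h3, ⟨v, h4, Or.inr ⟨hv, x, hx, hx1, h1, fun z hz h => hno z hz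
        ⟨h.1, h.2.trans h2⟩⟩⟩, h5⟩
    · obtain ⟨Y, h1, h2, h3⟩ := hC.child_right hx hx1 hk g
      exact ⟨Y, h1, ⟨k, h2, Or.inl ⟨rfl, hna⟩⟩, h3⟩
  have hchild : C.Child k := by
    by_cases hτ : C.τ k
    · obtain ⟨Y, hY, hh, _⟩ := right (Or.inl hτ)
      obtain ⟨j, hj, hj'⟩ := hC.host_of_child.1 Y hY
      rwa [hC.host_unique hh hj']
    · obtain ⟨Y, hY, hh, _⟩ := left (Or.inl hτ)
      obtain ⟨j, hj, hj'⟩ := hC.host_of_child.1 Y hY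
      rwa [hC.host_unique hh hj']
  obtain ⟨Y, hY, hh, h3⟩ := left (Or.inr hchild)
  obtain ⟨Y', hY', hh', h3'⟩ := right (Or.inr hchild)
  obtain rfl := hC.host_of_child.2 Y Y' k hY hY' hh hh'
  exact lt_asymm h3 h3'

end Chase

section Visibility

variable {ι : Type*} [Finite ι] {W : ι → Set Pt}

/-- `z` is an inner point of a nondegenerate segment in `T`. -/
def TwoSided (T : Set Pt) (z : Pt) : Prop := ∃ d : Pt, d ≠ 0 ∧ z + d ∈ T ∧ z - d ∈ T

/-- The segment from `p` to `q`, without `p` but with `q`, avoids the walls. -/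
def Free (W : ι → Set Pt) (p q : Pt) : Prop := ∀ t : ℝ, 0 < t → t ≤ 1 → ∀ i, p + t • (q - p) ∉ W i

lemma TwoSided.small {T : Set Pt} (hT : Convex ℝ T) {z d : Pt} (h1 : z + d ∈ T) (h2 : z - d ∈ T)
    {t : ℝ} (ht0 : 0 ≤ t) (ht1 : t ≤ 1) : z + t • d ∈ T := by
  have := hT h1 h2 (show 0 ≤ (1 + t) / 2 by linarith) (show 0 ≤ (1 - t) / 2 by linarith) (by ring)
  convert this using 1
  module

lemma exists_move {α β γ δ : ℝ} (hα : 0 < α) (hαβ : α + β < 1) (hβ : 0 ≤ β) (hδ : 0 ≤ δ) :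
    ∃ t : ℝ, 0 < t ∧ t ≤ 1 ∧ 0 ≤ α + t * γ ∧ 0 ≤ β + t * δ ∧ α + t * γ + (β + t * δ) ≤ 1 := by
  set μ := min α (1 - α - β)
  have h1 : μ ≤ α := min_le_left _ _
  have h2 : μ ≤ 1 - α - β := min_le_right _ _
  have hμ : 0 < μ := lt_min hα (by linarith)
  have hg := abs_nonneg γ
  have hK : 0 < |γ| + δ + 1 := by linarith
  have e : μ / (|γ| + δ + 1) * (|γ| + δ + 1) = μ := by field_simp
  set t := μ / (|γ| + δ + 1)
  have ht : 0 < t := by positivity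
  have g1 := neg_abs_le γ
  have g2 := le_abs_self γ
  refine ⟨t, ht, ?_, ?_, by positivity, ?_⟩ <;> nlinarith

/-- The hits of the walls in the triangle `p q z`, in the affine coordinates of the triangle. -/
def hits (W : ι → Set Pt) (p q z : Pt) : Set (ℝ × ℝ) :=
  {x | 0 ≤ x.1 ∧ 0 ≤ x.2 ∧ x.1 + x.2 ≤ 1 ∧ ∃ i, p + x.1 • (q - p) + x.2 • (z - p) ∈ W i}

lemma isCompact_hits (hW : ∀ i, IsWall (W i)) (p q z : Pt) : IsCompact (hits W p q z) := by
  refine (isCompact_Icc (a := ((0 : ℝ), (0 : ℝ))) (b := (1, 1))).of_isClosed_subset ?_ ?_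
  · have hu : IsClosed (⋃ i, W i) := isClosed_iUnion_of_finite fun i => (hW i).closed
    have hc : Continuous fun x : ℝ × ℝ => p + x.1 • (q - p) + x.2 • (z - p) := by fun_prop
    have : hits W p q z = ({x | 0 ≤ x.1} ∩ {x | 0 ≤ x.2} ∩ {x | x.1 + x.2 ≤ 1} ∩
        (fun x : ℝ × ℝ => p + x.1 • (q - p) + x.2 • (z - p)) ⁻¹' (⋃ i, W i)) := by
      ext x
      simp [hits, and_assoc]
    rw [this]
    refine ((IsClosed.inter ?_ ?_).inter ?_).inter (hu.preimage hc)
    · exact isClosed_le continuous_const continuous_fst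
    · exact isClosed_le continuous_const continuous_snd
    · exact isClosed_le (continuous_fst.add continuous_snd) continuous_const
  · rintro ⟨a, b⟩ ⟨h1, h2, h3, _⟩
    simp only at h1 h2 h3
    exact ⟨⟨h1, h2⟩, ⟨by simp only; linarith, by simp only; linarith⟩⟩

section Triangle

variable (hW : ∀ i, IsWall (W i)) (hE : ∀ i, ∀ z ∈ W i, ∃ j, TwoSided (W j) z) {p q z : Pt}
  (hcr : cr (q - p) (z - p) ≠ 0)

include hW hE hcr in
/-- Pushing a hit in the interior of the triangle along the wall. -/
lemma hits_move {x : ℝ × ℝ} (hx : x ∈ hits W p q z) (h1 : 0 < x.1) (h2 : x.1 + x.2 < 1) :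
    (∃ y ∈ hits W p q z, x.2 < y.2 ∨ x.2 = y.2 ∧ x.1 < y.1) ∧
    ((∃ y ∈ hits W p q z, x.2 < y.2) ∨ ∃ j, ∃ d : Pt, d ≠ 0 ∧ cr (q - p) d = 0 ∧
      p + x.1 • (q - p) + x.2 • (z - p) + d ∈ W j ∧
      p + x.1 • (q - p) + x.2 • (z - p) - d ∈ W j) := by
  obtain ⟨_, h3, _, i, hi⟩ := hx
  obtain ⟨j, d, hd, hd1, hd2⟩ := hE i _ hi
  set P := p + x.1 • (q - p) + x.2 • (z - p) with hP
  -- choose the sign of the direction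
  obtain ⟨d', hd', e1, e2, γ, δ, hcomb, hsgn⟩ : ∃ d' : Pt, d' ≠ 0 ∧ P + d' ∈ W j ∧ P - d' ∈ W j ∧
      ∃ γ δ : ℝ, d' = γ • (q - p) + δ • (z - p) ∧ (0 < δ ∨ δ = 0 ∧ 0 < γ) := by
    have hc := eq_comb_of_cr_ne hcr d
    set γ := cr d (z - p) / cr (q - p) (z - p)
    set δ := cr (q - p) d / cr (q - p) (z - p)
    have hneg : -d = (-γ) • (q - p) + (-δ) • (z - p) := by
      conv_lhs => rw [hc]
      module
    rcases lt_trichotomy δ 0 with h | h | h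
    · exact ⟨-d, neg_ne_zero.2 hd, by rwa [← sub_eq_add_neg], by rwa [sub_neg_eq_add], -γ, -δ,
        hneg, Or.inl (by linarith)⟩
    · rcases lt_trichotomy γ 0 with h' | h' | h'
      · exact ⟨-d, neg_ne_zero.2 hd, by rwa [← sub_eq_add_neg], by rwa [sub_neg_eq_add], -γ, -δ,
          hneg, Or.inr ⟨by linarith, by linarith⟩⟩
      · exfalso
        rw [h, h'] at hc
        exact hd (by simpa using hc)
      · exact ⟨d, hd, hd1, hd2, γ, δ, hc, Or.inr ⟨h, h'⟩⟩
    · exact ⟨d, hd, hd1, hd2, γ, δ, hc, Or.inl h⟩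
  have hδ : 0 ≤ δ := by rcases hsgn with h | h <;> linarith
  obtain ⟨t, ht0, ht1, m1, m2, m3⟩ := exists_move (γ := γ) h1 h2 h3 hδ
  have hmem : (x.1 + t * γ, x.2 + t * δ) ∈ hits W p q z := by
    refine ⟨m1, m2, m3, j, ?_⟩
    have := TwoSided.small (hW j).convex e1 e2 ht0.le ht1
    convert this using 1
    rw [hcomb, hP]; module
  refine ⟨⟨_, hmem, ?_⟩, ?_⟩
  · rcases hsgn with h | ⟨h, h'⟩
    · left; simp only; nlinarith
    · right; simp only [h]; constructor
      · ring
      · nlinarith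
  · rcases hsgn with h | ⟨h, h'⟩
    · left; refine ⟨_, hmem, ?_⟩; simp only; nlinarith
    · right
      refine ⟨j, d', hd', ?_, e1, e2⟩
      rw [hcomb, h]; simp

include hW hE hcr in
/-- Two sides of the triangle are free of walls: no wall meets the interior. -/
lemma hits_base (h1 : Free W p z) (h2 : Free W q z) {x : ℝ × ℝ} (hx : x ∈ hits W p q z) :
    x.2 = 0 := by
  by_contra hne
  have hpos : 0 < x.2 := lt_of_le_of_ne hx.2.1 (Ne.symm hne)
  obtain ⟨y, hy, hmax⟩ := (isCompact_hits hW p q z).exists_isMaxOn ⟨x, hx⟩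
    continuous_snd.continuousOn
  have hyx : x.2 ≤ y.2 := hmax hx
  have hc2 : IsCompact (hits W p q z ∩ {w | w.2 = y.2}) :=
    (isCompact_hits hW p q z).inter_right (isClosed_eq continuous_snd continuous_const)
  obtain ⟨w, ⟨hw, hwy⟩, hmax2⟩ := hc2.exists_isMaxOn ⟨y, hy, rfl⟩ continuous_fst.continuousOn
  simp only [Set.mem_ofPred_eq] at hwy
  obtain ⟨g1, g2, g3, i, hi⟩ := hw
  have hα : 0 < w.1 := by
    rcases g1.eq_or_lt with h | h
    · exfalso
      refine h1 w.2 (by linarith) (by linarith) i ?_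
      rw [← h] at hi
      simpa using hi
    · exact h
  have hαβ : w.1 + w.2 < 1 := by
    rcases g3.eq_or_lt with h | h
    · exfalso
      refine h2 w.2 (by linarith) (by linarith) i ?_
      have : w.1 = 1 - w.2 := by linarith
      rw [this] at hi
      convert hi using 1
      module
    · exact h
  obtain ⟨⟨v, hv, h⟩, _⟩ := hits_move hW hE hcr ⟨g1, g2, g3, i, hi⟩ hα hαβ
  have hv2 : v.2 ≤ y.2 := hmax hv
  rcases h with h | ⟨h, h'⟩
  · linarith
  · have : v.1 ≤ w.1 := hmax2 ⟨hv, by simp only [Set.mem_ofPred_eq]; linarith⟩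
    linarith

end Triangle

lemma free_collinear {p q z : Pt} (hpq : p ≠ q) (hcr : cr (q - p) (z - p) = 0) (h1 : Free W p z)
    (h2 : Free W q z) {t : ℝ} (ht0 : 0 < t) (ht1 : t < 1) (i : ι) : p + t • (q - p) ∉ W i := by
  intro hi
  obtain ⟨s, hs⟩ := exists_smul_of_cr_eq_zero (sub_ne_zero.2 hpq.symm) hcr
  have hz : z = p + s • (q - p) := by rw [← hs]; abel
  rcases le_or_gt t s with hts | hts
  · have hs0 : 0 < s := by linarith
    refine h1 (t / s) (by positivity) ((div_le_one hs0).2 hts) i ?_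
    rwa [hs, smul_smul, div_mul_cancel₀ _ hs0.ne']
  · have hs1 : 0 < 1 - s := by linarith
    refine h2 ((1 - t) / (1 - s)) (by apply div_pos <;> linarith)
      ((div_le_one hs1).2 (by linarith)) i ?_
    have e : z - q = (-(1 - s)) • (q - p) := by rw [hz]; module
    rw [e, smul_smul]
    have e2 : (1 - t) / (1 - s) * -(1 - s) = t - 1 := by field_simp; ring
    rw [e2]
    convert hi using 1
    module

/-- Walls met by the open segment `p q` contain a piece of that segment, if `p` and `q` are both
visible from `z`. -/
lemma hit_parallel (hW : ∀ i, IsWall (W i)) (hE : ∀ i, ∀ z ∈ W i, ∃ j, TwoSided (W j) z)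
    {p q z : Pt} (hpq : p ≠ q) (h1 : Free W p z) (h2 : Free W q z) {t : ℝ} (ht0 : 0 < t)
    (ht1 : t < 1) {i : ι} (hi : p + t • (q - p) ∈ W i) :
    ∃ j, ∃ d : Pt, d ≠ 0 ∧ cr (q - p) d = 0 ∧ p + t • (q - p) + d ∈ W j ∧
      p + t • (q - p) - d ∈ W j := by
  by_cases hcr : cr (q - p) (z - p) = 0
  · exact absurd hi (free_collinear hpq hcr h1 h2 ht0 ht1 i)
  have hx : ((t, 0) : ℝ × ℝ) ∈ hits W p q z :=
    ⟨ht0.le, le_rfl, by simp only; linarith, i, by simpa using hi⟩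
  obtain ⟨_, ⟨y, hy, h⟩ | ⟨j, d, h3, h4, h5, h6⟩⟩ :=
    hits_move hW hE hcr hx ht0 (by simp only; linarith)
  · have := hits_base hW hE hcr h1 h2 hy
    simp only at h; linarith
  · exact ⟨j, d, h3, h4, by simpa using h5, by simpa using h6⟩

/-- Visibility from a fixed point is invariant along free segments. -/
lemma Free.extend (hW : ∀ i, IsWall (W i)) (hE : ∀ i, ∀ z ∈ W i, ∃ j, TwoSided (W j) z)
    {p q z : Pt} (hpq : p ≠ q) (h1 : Free W p z) (h2 : Free W q z) (hq : ∀ i, q ∉ W i) :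
    Free W p q := by
  intro t ht0 ht1 i hi
  rcases ht1.eq_or_lt with rfl | ht1
  · exact hq i (by simpa using hi)
  by_cases hcr : cr (q - p) (z - p) = 0
  · exact absurd hi (free_collinear hpq hcr h1 h2 ht0 ht1 i)
  have hx : ((t, 0) : ℝ × ℝ) ∈ hits W p q z :=
    ⟨ht0.le, le_rfl, by simp only; linarith, i, by simpa using hi⟩
  obtain ⟨y, hy, hmax⟩ := (isCompact_hits hW p q z).exists_isMaxOn ⟨_, hx⟩
    continuous_fst.continuousOn
  have hty : t ≤ y.1 := hmax hx
  have hy2 := hits_base hW hE hcr h1 h2 hy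
  have hy1 : y.1 < 1 := by
    obtain ⟨_, _, h3, k, hk⟩ := hy
    rw [hy2, add_zero] at h3
    rcases h3.eq_or_lt with h | h
    · exfalso
      rw [h, hy2] at hk
      exact hq k (by simpa using hk)
    · exact h
  obtain ⟨⟨v, hv, h⟩, _⟩ := hits_move hW hE hcr hy (by linarith) (by linarith)
  have hv2 := hits_base hW hE hcr h1 h2 hv
  have : v.1 ≤ y.1 := hmax hv
  rcases h with h | ⟨_, h⟩ <;> linarith

/-- Every point sees the points of a thin sector. -/
lemma germ_free (hW : ∀ i, IsWall (W i)) (x : Pt) {d n : Pt} (hdn : cr d n ≠ 0) :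
    Germ (fun z => Free W x z) x d n := by
  obtain ⟨ε, hε, h⟩ := exists_small (P := fun i ε => ∀ σ τ : ℝ, 0 < σ → σ < ε → 0 < τ → τ < ε * σ →
    x + σ • d + τ • n ∉ W i) fun i => by
      obtain ⟨ε, hε, h⟩ := (hW i).sector_free (x := x) hdn
      exact ⟨ε, hε, fun δ h0 h1 σ τ a b c e => h σ τ a (by linarith) c (by nlinarith)⟩
  refine ⟨ε, hε, fun σ τ h1 h2 h3 h4 t ht0 ht1 i hi => ?_⟩
  refine h i (t * σ) (t * τ) (by positivity) (by nlinarith) (by positivity) (by nlinarith) ?_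
  convert hi using 1
  module

end Visibility

section Elongation

variable {V : Type*} {X : V → ℝ → Pt} {St : V → Set Pt}

/-- The rays `t ↦ X v t`, `v ∈ S`, are cut at time `s v` (if `fin v`) so that they do not
penetrate the obstacles and one another, and are only cut where they hit something. -/
structure Elong (X : V → ℝ → Pt) (St : V → Set Pt) (S : Set V) (fin : V → Prop) (s : V → ℝ) :
    Prop where
  pos : ∀ v, 0 < s v
  hit : ∀ v ∈ S, fin v → X v (s v) ∈ St v ∨
    ∃ u ∈ S, u ≠ v ∧ ∃ t > 0, (fin u → t < s u) ∧ X u t = X v (s v)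
  avoid : ∀ v ∈ S, ∀ t > 0, (fin v → t < s v) → X v t ∉ St v
  cross : ∀ u ∈ S, ∀ v ∈ S, u ≠ v → ∀ t > 0, ∀ t' > 0, X u t = X v t' → (fin u → t < s u) →
    fin v ∧ s v ≤ t'

variable (hst : ∀ v, {t : ℝ | 0 < t ∧ X v t ∈ St v}.Finite)
  (hray : ∀ u v, u ≠ v → {t : ℝ | 0 < t ∧ ∃ t' > 0, X u t' = X v t}.Finite)
  (htie : ∀ u v, u ≠ v → ∀ t > 0, ∀ t' > 0, X u t' = X v t → X u t' ∈ St u → X v t ∈ St v)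

include hst hray htie in
lemma exists_elong_insert [Finite V] {S : Set V} {fin : V → Prop} {s : V → ℝ}
    (h : Elong X St S fin s) {v : V} (hv : v ∉ S) :
    ∃ fin' s', Elong X St (insert v S) fin' s' := by
  set H : Set ℝ := {t | 0 < t ∧ (X v t ∈ St v ∨ ∃ u ∈ S, ∃ t' > 0, (fin u → t' ≤ s u) ∧
    X u t' = X v t)} with hH
  have hfinH : H.Finite := by
    refine ((hst v).union (Set.finite_iUnion fun u : {u // u ≠ v} => hray u v u.2)).subset ?_
    rintro t ⟨h0, h | ⟨u, hu, t', h1, _, h2⟩⟩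
    · exact Or.inl ⟨h0, h⟩
    · exact Or.inr (Set.mem_iUnion.2 ⟨⟨u, fun e => hv (e ▸ hu)⟩, h0, t', h1, h2⟩)
  obtain ⟨f, m, hm0, hfm, hmin⟩ : ∃ (f : Prop) (m : ℝ), 0 < m ∧ (f → m ∈ H) ∧
      ∀ t ∈ H, f ∧ m ≤ t := by
    by_cases hne : H.Nonempty
    · obtain ⟨m, hm, hmin⟩ := hfinH.exists_minimalFor id H hne
      refine ⟨True, m, hm.1, fun _ => hm, fun t ht => ⟨trivial, ?_⟩⟩
      by_contra hlt
      exact hlt (hmin ht (not_le.1 hlt).le)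
    · exact ⟨False, 1, one_pos, False.elim, fun t ht => absurd ⟨t, ht⟩ hne⟩
  have hne : ∀ u ∈ S, u ≠ v := fun u hu e => hv (e ▸ hu)
  refine ⟨fun u => if u = v then f else fin u, fun u => if u = v then m else s u, ?_, ?_, ?_, ?_⟩
  · intro u
    by_cases hu : u = v
    · simpa [hu] using hm0
    · simpa [hu] using h.pos u
  · have old : ∀ u ∈ S, fin u → X u (s u) ∈ St u ∨ ∃ w ∈ insert v S, w ≠ u ∧ ∃ t > 0,
        ((if w = v then f else fin w) → t < if w = v then m else s w) ∧ X w t = X u (s u) := by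
      intro u hu hf
      refine (h.hit u hu hf).imp_right ?_
      rintro ⟨w, hw, hwu, t, ht, h1, h2⟩
      exact ⟨w, Or.inr hw, hwu, t, ht, by simpa [hne w hw] using h1, h2⟩
    rintro u (rfl | hu) hf
    · simp only [if_true] at hf ⊢
      obtain ⟨_, h1 | ⟨w, hw, t', ht', h1, h2⟩⟩ := hfm hf
      · exact Or.inl h1
      · by_cases hlt : fin w → t' < s w
        · exact Or.inr ⟨w, Or.inr hw, hne w hw, t', ht', by simpa [hne w hw] using hlt, h2⟩
        · push Not at hlt
          have e : t' = s w := le_antisymm (h1 hlt.1) hlt.2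
          subst e
          rcases h.hit w hw hlt.1 with h3 | ⟨y, hy, hyw, t, ht, h3, h4⟩
          · exact Or.inl (htie w u (hne w hw) m hm0 _ ht' h2 h3)
          · exact Or.inr ⟨y, Or.inr hy, hne y hy, t, ht, by simpa [hne y hy] using h3,
              h4.trans h2⟩
    · simp only [hne u hu, if_false] at hf ⊢
      exact old u hu hf
  · rintro u (rfl | hu) t ht hlt
    · simp only [if_true] at hlt
      intro hmem
      obtain ⟨h1, h2⟩ := hmin t ⟨ht, Or.inl hmem⟩
      linarith [hlt h1]
    · simp only [hne u hu, if_false] at hlt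
      exact h.avoid u hu t ht hlt
  · rintro u hu w hw huw t ht t' ht' he hlt
    rcases hu with rfl | hu
    · rcases hw with rfl | hw
      · exact absurd rfl huw
      · simp only [if_true] at hlt
        simp only [hne w hw, if_false]
        by_contra hcon
        obtain ⟨h1, h2⟩ := hmin t ⟨ht, Or.inr ⟨w, hw, t', ht', fun hf => by
          by_contra hh; exact hcon ⟨hf, (not_le.1 hh).le⟩, he.symm⟩⟩
        linarith [hlt h1]
    · simp only [hne u hu, if_false] at hlt
      rcases hw with rfl | hw
      · simp only [if_true]
        exact hmin t' ⟨ht', Or.inr ⟨u, hu, t, ht, fun hf => (hlt hf).le, he⟩⟩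
      · simp only [hne w hw, if_false]
        exact h.cross u hu w hw huw t ht t' ht' he hlt

include hst hray htie in
/-- The rays can be cut so that they do not penetrate one another. -/
lemma exists_elong [Finite V] : ∃ fin s, Elong X St Set.univ fin s := by
  have : ∀ S : Set V, ∃ fin s, Elong X St S fin s := by
    intro S
    induction S, Set.toFinite S using Set.Finite.induction_on with
    | empty => exact ⟨fun _ => False, fun _ => 1, by simp, by simp, by simp, by simp⟩
    | insert hv _ ih =>
      obtain ⟨fin, s, h⟩ := ih
      exact exists_elong_insert hst hray htie h hv
  exact this _

end Elongation

/-- `p` is an endpoint of an edge of `M`. -/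
def Vert (M : Finset (Pt × Pt)) (p : Pt) : Prop := ∃ e ∈ M, p = e.1 ∨ p = e.2

/-- The line of the edge `e = (b, r)`, parametrized from `r` (if `i`) or from `b` (if not `i`) in
the direction away from the edge. -/
def beyond (e : Pt × Pt) : Bool → ℝ → Pt
  | true, t => e.2 + t • (e.2 - e.1)
  | false, t => e.1 + t • (e.1 - e.2)

lemma beyond_not (e : Pt × Pt) (i : Bool) (t : ℝ) : beyond e (!i) t = beyond e i (-1 - t) := by
  cases i <;> simp only [beyond, Bool.not_true, Bool.not_false] <;> module

lemma beyond_sub (e : Pt × Pt) (i : Bool) (s t : ℝ) :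
    beyond e i s - beyond e i t = (s - t) • (beyond e i 1 - beyond e i 0) := by
  cases i <;> simp only [beyond] <;> module

lemma beyond_inj {e : Pt × Pt} (he : e.1 ≠ e.2) {i : Bool} {s t : ℝ}
    (h : beyond e i s = beyond e i t) : s = t := by
  have h1 := beyond_sub e i s t
  rw [h, sub_self] at h1
  have h2 : beyond e i 1 - beyond e i 0 ≠ 0 := by
    cases i <;> simp [beyond, sub_eq_zero, he, he.symm]
  rcases smul_eq_zero.1 h1.symm with h3 | h3
  · linarith
  · exact absurd h3 h2

lemma beyond_line (e : Pt × Pt) (i : Bool) (t : ℝ) : cr (beyond e i t - e.1) (e.2 - e.1) = 0 := by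
  cases i
  · have : beyond e false t - e.1 = (-t) • (e.2 - e.1) := by simp only [beyond]; module
    rw [this, cr_smul_left, cr_self, mul_zero]
  · have : beyond e true t - e.1 = (1 + t) • (e.2 - e.1) := by simp only [beyond]; module
    rw [this, cr_smul_left, cr_self, mul_zero]

lemma segment_line {p q z : Pt} (h : z ∈ segment ℝ p q) : cr (z - p) (q - p) = 0 := by
  rw [segment_eq_image'] at h
  obtain ⟨t, _, rfl⟩ := h
  simp [-cr_sub_left, -cr_sub_right]

lemma beyond_mem_segment {e : Pt × Pt} {i : Bool} {t : ℝ} (h1 : -1 ≤ t) (h2 : t ≤ 0) :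
    beyond e i t ∈ segment ℝ e.1 e.2 := by
  cases i
  · refine ⟨1 + t, -t, by linarith, by linarith, by ring, ?_⟩
    simp only [beyond]; module
  · refine ⟨-t, 1 + t, by linarith, by linarith, by ring, ?_⟩
    simp only [beyond]; module

lemma mem_segment_beyond {e : Pt × Pt} (i : Bool) {z : Pt} (h : z ∈ segment ℝ e.1 e.2) :
    ∃ t : ℝ, -1 ≤ t ∧ t ≤ 0 ∧ z = beyond e i t := by
  obtain ⟨a, b, ha, hb, hab, rfl⟩ := h
  cases i
  · refine ⟨-b, by linarith, by linarith, ?_⟩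
    obtain rfl : a = 1 - b := by linarith
    simp only [beyond]; module
  · refine ⟨-a, by linarith, by linarith, ?_⟩
    obtain rfl : b = 1 - a := by linarith
    simp only [beyond]; module

lemma beyond_not_mem_segment {e : Pt × Pt} (he : e.1 ≠ e.2) {i : Bool} {t : ℝ} (h : 0 < t) :
    beyond e i t ∉ segment ℝ e.1 e.2 := by
  intro hz
  obtain ⟨s, _, hs, h1⟩ := mem_segment_beyond i hz
  have := beyond_inj he h1
  linarith

lemma endpoint_of_not_open {p q z : Pt} (h : z ∈ segment ℝ p q) (h' : z ∉ openSegment ℝ p q) :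
    z = p ∨ z = q := by
  obtain ⟨a, b, ha, hb, hab, rfl⟩ := h
  rcases ha.eq_or_lt with rfl | ha
  · right; rw [zero_add] at hab; simp [hab]
  rcases hb.eq_or_lt with rfl | hb
  · left; rw [add_zero] at hab; simp [hab]
  exact absurd ⟨a, b, ha, hb, hab, rfl⟩ h'

lemma left_not_mem_open {p q : Pt} (h : p ≠ q) : p ∉ openSegment ℝ p q := by
  rw [left_mem_openSegment_iff]; exact h

lemma right_not_mem_open {p q : Pt} (h : p ≠ q) : q ∉ openSegment ℝ p q := by
  rw [right_mem_openSegment_iff]; exact h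

/-- A growing family of arcs: `M` is a plane matching with edges `(b, r)`, `u` is its only edge from
a red point left of the line `z.1 = c` to a blue point on the right, `A ∋ u` is the set of edges
reached so far, and the arcs `D` join red points of `A` to blue points of `A`. -/
structure Conf (c : ℝ) (M A D : Finset (Pt × Pt)) (u : Pt × Pt) : Prop where
  gen : ∀ p q r, Vert M p → Vert M q → Vert M r → p ≠ q → p ≠ r → q ≠ r → cr (q - p) (r - p) ≠ 0
  blue_inj : ∀ e ∈ M, ∀ f ∈ M, e.1 = f.1 → e = f
  red_inj : ∀ e ∈ M, ∀ f ∈ M, e.2 = f.2 → e = f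
  colour : ∀ e ∈ M, ∀ f ∈ M, e.1 ≠ f.2
  plane : ∀ e ∈ M, ∀ f ∈ M, e ≠ f → ∀ z ∈ segment ℝ e.1 e.2, z ∉ segment ℝ f.1 f.2
  off : ∀ p, Vert M p → p.1 ≠ c
  lines : ∀ p q p' q', Vert M p → Vert M q → Vert M p' → Vert M q' → p ≠ q → p' ≠ q' → ∀ z : Pt,
    z.1 = c → cr (z - p) (q - p) = 0 → cr (z - p') (q' - p') = 0 →
    p' = p ∧ q' = q ∨ p' = q ∧ q' = p
  uM : u ∈ M
  u_left : u.2.1 < c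
  u_right : c < u.1.1
  uniq : ∀ e ∈ M, e.2.1 < c → c < e.1.1 → e = u
  AM : A ⊆ M
  uA : u ∈ A
  arc : ∀ d ∈ D, ∃ e ∈ A, ∃ f ∈ A, f ≠ u ∧ e ≠ f ∧ d = (f.1, e.2)
  arc_side : ∀ d ∈ D, ¬ (d.2.1 < c ∧ c < d.1.1)
  arc_edge : ∀ d ∈ D, ∀ e ∈ M, ∀ z ∈ openSegment ℝ d.1 d.2, z ∉ segment ℝ e.1 e.2
  arc_arc : ∀ d ∈ D, ∀ d' ∈ D, d ≠ d' → ∀ z ∈ openSegment ℝ d.1 d.2, z ∉ segment ℝ d'.1 d'.2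

namespace Conf

variable {c : ℝ} {M A D : Finset (Pt × Pt)} {u : Pt × Pt} (hC : Conf c M A D u)
include hC

lemma edge_ne {e : Pt × Pt} (he : e ∈ M) : e.1 ≠ e.2 := hC.colour e he e he

omit hC in
lemma vert_left {e : Pt × Pt} (he : e ∈ M) : Vert M e.1 := ⟨e, he, Or.inl rfl⟩

omit hC in
lemma vert_right {e : Pt × Pt} (he : e ∈ M) : Vert M e.2 := ⟨e, he, Or.inr rfl⟩

lemma arc_vert_left {d : Pt × Pt} (hd : d ∈ D) : Vert M d.1 := by
  obtain ⟨e, he, f, hf, _, _, rfl⟩ := hC.arc d hd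
  exact ⟨f, hC.AM hf, Or.inl rfl⟩

lemma arc_vert_right {d : Pt × Pt} (hd : d ∈ D) : Vert M d.2 := by
  obtain ⟨e, he, f, hf, _, _, rfl⟩ := hC.arc d hd
  exact ⟨e, hC.AM he, Or.inr rfl⟩

lemma arc_ne {d : Pt × Pt} (hd : d ∈ D) : d.1 ≠ d.2 := by
  obtain ⟨e, he, f, hf, _, _, rfl⟩ := hC.arc d hd
  exact hC.colour f (hC.AM hf) e (hC.AM he)

/-- An arc does not have the endpoints of an edge. -/
lemma arc_not_edge {d e : Pt × Pt} (hd : d ∈ D) (he : e ∈ M) :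
    ¬ (d.1 = e.1 ∧ d.2 = e.2 ∨ d.1 = e.2 ∧ d.2 = e.1) := by
  obtain ⟨g, hg, f, hf, _, hgf, rfl⟩ := hC.arc d hd
  rintro (⟨h1, h2⟩ | ⟨h1, h2⟩)
  · exact hgf ((hC.red_inj g (hC.AM hg) e he h2).trans (hC.blue_inj f (hC.AM hf) e he h1).symm)
  · exact hC.colour f (hC.AM hf) e he h1

lemma vert_on_edge {q : Pt} {e : Pt × Pt} (hq : Vert M q) (he : e ∈ M)
    (h : q ∈ segment ℝ e.1 e.2) : q = e.1 ∨ q = e.2 := by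
  obtain ⟨f, hf, h'⟩ := hq
  have hqf : q ∈ segment ℝ f.1 f.2 := by
    rcases h' with rfl | rfl
    · exact left_mem_segment _ _ _
    · exact right_mem_segment _ _ _
  by_cases hef : e = f
  · rwa [hef]
  · exact absurd hqf (hC.plane e he f hf hef q h)

lemma vert_beyond {e : Pt × Pt} (he : e ∈ M) (i : Bool) : Vert M (beyond e i 0) := by
  cases i
  · simpa [beyond] using vert_left he
  · simpa [beyond] using vert_right he

/-- Vertices on the line of an edge are its endpoints. -/
lemma vert_on_line {q : Pt} {e : Pt × Pt} (hq : Vert M q) (he : e ∈ M)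
    (h : cr (q - e.1) (e.2 - e.1) = 0) : q = e.1 ∨ q = e.2 := by
  by_contra hcon
  push Not at hcon
  exact hC.gen e.1 q e.2 (vert_left he) hq (vert_right he) hcon.1.symm (hC.edge_ne he) hcon.2 h

/-- The lines of different edges do not meet on the vertical line. -/
lemma edge_edge_off {e f : Pt × Pt} (he : e ∈ M) (hf : f ∈ M) (hef : e ≠ f) {z : Pt}
    (h1 : cr (z - e.1) (e.2 - e.1) = 0) (h2 : cr (z - f.1) (f.2 - f.1) = 0) : z.1 ≠ c := by
  intro hz
  rcases hC.lines _ _ _ _ (vert_left he) (vert_right he) (vert_left hf) (vert_right hf)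
    (hC.edge_ne he) (hC.edge_ne hf) z hz h1 h2 with ⟨h, _⟩ | ⟨h, _⟩
  · exact hef (hC.blue_inj f hf e he h).symm
  · exact hC.colour f hf e he h

lemma edge_arc_off {e d : Pt × Pt} (he : e ∈ M) (hd : d ∈ D) {z : Pt}
    (h1 : cr (z - e.1) (e.2 - e.1) = 0) (h2 : cr (z - d.1) (d.2 - d.1) = 0) : z.1 ≠ c := by
  intro hz
  exact hC.arc_not_edge hd he (hC.lines _ _ _ _ (vert_left he) (vert_right he)
    (hC.arc_vert_left hd) (hC.arc_vert_right hd) (hC.edge_ne he) (hC.arc_ne hd) z hz h1 h2)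

lemma arc_arc_off {d d' : Pt × Pt} (hd : d ∈ D) (hd' : d' ∈ D) (hdd : d ≠ d') {z : Pt}
    (h1 : cr (z - d.1) (d.2 - d.1) = 0) (h2 : cr (z - d'.1) (d'.2 - d'.1) = 0) : z.1 ≠ c := by
  intro hz
  rcases hC.lines _ _ _ _ (hC.arc_vert_left hd) (hC.arc_vert_right hd)
    (hC.arc_vert_left hd') (hC.arc_vert_right hd') (hC.arc_ne hd) (hC.arc_ne hd') z hz h1 h2
    with ⟨h, h'⟩ | ⟨h, _⟩
  · exact hdd (Prod.ext h.symm h'.symm)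
  · obtain ⟨e, he, _, _, _, _, rfl⟩ := hC.arc d hd
    obtain ⟨_, _, f, hf, _, _, rfl⟩ := hC.arc d' hd'
    exact hC.colour f (hC.AM hf) e (hC.AM he) h

end Conf

/-- The label of the end `i` of the edge `e`. -/
def lab (A : Finset (Pt × Pt)) (u e : Pt × Pt) (i : Bool) : Prop := if e = u then i = true else e ∈ A

/-- The origin of the arm through the end `i` of the edge `e`. -/
noncomputable def org (A : Finset (Pt × Pt)) (u e : Pt × Pt) (i : Bool) : Pt :=
  if lab A u e i then e.2 else e.1

/-- The parameter of the origin of an arm. -/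
noncomputable def low (A : Finset (Pt × Pt)) (u e : Pt × Pt) (i : Bool) : ℝ :=
  if i = true ↔ lab A u e i then 0 else -1

lemma beyond_low (A : Finset (Pt × Pt)) (u e : Pt × Pt) (i : Bool) :
    beyond e i (low A u e i) = org A u e i := by
  cases i
  · by_cases h : lab A u e false <;> simp [low, org, h, beyond]
  · by_cases h : lab A u e true <;> simp [low, org, h, beyond]

lemma low_eq (A : Finset (Pt × Pt)) (u e : Pt × Pt) (i : Bool) :
    low A u e i = 0 ∨ low A u e i = -1 ∧ e ≠ u := by
  by_cases h : e = u
  · left; simp [low, lab, h]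
  · by_cases h2 : i = true ↔ lab A u e i
    · left; simp only [low]; rw [if_pos h2]
    · right; simp only [low]; rw [if_neg h2]; exact ⟨rfl, h⟩

lemma low_self (A : Finset (Pt × Pt)) (u : Pt × Pt) (i : Bool) : low A u u i = 0 :=
  (low_eq A u u i).resolve_right fun h => h.2 rfl

lemma low_add {A : Finset (Pt × Pt)} {u e : Pt × Pt} (h : e ≠ u) (i : Bool) :
    low A u e i + low A u e (!i) = -1 := by
  cases i <;> by_cases hA : e ∈ A <;> simp [low, lab, h, hA]

/-- The arms with origin left of the vertical line and label `1` (or the reverse) must not cross the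
vertical line. -/
def Threatened (c : ℝ) (A : Finset (Pt × Pt)) (u e : Pt × Pt) (i : Bool) : Prop :=
  (org A u e i).1 < c ∧ lab A u e i ∨ c < (org A u e i).1 ∧ ¬ lab A u e i

/-- The static obstacles of an arm. -/
def obst (c : ℝ) (M A D : Finset (Pt × Pt)) (u e : Pt × Pt) (i : Bool) : Set Pt :=
  {z | (∃ f ∈ M, z ∈ segment ℝ f.1 f.2) ∨ (∃ d ∈ D, z ∈ segment ℝ d.1 d.2) ∨
    Threatened c A u e i ∧ z.1 = c}

namespace Conf

variable {c : ℝ} {M A D : Finset (Pt × Pt)} {u : Pt × Pt} (hC : Conf c M A D u)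
include hC

lemma vert_org {e : Pt × Pt} (he : e ∈ M) (i : Bool) : Vert M (org A u e i) := by
  unfold org; split_ifs
  · exact vert_right he
  · exact vert_left he

omit hC in
/-- An affine function that does not vanish identically has finitely many zeros on a line. -/
lemma finite_zeros {p d w a : Pt} {t0 : ℝ} (h : cr w (p + t0 • d - a) ≠ 0) :
    {t : ℝ | cr w (p + t • d - a) = 0}.Finite := by
  refine Set.Subsingleton.finite fun s hs t ht => ?_
  simp only [Set.mem_ofPred_eq] at hs ht
  have e : ∀ t : ℝ, cr w (p + t • d - a) = cr w (p - a) + t * cr w d := by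
    intro t; simp; ring
  rw [e] at hs ht h
  have h1 : (s - t) * cr w d = 0 := by linarith
  rcases mul_eq_zero.1 h1 with h2 | h2
  · linarith
  · rw [h2] at hs h
    exfalso; apply h; linarith

omit hC in
lemma finite_beyond {e : Pt × Pt} {i : Bool} {w a : Pt} {t0 : ℝ}
    (h : cr (beyond e i t0 - a) w ≠ 0) : {t : ℝ | cr (beyond e i t - a) w = 0}.Finite := by
  have e1 : ∀ t : ℝ, cr w (beyond e i 0 + t • (beyond e i 1 - beyond e i 0) - a) =
      - cr (beyond e i t - a) w := by
    intro t
    have := beyond_sub e i t 0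
    rw [sub_zero] at this
    rw [← this, add_sub_cancel, cr_comm]
  have := finite_zeros (p := beyond e i 0) (d := beyond e i 1 - beyond e i 0) (w := w) (a := a)
    (t0 := t0) (by rw [e1]; exact neg_ne_zero.2 h)
  simpa only [e1, neg_eq_zero] using this

lemma finite_edge {e f : Pt × Pt} (he : e ∈ M) (hf : f ∈ M) (hef : e ≠ f) (i : Bool) :
    {t : ℝ | cr (beyond e i t - f.1) (f.2 - f.1) = 0}.Finite := by
  refine finite_beyond (t0 := 0) fun h => ?_
  rcases hC.vert_on_line (hC.vert_beyond he i) hf h with h1 | h1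
  all_goals
    refine hC.plane e he f hf hef _ (beyond_mem_segment (i := i) (t := 0) (by simp) le_rfl) ?_
    rw [h1]
  · exact left_mem_segment _ _ _
  · exact right_mem_segment _ _ _

lemma finite_arc {e d : Pt × Pt} (he : e ∈ M) (hd : d ∈ D) (i : Bool) :
    {t : ℝ | cr (beyond e i t - d.1) (d.2 - d.1) = 0}.Finite := by
  have key : ∀ q, Vert M q → cr (q - d.1) (d.2 - d.1) = 0 → q = d.1 ∨ q = d.2 := by
    intro q hq h
    by_contra hcon
    push Not at hcon
    exact hC.gen d.1 q d.2 (hC.arc_vert_left hd) hq (hC.arc_vert_right hd) hcon.1.symm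
      (hC.arc_ne hd) hcon.2 h
  have h1 : e.1 = beyond e i 0 ∧ e.2 = beyond e i (-1) ∨
      e.2 = beyond e i 0 ∧ e.1 = beyond e i (-1) := by
    cases i <;> simp [beyond]
  by_cases ha : cr (beyond e i 0 - d.1) (d.2 - d.1) = 0
  · refine finite_beyond (t0 := -1) fun hb => ?_
    have hne := hC.edge_ne he
    have hn := hC.arc_not_edge hd he
    rcases h1 with ⟨h1, h2⟩ | ⟨h1, h2⟩
    · rw [← h1] at ha; rw [← h2] at hb
      rcases key _ (vert_left he) ha with h | h <;> rcases key _ (vert_right he) hb with h' | h'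
      · exact hne (h.trans h'.symm)
      · exact hn (Or.inl ⟨h.symm, h'.symm⟩)
      · exact hn (Or.inr ⟨h'.symm, h.symm⟩)
      · exact hne (h.trans h'.symm)
    · rw [← h1] at ha; rw [← h2] at hb
      rcases key _ (vert_left he) hb with h | h <;> rcases key _ (vert_right he) ha with h' | h'
      · exact hne (h.trans h'.symm)
      · exact hn (Or.inl ⟨h.symm, h'.symm⟩)
      · exact hn (Or.inr ⟨h'.symm, h.symm⟩)
      · exact hne (h.trans h'.symm)
  · exact finite_beyond ha

lemma finite_vertical {e : Pt × Pt} (he : e ∈ M) (i : Bool) :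
    {t : ℝ | (beyond e i t).1 = c}.Finite := by
  have h := finite_beyond (e := e) (i := i) (w := (0, 1)) (a := (c, 0)) (t0 := 0) (by
    have := hC.off _ (hC.vert_beyond he i)
    simpa [cr, sub_eq_zero] using this)
  refine h.subset fun t ht => ?_
  simp only [Set.mem_ofPred_eq] at ht ⊢
  simp [cr, ht]

/-- The ends of the edges can be extended until they hit an obstacle. -/
lemma exists_extension : ∃ fin s, Elong (fun v : {e // e ∈ M} × Bool => beyond v.1.1 v.2)
    (fun v => obst c M A D u v.1.1 v.2) Set.univ fin s := by
  refine exists_elong ?_ ?_ ?_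
  · rintro ⟨⟨e, he⟩, i⟩
    refine (((Set.finite_iUnion fun f : {f : {f // f ∈ M} // e ≠ f.1} =>
      hC.finite_edge he f.1.2 f.2 i).union (Set.finite_iUnion fun d : {d // d ∈ D} =>
      hC.finite_arc he d.2 i)).union (hC.finite_vertical he i)).subset ?_
    rintro t ⟨ht, ⟨f, hf, h⟩ | ⟨d, hd, h⟩ | ⟨_, h⟩⟩
    · left; left
      have hef : e ≠ f := by
        rintro rfl
        exact beyond_not_mem_segment (hC.edge_ne he) ht h
      exact Set.mem_iUnion.2 ⟨⟨⟨f, hf⟩, hef⟩, segment_line h⟩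
    · left; right
      exact Set.mem_iUnion.2 ⟨⟨d, hd⟩, segment_line h⟩
    · right; exact h
  · rintro ⟨⟨e, he⟩, i⟩ ⟨⟨f, hf⟩, j⟩ hne
    by_cases hef : e = f
    · subst hef
      have hij : i = !j := by
        cases i <;> cases j <;> simp_all
      subst hij
      convert Set.finite_empty
      ext t
      simp only [Set.mem_ofPred_eq, Set.mem_empty_iff_false, iff_false]
      rintro ⟨ht, t', ht', h⟩
      rw [beyond_not] at h
      have := beyond_inj (hC.edge_ne he) h
      linarith
    · refine (hC.finite_edge hf he (Ne.symm hef) j).subset ?_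
      rintro t ⟨_, t', _, h⟩
      simp only [Set.mem_ofPred_eq]
      simp only at h
      rw [← h]
      exact beyond_line _ _ _
  · rintro ⟨⟨e, he⟩, i⟩ ⟨⟨f, hf⟩, j⟩ hne t ht t' ht' h hm
    simp only at h hm ⊢
    rw [← h]
    rcases hm with h1 | h1 | ⟨_, h1⟩
    · exact Or.inl h1
    · exact Or.inr (Or.inl h1)
    · exfalso
      by_cases hef : e = f
      · subst hef
        have hij : i = !j := by
          cases i <;> cases j <;> simp_all
        subst hij
        rw [beyond_not] at h
        have := beyond_inj (hC.edge_ne he) h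
        linarith
      · refine hC.edge_edge_off he hf hef (beyond_line e i t') ?_ h1
        rw [h]; exact beyond_line _ _ _

end Conf

section Arms

variable {c : ℝ} {M A D : Finset (Pt × Pt)} {u : Pt × Pt}

/-- The arms given by an extension of the edges. -/
noncomputable def arms (c : ℝ) (M A D : Finset (Pt × Pt)) (u : Pt × Pt)
    (fin : {e // e ∈ M} × Bool → Prop) (s : {e // e ∈ M} × Bool → ℝ) (ou : Pt) (lam : Pt → Prop) :
    Chase (({e // e ∈ M} × Bool) ⊕ {d // d ∈ D}) where
  o := Sum.elim (fun v => org A u v.1.1 v.2) (fun d => d.1.2)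
  w := Sum.elim (fun v => (if fin v then s v - low A u v.1.1 v.2 else 1) •
    (beyond v.1.1 v.2 1 - beyond v.1.1 v.2 0)) (fun d => d.1.1 - d.1.2)
  τ := Sum.elim (fun v => lab A u v.1.1 v.2) (fun _ => True)
  fin := Sum.elim fin (fun _ => True)
  r := u.2
  b := u.1
  ou := ou
  c := c
  lam := lam

variable {fin : {e // e ∈ M} × Bool → Prop} {s : {e // e ∈ M} × Bool → ℝ} {ou : Pt}
  {lam : Pt → Prop}

lemma low_le (A : Finset (Pt × Pt)) (u e : Pt × Pt) (i : Bool) : low A u e i ≤ 0 := by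
  rcases low_eq A u e i with h | h <;> linarith

lemma neg_one_le_low (A : Finset (Pt × Pt)) (u e : Pt × Pt) (i : Bool) : -1 ≤ low A u e i := by
  rcases low_eq A u e i with h | h <;> linarith

lemma arms_point (v : {e // e ∈ M} × Bool) (γ t : ℝ) :
    org A u v.1.1 v.2 + t • γ • (beyond v.1.1 v.2 1 - beyond v.1.1 v.2 0) =
      beyond v.1.1 v.2 (low A u v.1.1 v.2 + t * γ) := by
  have := beyond_sub v.1.1 v.2 (low A u v.1.1 v.2 + t * γ) (low A u v.1.1 v.2)
  rw [beyond_low, add_sub_cancel_left, sub_eq_iff_eq_add] at this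
  rw [this, smul_smul, add_comm]

lemma mem_arm_inl (hs : ∀ v, 0 < s v) {v : {e // e ∈ M} × Bool} {z : Pt} :
    z ∈ (arms c M A D u fin s ou lam).arm (Sum.inl v) ↔
      ∃ t, low A u v.1.1 v.2 ≤ t ∧ (fin v → t ≤ s v) ∧ z = beyond v.1.1 v.2 t := by
  have h0 := low_le A u v.1.1 v.2
  have hsv := hs v
  simp only [Chase.arm, linePart, Chase.range, arms, Sum.elim_inl, Set.mem_image,
    Set.mem_ofPred_eq, arms_point]
  by_cases hf : fin v
  · simp only [hf, if_true, true_imp_iff]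
    have hp : 0 < s v - low A u v.1.1 v.2 := by linarith
    constructor
    · rintro ⟨t, ⟨h1, h2⟩, rfl⟩
      exact ⟨_, by nlinarith, by nlinarith, rfl⟩
    · rintro ⟨t, h1, h2, rfl⟩
      refine ⟨(t - low A u v.1.1 v.2) / (s v - low A u v.1.1 v.2), ⟨?_, ?_⟩, ?_⟩
      · apply div_nonneg <;> linarith
      · rw [div_le_one hp]; linarith
      · rw [div_mul_cancel₀ _ hp.ne']; congr 1; ring
  · simp only [hf, if_false, false_imp_iff, and_true, true_and, mul_one]
    constructor
    · rintro ⟨t, h1, rfl⟩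
      exact ⟨_, by linarith, rfl⟩
    · rintro ⟨t, h1, rfl⟩
      exact ⟨t - low A u v.1.1 v.2, by linarith, by congr 1; ring⟩

lemma mem_inter_inl (hs : ∀ v, 0 < s v) {v : {e // e ∈ M} × Bool} {z : Pt} :
    z ∈ (arms c M A D u fin s ou lam).inter (Sum.inl v) ↔
      ∃ t, low A u v.1.1 v.2 < t ∧ (fin v → t < s v) ∧ z = beyond v.1.1 v.2 t := by
  have h0 := low_le A u v.1.1 v.2
  have hsv := hs v
  simp only [Chase.inter, linePart, arms, Sum.elim_inl, Set.mem_image,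
    Set.mem_ofPred_eq, arms_point]
  by_cases hf : fin v
  · simp only [hf, if_true, true_imp_iff]
    have hp : 0 < s v - low A u v.1.1 v.2 := by linarith
    constructor
    · rintro ⟨t, ⟨h1, h2⟩, rfl⟩
      exact ⟨_, by nlinarith, by nlinarith, rfl⟩
    · rintro ⟨t, h1, h2, rfl⟩
      refine ⟨(t - low A u v.1.1 v.2) / (s v - low A u v.1.1 v.2), ⟨?_, ?_⟩, ?_⟩
      · apply div_pos <;> linarith
      · rw [div_lt_one hp]; linarith
      · rw [div_mul_cancel₀ _ hp.ne']; congr 1; ring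
  · simp only [hf, if_false, false_imp_iff, and_true, true_and, mul_one]
    constructor
    · rintro ⟨t, h1, rfl⟩
      exact ⟨_, by linarith, rfl⟩
    · rintro ⟨t, h1, rfl⟩
      exact ⟨t - low A u v.1.1 v.2, by linarith, by congr 1; ring⟩

lemma tip_inl {v : {e // e ∈ M} × Bool} (hf : fin v) :
    (arms c M A D u fin s ou lam).tip (Sum.inl v) = beyond v.1.1 v.2 (s v) := by
  have := arms_point (A := A) (u := u) v (s v - low A u v.1.1 v.2) 1
  rw [one_smul, one_mul, add_sub_cancel] at this
  simpa [Chase.tip, arms, hf] using this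

lemma mem_arm_inr {d : {d // d ∈ D}} {z : Pt} :
    z ∈ (arms c M A D u fin s ou lam).arm (Sum.inr d) ↔ z ∈ segment ℝ d.1.1 d.1.2 := by
  rw [segment_symm, segment_eq_linePart]
  simp [Chase.arm, Chase.range, arms, linePart, Set.Icc]

lemma mem_inter_inr {d : {d // d ∈ D}} {z : Pt} :
    z ∈ (arms c M A D u fin s ou lam).inter (Sum.inr d) ↔ z ∈ openSegment ℝ d.1.1 d.1.2 := by
  rw [openSegment_symm, openSegment_eq_image']
  simp [Chase.inter, arms, linePart, Set.Ioo]

lemma tip_inr {d : {d // d ∈ D}} :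
    (arms c M A D u fin s ou lam).tip (Sum.inr d) = d.1.1 := by
  simp [Chase.tip, arms]

variable (hC : Conf c M A D u)
  (hL : Elong (fun v : {e // e ∈ M} × Bool => beyond v.1.1 v.2)
    (fun v => obst c M A D u v.1.1 v.2) Set.univ fin s)
include hC hL

/-- Beyond the edge, a point of an arm on an obstacle is the tip. -/
lemma ext_static {v : {e // e ∈ M} × Bool} {t : ℝ} (ht : 0 < t) (hts : fin v → t ≤ s v)
    (h : beyond v.1.1 v.2 t ∈ obst c M A D u v.1.1 v.2) : fin v ∧ t = s v := by
  by_contra hcon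
  refine hL.avoid v trivial t ht (fun hf => ?_) h
  exact lt_of_le_of_ne (hts hf) fun e => hcon ⟨hf, e⟩

/-- Points of an arm are on the edge, or beyond it. -/
lemma edge_or_ext (v : {e // e ∈ M} × Bool) {t : ℝ} (h : low A u v.1.1 v.2 ≤ t) :
    beyond v.1.1 v.2 t ∈ segment ℝ v.1.1.1 v.1.1.2 ∨ 0 < t := by
  rcases le_or_gt t 0 with h1 | h1
  · left
    exact beyond_mem_segment ((neg_one_le_low A u _ _).trans h) h1
  · exact Or.inr h1

/-- Two arms of one edge meet at most at their origin. -/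
lemma same_edge {v v' : {e // e ∈ M} × Bool} (hne : v ≠ v') (he : v.1 = v'.1) {t t' : ℝ}
    (h : low A u v.1.1 v.2 ≤ t) (h' : low A u v'.1.1 v'.2 ≤ t')
    (heq : beyond v.1.1 v.2 t = beyond v'.1.1 v'.2 t') :
    t = low A u v.1.1 v.2 ∧ t' = low A u v'.1.1 v'.2 := by
  obtain ⟨e, i⟩ := v
  obtain ⟨e', j⟩ := v'
  simp only at he
  subst he
  have hij : j = !i := by
    cases i <;> cases j <;> simp_all
  subst hij
  simp only at h h' heq ⊢
  rw [beyond_not] at heq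
  have h1 := beyond_inj (hC.edge_ne e.2) heq
  by_cases heu : e.1 = u
  · exfalso
    rw [heu, low_self] at h h'
    linarith
  · have := low_add (A := A) heu i
    constructor <;> linarith

lemma vv_int {v v' : {e // e ∈ M} × Bool} (hne : v ≠ v') {t t' : ℝ}
    (h : low A u v.1.1 v.2 ≤ t) (hts : fin v → t ≤ s v)
    (h' : low A u v'.1.1 v'.2 < t') (hts' : fin v' → t' < s v')
    (heq : beyond v.1.1 v.2 t = beyond v'.1.1 v'.2 t') : fin v ∧ t = s v := by
  by_cases he : v.1 = v'.1
  · have := (same_edge hC hL hne he h h'.le heq).2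
    linarith
  have he' : v.1.1 ≠ v'.1.1 := fun h => he (Subtype.ext h)
  rcases edge_or_ext hC hL v h with h1 | h1 <;> rcases edge_or_ext hC hL v' h'.le with h2 | h2
  · rw [← heq] at h2
    exact absurd h2 (hC.plane _ v.1.2 _ v'.1.2 he' _ h1)
  · exfalso
    refine hL.avoid v' trivial t' h2 hts' (Or.inl ⟨v.1.1, v.1.2, ?_⟩)
    rwa [← heq]
  · refine ext_static hC hL h1 hts (Or.inl ⟨v'.1.1, v'.1.2, ?_⟩)
    rwa [heq]
  · obtain ⟨hf, hle⟩ := hL.cross v' trivial v trivial hne.symm t' h2 t h1 heq.symm hts'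
    exact ⟨hf, le_antisymm (hts hf) hle⟩

lemma arms_arm_int (j k : ({e // e ∈ M} × Bool) ⊕ {d // d ∈ D}) (z : Pt) (hjk : j ≠ k)
    (hj : z ∈ (arms c M A D u fin s ou lam).arm j)
    (hk : z ∈ (arms c M A D u fin s ou lam).inter k) :
    (arms c M A D u fin s ou lam).fin j ∧ z = (arms c M A D u fin s ou lam).tip j := by
  rcases j with v | d <;> rcases k with v' | d'
  · rw [mem_arm_inl hL.pos] at hj
    rw [mem_inter_inl hL.pos] at hk
    obtain ⟨t, h1, h2, rfl⟩ := hj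
    obtain ⟨t', h3, h4, h5⟩ := hk
    obtain ⟨hf, rfl⟩ := vv_int hC hL (fun e => hjk (congrArg _ e)) h1 h2 h3 h4 h5
    exact ⟨hf, (tip_inl hf).symm⟩
  · rw [mem_arm_inl hL.pos] at hj
    rw [mem_inter_inr] at hk
    obtain ⟨t, h1, h2, rfl⟩ := hj
    rcases edge_or_ext hC hL v h1 with h3 | h3
    · exact absurd h3 (hC.arc_edge _ d'.2 _ v.1.2 _ hk)
    · obtain ⟨hf, rfl⟩ := ext_static hC hL h3 h2
        (Or.inr (Or.inl ⟨d'.1, d'.2, openSegment_subset_segment ℝ _ _ hk⟩))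
      exact ⟨hf, (tip_inl hf).symm⟩
  · rw [mem_arm_inr] at hj
    rw [mem_inter_inl hL.pos] at hk
    obtain ⟨t, h1, h2, rfl⟩ := hk
    rcases edge_or_ext hC hL v' h1.le with h3 | h3
    · have hno : beyond v'.1.1 v'.2 t ∉ openSegment ℝ d.1.1 d.1.2 := fun h =>
        hC.arc_edge _ d.2 _ v'.1.2 _ h h3
      rcases endpoint_of_not_open hj hno with h | h
      · exact ⟨trivial, by rw [h, tip_inr]⟩
      · exfalso
        obtain ⟨e, he, f, hf, hfu, hef, hd⟩ := hC.arc _ d.2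
        have h4 : d.1.2 = e.2 := by rw [hd]
        rw [h4] at h
        rw [h] at h3
        have heq : e = v'.1.1 := by
          by_contra hne
          exact hC.plane e (hC.AM he) _ v'.1.2 hne _ (right_mem_segment _ _ _) h3
        by_cases hl : lab A u v'.1.1 v'.2
        · have h5 := beyond_low A u v'.1.1 v'.2
          have h6 : org A u v'.1.1 v'.2 = e.2 := by
            unfold org
            rw [if_pos hl, heq]
          rw [h6, ← h] at h5
          have := beyond_inj (hC.edge_ne v'.1.2) h5
          linarith
        · by_cases hu : v'.1.1 = u
          · have hv2 : v'.2 = false := by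
              simpa [lab, hu] using hl
            rw [hu, low_self] at h1
            refine beyond_not_mem_segment (hC.edge_ne v'.1.2) (i := v'.2) h1 ?_
            rw [h]; exact h3
          · apply hl
            simp only [lab, if_neg hu]
            rwa [← heq]
    · exact absurd (Or.inr (Or.inl ⟨d.1, d.2, hj⟩)) (hL.avoid v' trivial t h3 h2)
  · rw [mem_arm_inr] at hj
    rw [mem_inter_inr] at hk
    exact absurd hj (hC.arc_arc _ d'.2 _ d.2 (fun e => hjk (by rw [Subtype.ext e])) _ hk)

lemma arms_arm_u (j : ({e // e ∈ M} × Bool) ⊕ {d // d ∈ D}) (z : Pt)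
    (hj : z ∈ (arms c M A D u fin s ou lam).arm j) (hz : z ∈ openSegment ℝ u.2 u.1) :
    (arms c M A D u fin s ou lam).fin j ∧ z = (arms c M A D u fin s ou lam).tip j := by
  rw [openSegment_symm] at hz
  have hzs := openSegment_subset_segment ℝ _ _ hz
  have hno : ¬ Vert M z := fun h => by
    rcases hC.vert_on_edge h hC.uM hzs with rfl | rfl
    · exact left_not_mem_open (hC.edge_ne hC.uM) hz
    · exact right_not_mem_open (hC.edge_ne hC.uM) hz
  rcases j with v | d
  · rw [mem_arm_inl hL.pos] at hj
    obtain ⟨t, h1, h2, rfl⟩ := hj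
    rcases edge_or_ext hC hL v h1 with h3 | h3
    · exfalso
      have hvu : v.1.1 = u := by
        by_contra hne
        exact hC.plane _ v.1.2 u hC.uM hne _ h3 hzs
      rw [hvu, low_self] at h1
      rcases h1.eq_or_lt with rfl | h1
      · exact hno (hC.vert_beyond v.1.2 v.2)
      · exact beyond_not_mem_segment (hC.edge_ne v.1.2) h1 h3
    · obtain ⟨hf, rfl⟩ := ext_static hC hL h3 h2 (Or.inl ⟨u, hC.uM, hzs⟩)
      exact ⟨hf, (tip_inl hf).symm⟩
  · rw [mem_arm_inr] at hj
    exfalso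
    rcases endpoint_of_not_open hj (fun h => hC.arc_edge _ d.2 _ hC.uM _ h hzs) with rfl | rfl
    · exact hno (hC.arc_vert_left d.2)
    · exact hno (hC.arc_vert_right d.2)

lemma arms_u_int (k : ({e // e ∈ M} × Bool) ⊕ {d // d ∈ D}) (z : Pt) (hz : z ∈ segment ℝ u.2 u.1) :
    z ∉ (arms c M A D u fin s ou lam).inter k := by
  rw [segment_symm] at hz
  intro hk
  rcases k with v | d
  · rw [mem_inter_inl hL.pos] at hk
    obtain ⟨t, h1, h2, rfl⟩ := hk
    by_cases hvu : v.1.1 = u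
    · rw [hvu, low_self] at h1
      refine beyond_not_mem_segment (hC.edge_ne v.1.2) (i := v.2) h1 ?_
      rw [hvu] at hz ⊢; exact hz
    · rcases edge_or_ext hC hL v h1.le with h3 | h3
      · exact hC.plane _ v.1.2 u hC.uM hvu _ h3 hz
      · exact hL.avoid v trivial t h3 h2 (Or.inl ⟨u, hC.uM, hz⟩)
  · rw [mem_inter_inr] at hk
    exact hC.arc_edge _ d.2 _ hC.uM _ hk hz

/-- An extension is cut on the vertical line only if it is threatened. -/
lemma threatened_of_tip {v : {e // e ∈ M} × Bool} (hf : fin v)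
    (h : (beyond v.1.1 v.2 (s v)).1 = c) : Threatened c A u v.1.1 v.2 := by
  rcases hL.hit v trivial hf with (⟨f, hf, h1⟩ | ⟨d, hd, h1⟩ | h1) | ⟨v', _, hne, t, ht, h1, h2⟩
  · exfalso
    refine hC.edge_edge_off v.1.2 hf ?_ (beyond_line v.1.1 v.2 (s v)) (segment_line h1) h
    rintro rfl
    exact beyond_not_mem_segment (hC.edge_ne v.1.2) (hL.pos v) h1
  · exact absurd h (hC.edge_arc_off v.1.2 hd (beyond_line v.1.1 v.2 (s v)) (segment_line h1))
  · exact h1.1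
  · exfalso
    by_cases he : v'.1 = v.1
    · have h3 := same_edge hC hL hne he ((low_le A u _ _).trans ht.le)
        ((low_le A u _ _).trans (hL.pos v).le) h2
      linarith [low_le A u v'.1.1 v'.2]
    · refine hC.edge_edge_off v'.1.2 v.1.2 (fun h => he (Subtype.ext h))
        (beyond_line v'.1.1 v'.2 t) ?_ (by rw [h2]; exact h)
      rw [h2]; exact beyond_line _ _ _

lemma arms_fin_side (k : ({e // e ∈ M} × Bool) ⊕ {d // d ∈ D})
    (hk : (arms c M A D u fin s ou lam).Anch k) :
    ((arms c M A D u fin s ou lam).o k).1 < c ∧ (arms c M A D u fin s ou lam).τ k ∨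
      c < ((arms c M A D u fin s ou lam).o k).1 ∧ ¬ (arms c M A D u fin s ou lam).τ k := by
  rcases k with v | d
  · obtain ⟨hf, ht⟩ := hk
    rw [tip_inl hf] at ht
    exact threatened_of_tip hC hL hf ht
  · obtain ⟨hf, ht⟩ := hk
    rw [tip_inr] at ht
    exact absurd ht (hC.off _ (hC.arc_vert_left d.2))

lemma arms_int_side (k : ({e // e ∈ M} × Bool) ⊕ {d // d ∈ D}) (z : Pt)
    (hk : z ∈ (arms c M A D u fin s ou lam).inter k) (hz : z.1 = c) :
    c < ((arms c M A D u fin s ou lam).o k).1 ∧ (arms c M A D u fin s ou lam).τ k ∨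
      ((arms c M A D u fin s ou lam).o k).1 < c ∧ ¬ (arms c M A D u fin s ou lam).τ k := by
  have side : ∀ p q : Pt, z ∈ segment ℝ p q → p.1 ≠ c → q.1 ≠ c →
      p.1 < c ∧ c < q.1 ∨ q.1 < c ∧ c < p.1 := by
    rintro p q ⟨a, b, ha, hb, hab, rfl⟩ hp hq
    simp at hz
    obtain rfl : a = 1 - b := by linarith
    rcases lt_or_gt_of_ne hp with h1 | h1 <;> rcases lt_or_gt_of_ne hq with h2 | h2
    · exfalso
      rcases hb.eq_or_lt with rfl | hb
      · linarith
      · nlinarith [mul_nonneg ha (sub_nonneg.2 h1.le), mul_pos hb (sub_pos.2 h2)]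
    · exact Or.inl ⟨h1, h2⟩
    · exact Or.inr ⟨h2, h1⟩
    · exfalso
      rcases hb.eq_or_lt with rfl | hb
      · linarith
      · nlinarith [mul_nonneg ha (sub_nonneg.2 h1.le), mul_pos hb (sub_pos.2 h2)]
  rcases k with v | d
  · rw [mem_inter_inl hL.pos] at hk
    obtain ⟨t, h1, h2, rfl⟩ := hk
    change c < (org A u v.1.1 v.2).1 ∧ lab A u v.1.1 v.2 ∨
      (org A u v.1.1 v.2).1 < c ∧ ¬ lab A u v.1.1 v.2
    rcases edge_or_ext hC hL v h1.le with h3 | h3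
    · have hvu : v.1.1 ≠ u := by
        intro hvu
        rw [hvu, low_self] at h1
        exact beyond_not_mem_segment (hC.edge_ne v.1.2) h1 h3
      rcases side _ _ h3 (hC.off _ (Conf.vert_left v.1.2)) (hC.off _ (Conf.vert_right v.1.2))
        with ⟨h4, h5⟩ | ⟨h4, h5⟩
      · by_cases hl : lab A u v.1.1 v.2 <;> simp [org, hl, h4, h5]
      · exact absurd (hC.uniq _ v.1.2 h4 h5) hvu
    · have h4 : ¬ Threatened c A u v.1.1 v.2 := fun h =>
        hL.avoid v trivial t h3 h2 (Or.inr (Or.inr ⟨h, hz⟩))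
      have h5 := hC.off _ (hC.vert_org v.1.2 v.2)
      unfold Threatened at h4
      by_cases hl : lab A u v.1.1 v.2
      · simp only [hl, and_true, not_true, and_false, or_false, not_lt] at h4 ⊢
        exact lt_of_le_of_ne h4 (Ne.symm h5)
      · simp only [hl, and_false, not_false_iff, and_true, false_or, not_lt] at h4 ⊢
        exact lt_of_le_of_ne h4 h5
  · rw [mem_inter_inr] at hk
    left
    refine ⟨?_, trivial⟩
    change c < d.1.2.1
    rcases side _ _ (openSegment_subset_segment ℝ _ _ hk) (hC.off _ (hC.arc_vert_left d.2))
      (hC.off _ (hC.arc_vert_right d.2)) with ⟨h4, h5⟩ | ⟨h4, h5⟩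
    · exact h5
    · exact absurd ⟨h4, h5⟩ (hC.arc_side _ d.2)

omit hL in
lemma arms_o_off (k : ({e // e ∈ M} × Bool) ⊕ {d // d ∈ D}) :
    ((arms c M A D u fin s ou lam).o k).1 ≠ c := by
  rcases k with v | d
  · exact hC.off _ (hC.vert_org v.1.2 v.2)
  · exact hC.off _ (hC.arc_vert_right d.2)

lemma arms_arm_arm (j k : ({e // e ∈ M} × Bool) ⊕ {d // d ∈ D}) (z : Pt) (hjk : j ≠ k)
    (hj : z ∈ (arms c M A D u fin s ou lam).arm j)
    (hk : z ∈ (arms c M A D u fin s ou lam).arm k) : z.1 ≠ c := by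
  rcases j with v | d <;> rcases k with v' | d'
  · rw [mem_arm_inl hL.pos] at hj hk
    obtain ⟨t, h1, h2, rfl⟩ := hj
    obtain ⟨t', h3, h4, h5⟩ := hk
    have hne : v ≠ v' := fun e => hjk (congrArg _ e)
    by_cases he : v.1 = v'.1
    · rw [(same_edge hC hL hne he h1 h3 h5).1, beyond_low]
      exact hC.off _ (hC.vert_org v.1.2 v.2)
    · refine hC.edge_edge_off v.1.2 v'.1.2 (fun h => he (Subtype.ext h)) (beyond_line _ _ _) ?_
      rw [h5]; exact beyond_line _ _ _
  · rw [mem_arm_inl hL.pos] at hj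
    rw [mem_arm_inr] at hk
    obtain ⟨t, h1, h2, rfl⟩ := hj
    exact hC.edge_arc_off v.1.2 d'.2 (beyond_line _ _ _) (segment_line hk)
  · rw [mem_arm_inr] at hj
    rw [mem_arm_inl hL.pos] at hk
    obtain ⟨t, h1, h2, rfl⟩ := hk
    exact hC.edge_arc_off v'.1.2 d.2 (beyond_line _ _ _) (segment_line hj)
  · rw [mem_arm_inr] at hj hk
    exact hC.arc_arc_off d.2 d'.2 (fun e => hjk (by rw [Subtype.ext e])) (segment_line hj)
      (segment_line hk)

lemma arms_arm_seg (k : ({e // e ∈ M} × Bool) ⊕ {d // d ∈ D}) (z : Pt)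
    (hk : z ∈ (arms c M A D u fin s ou lam).arm k) (hz : z ∈ segment ℝ u.2 u.1) : z.1 ≠ c := by
  rw [segment_symm] at hz
  rcases k with v | d
  · rw [mem_arm_inl hL.pos] at hk
    obtain ⟨t, h1, h2, rfl⟩ := hk
    by_cases hvu : v.1.1 = u
    · rw [hvu, low_self] at h1
      rcases h1.eq_or_lt with rfl | h1
      · exact hC.off _ (hC.vert_beyond v.1.2 v.2)
      · rw [← hvu] at hz
        exact absurd hz (beyond_not_mem_segment (hC.edge_ne v.1.2) h1)
    · exact hC.edge_edge_off v.1.2 hC.uM hvu (beyond_line _ _ _) (segment_line hz)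
  · rw [mem_arm_inr] at hk
    exact hC.edge_arc_off hC.uM d.2 (segment_line hz) (segment_line hk)

end Arms

section Bars

variable {c : ℝ} {M A D : Finset (Pt × Pt)} {u : Pt × Pt}

/-- An edge together with its extensions. -/
def bar (fin : {e // e ∈ M} × Bool → Prop) (s : {e // e ∈ M} × Bool → ℝ) (e : {e // e ∈ M}) :
    Set Pt :=
  {z | ∃ t, (fin (e, true) → t ≤ s (e, true)) ∧ (fin (e, false) → -1 - t ≤ s (e, false)) ∧
    z = beyond e.1 true t}

/-- The part of the vertical line around the tip of an extension, up to the next crossings. -/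
def gateWall (C : Chase (({e // e ∈ M} × Bool) ⊕ {d // d ∈ D})) (v : {e // e ∈ M} × Bool) :
    Set Pt :=
  {z | C.Anch (Sum.inl v) ∧ z.1 = C.c ∧ ∀ x, C.Cross x →
    (x.2 < (C.tip (Sum.inl v)).2 → x.2 ≤ z.2) ∧ ((C.tip (Sum.inl v)).2 < x.2 → z.2 ≤ x.2)}

/-- The walls that block the view of the red points of `A`. -/
noncomputable def screen (c : ℝ) (M A D : Finset (Pt × Pt)) (u : Pt × Pt)
    (fin : {e // e ∈ M} × Bool → Prop) (s : {e // e ∈ M} × Bool → ℝ) :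
    {e // e ∈ M} ⊕ {d // d ∈ D} ⊕ ({e // e ∈ M} × Bool) → Set Pt
  | Sum.inl e => bar fin s e
  | Sum.inr (Sum.inl d) => segment ℝ d.1.1 d.1.2
  | Sum.inr (Sum.inr v) => gateWall (arms c M A D u fin s 0 fun _ => False) v

variable {fin : {e // e ∈ M} × Bool → Prop} {s : {e // e ∈ M} × Bool → ℝ}

lemma mem_bar_iff {e : {e // e ∈ M}} (i : Bool) {z : Pt} :
    z ∈ bar fin s e ↔ ∃ t, (fin (e, i) → t ≤ s (e, i)) ∧ (fin (e, !i) → -1 - t ≤ s (e, !i)) ∧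
      z = beyond e.1 i t := by
  cases i
  · constructor
    · rintro ⟨t, h1, h2, rfl⟩
      refine ⟨-1 - t, h2, fun h => by simpa using h1 h, ?_⟩
      have := beyond_not e.1 true t
      rw [← beyond_not]; simp
    · rintro ⟨t, h1, h2, rfl⟩
      refine ⟨-1 - t, h2, fun h => by simpa using h1 h, ?_⟩
      rw [← beyond_not]; simp
  · rfl

lemma bar_line {e : {e // e ∈ M}} {z : Pt} (h : z ∈ bar fin s e) :
    cr (z - e.1.1) (e.1.2 - e.1.1) = 0 := by
  obtain ⟨t, _, _, rfl⟩ := h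
  exact beyond_line _ _ _

lemma bar_strict (hM : ∀ e ∈ M, e.1 ≠ e.2) {e : {e // e ∈ M}} {i : Bool} {t : ℝ}
    (h1 : fin (e, i) → t < s (e, i)) (h2 : fin (e, !i) → -1 - t < s (e, !i)) :
    TwoSided (bar fin s e) (beyond e.1 i t) := by
  obtain ⟨η, h0, h3, h4⟩ : ∃ η > 0, (fin (e, i) → t + η ≤ s (e, i)) ∧
      (fin (e, !i) → -1 - t + η ≤ s (e, !i)) := by
    have aux : ∀ (p : Prop) (x y : ℝ), (p → x < y) → ∃ η > 0, ∀ δ ≤ η, p → x + δ ≤ y := by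
      intro p x y h
      by_cases hp : p
      · exact ⟨y - x, sub_pos.2 (h hp), fun δ hδ _ => by linarith⟩
      · exact ⟨1, one_pos, fun _ _ h => absurd h hp⟩
    obtain ⟨a, ha, ha'⟩ := aux _ _ _ h1
    obtain ⟨b, hb, hb'⟩ := aux _ _ _ h2
    exact ⟨min a b, lt_min ha hb, ha' _ (min_le_left _ _), hb' _ (min_le_right _ _)⟩
  refine ⟨η • (beyond e.1 i 1 - beyond e.1 i 0), ?_, ?_, ?_⟩
  · refine smul_ne_zero h0.ne' (sub_ne_zero.2 fun h => ?_)
    exact one_ne_zero (beyond_inj (hM _ e.2) h)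
  · refine (mem_bar_iff i).2 ⟨t + η, h3, fun h => by linarith [h4 h], ?_⟩
    have := beyond_sub e.1 i (t + η) t
    rw [add_sub_cancel_left] at this
    rw [← this]; abel
  · refine (mem_bar_iff i).2 ⟨t - η, fun h => by linarith [h3 h], fun h => by linarith [h4 h], ?_⟩
    have := beyond_sub e.1 i t (t - η)
    rw [sub_sub_cancel] at this
    rw [← this]; abel

lemma bar_segment (hM : ∀ e ∈ M, e.1 ≠ e.2) (hs : ∀ v, 0 < s v) {e : Pt × Pt} (he : e ∈ M) {z : Pt}
    (hz : z ∈ segment ℝ e.1 e.2) : TwoSided (bar fin s ⟨e, he⟩) z := by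
  obtain ⟨t, h1, h2, rfl⟩ := mem_segment_beyond true hz
  exact bar_strict (e := ⟨e, he⟩) hM (fun _ => by linarith [hs (⟨e, he⟩, true)])
    (fun _ => by linarith [hs (⟨e, he⟩, !true)])

lemma segment_subset_bar (hs : ∀ v, 0 < s v) {e : Pt × Pt} (he : e ∈ M) {z : Pt}
    (hz : z ∈ segment ℝ e.1 e.2) : z ∈ bar fin s ⟨e, he⟩ := by
  obtain ⟨t, h1, h2, rfl⟩ := mem_segment_beyond true hz
  exact ⟨t, fun _ => by linarith [hs (⟨e, he⟩, true)], fun _ => by linarith [hs (⟨e, he⟩, false)],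
    rfl⟩

lemma isWall_bar (hM : ∀ e ∈ M, e.1 ≠ e.2) (e : {e // e ∈ M}) : IsWall (bar fin s e) := by
  have : bar fin s e = linePart e.1.2 (e.1.2 - e.1.1)
      ({t | fin (e, true) → t ≤ s (e, true)} ∩ {t | fin (e, false) → -1 - t ≤ s (e, false)}) := by
    ext z
    constructor
    · rintro ⟨t, h1, h2, rfl⟩; exact ⟨t, ⟨h1, h2⟩, rfl⟩
    · rintro ⟨t, ⟨h1, h2⟩, rfl⟩; exact ⟨t, h1, h2, rfl⟩
  rw [this]
  refine isWall_linePart (sub_ne_zero.2 (hM _ e.2).symm) (.inter ?_ ?_) (.inter ?_ ?_)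
  · by_cases h : fin (e, true)
    · simp only [h, true_imp_iff]; exact isClosed_Iic
    · simp [h]
  · by_cases h : fin (e, false)
    · simp only [h, true_imp_iff]; exact isClosed_le (by fun_prop) (by fun_prop)
    · simp [h]
  · by_cases h : fin (e, true)
    · simp only [h, true_imp_iff]; exact convex_Iic _
    · simp [h, convex_univ]
  · by_cases h : fin (e, false)
    · simp only [h, true_imp_iff]
      have : {t | -1 - t ≤ s (e, false)} = Set.Ici (-1 - s (e, false)) := by
        ext t; simp only [Set.mem_ofPred_eq, Set.mem_Ici]; constructor <;> intro _ <;> linarith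
      rw [this]; exact convex_Ici _
    · simp [h, convex_univ]

lemma isWall_gateWall (C : Chase (({e // e ∈ M} × Bool) ⊕ {d // d ∈ D}))
    (v : {e // e ∈ M} × Bool) : IsWall (gateWall C v) where
  closed := by
    by_cases h : C.Anch (Sum.inl v)
    · have : gateWall C v = {z | z.1 = C.c} ∩ ⋂ x, ⋂ (_ : C.Cross x),
          ({z | x.2 < (C.tip (Sum.inl v)).2 → x.2 ≤ z.2} ∩
            {z | (C.tip (Sum.inl v)).2 < x.2 → z.2 ≤ x.2}) := by
        ext z; simp [gateWall, h]
      rw [this]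
      refine (isClosed_eq (by fun_prop) (by fun_prop)).inter
        (isClosed_iInter fun x => isClosed_iInter fun _ => ?_)
      have imp : ∀ (p : Prop) {T : Set Pt}, IsClosed T → IsClosed {z | p → z ∈ T} := by
        intro p T hT
        by_cases hp : p <;> simp [hp, hT]
      exact (imp _ (isClosed_le continuous_const continuous_snd)).inter
        (imp _ (isClosed_le continuous_snd continuous_const))
    · have : gateWall C v = ∅ := by ext z; simp [gateWall, h]
      rw [this]; exact isClosed_empty
  convex := by
    rintro y ⟨h, h1, h2⟩ z ⟨_, h3, h4⟩ a b ha hb hab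
    obtain rfl : a = 1 - b := by linarith
    refine ⟨h, by simp [h1, h3, ← add_mul], fun x hx => ⟨fun hlt => ?_, fun hlt => ?_⟩⟩
    · have := (h2 x hx).1 hlt
      have := (h4 x hx).1 hlt
      simp; nlinarith
    · have := (h2 x hx).2 hlt
      have := (h4 x hx).2 hlt
      simp; nlinarith
  line := by
    refine ⟨(C.c, 0), (0, 1), by simp, ?_⟩
    rintro z ⟨_, h, _⟩
    simp [cr, h]

lemma isWall_segment {p q : Pt} (h : p ≠ q) : IsWall (segment ℝ p q) := by
  rw [segment_eq_linePart]
  exact isWall_linePart (sub_ne_zero.2 h.symm) isClosed_Icc (convex_Icc _ _)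

lemma isWall_screen (hC : Conf c M A D u) : ∀ i, IsWall (screen c M A D u fin s i)
  | Sum.inl e => isWall_bar (fun _ he => hC.edge_ne he) e
  | Sum.inr (Sum.inl d) => isWall_segment (hC.arc_ne d.2)
  | Sum.inr (Sum.inr v) => isWall_gateWall _ v

lemma eq_of_mem_segment_vertical {p q z z' : Pt} {c : ℝ} (hp : p.1 ≠ c) (hz : z ∈ segment ℝ p q)
    (hz' : z' ∈ segment ℝ p q) (h : z.1 = c) (h' : z'.1 = c) : z = z' := by
  rw [segment_eq_image'] at hz hz'
  obtain ⟨t, _, rfl⟩ := hz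
  obtain ⟨t', _, rfl⟩ := hz'
  simp at h h'
  have h1 : (t - t') * (q.1 - p.1) = 0 := by linarith
  rcases mul_eq_zero.1 h1 with h2 | h2
  · rw [sub_eq_zero.1 h2]
  · rw [h2] at h; exact absurd (by linarith) hp

variable (hC : Conf c M A D u)
  (hL : Elong (fun v : {e // e ∈ M} × Bool => beyond v.1.1 v.2)
    (fun v => obst c M A D u v.1.1 v.2) Set.univ fin s)
include hC

lemma finite_cross {ou : Pt} {lam : Pt → Prop} :
    {z | (arms c M A D u fin s ou lam).Cross z}.Finite := by
  have : {z | (arms c M A D u fin s ou lam).Cross z} ⊆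
      {z | z.1 = c ∧ z ∈ segment ℝ u.2 u.1} ∪
        ⋃ k, {z | z.1 = c ∧ z ∈ (arms c M A D u fin s ou lam).arm k} := by
    rintro z ⟨h1, h2 | ⟨k, h2⟩⟩
    · exact Or.inl ⟨h1, h2⟩
    · exact Or.inr (Set.mem_iUnion.2 ⟨k, h1, Chase.inter_subset k h2⟩)
  refine (Set.Finite.union ?_ (Set.finite_iUnion fun k => ?_)).subset this
  · exact Set.Subsingleton.finite fun z hz z' hz' =>
      eq_of_mem_segment_vertical hC.u_left.ne hz.2 hz'.2 hz.1 hz'.1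
  · exact Set.Subsingleton.finite fun z hz z' hz' =>
      Chase.eq_of_mem_arm (arms_o_off hC k) hz.2 hz'.2 hz.1 hz'.1

lemma arc_twoSided (hs : ∀ v, 0 < s v) {d : Pt × Pt} (hd : d ∈ D) {z : Pt}
    (hz : z ∈ segment ℝ d.1 d.2) :
    ∃ j, TwoSided (screen c M A D u fin s j) z := by
  have vert : ∀ p, Vert M p → ∃ j, TwoSided (screen c M A D u fin s j) p := by
    rintro p ⟨e, he, rfl | rfl⟩
    · exact ⟨Sum.inl ⟨e, he⟩, bar_segment (fun _ he => hC.edge_ne he) hs he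
        (left_mem_segment _ _ _)⟩
    · exact ⟨Sum.inl ⟨e, he⟩, bar_segment (fun _ he => hC.edge_ne he) hs he
        (right_mem_segment _ _ _)⟩
  by_cases ho : z ∈ openSegment ℝ d.1 d.2
  · refine ⟨Sum.inr (Sum.inl ⟨d, hd⟩), ?_⟩
    rw [openSegment_eq_image'] at ho
    obtain ⟨t, ⟨h0, h1⟩, rfl⟩ := ho
    change TwoSided (segment ℝ d.1 d.2) _
    rw [segment_eq_image']
    have hm : 0 < min t (1 - t) := lt_min h0 (by linarith)
    have hm1 := min_le_left t (1 - t)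
    have hm2 := min_le_right t (1 - t)
    refine ⟨min t (1 - t) • (d.2 - d.1), smul_ne_zero hm.ne' (sub_ne_zero.2 (hC.arc_ne hd).symm),
      ⟨t + min t (1 - t), ⟨by linarith, by linarith⟩, ?_⟩,
      ⟨t - min t (1 - t), ⟨by linarith, by linarith⟩, ?_⟩⟩
    · simp only; module
    · simp only; module
  · rcases endpoint_of_not_open hz ho with rfl | rfl
    · exact vert _ (hC.arc_vert_left hd)
    · exact vert _ (hC.arc_vert_right hd)

lemma cross_twoSided (hs : ∀ v, 0 < s v) {ou : Pt} {lam : Pt → Prop} {z : Pt}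
    (hz : (arms c M A D u fin s ou lam).Cross z) : ∃ j, TwoSided (screen c M A D u fin s j) z := by
  rcases hz.2 with h | ⟨v | d, h⟩
  · refine ⟨Sum.inl ⟨u, hC.uM⟩, bar_segment (fun _ he => hC.edge_ne he) hs hC.uM ?_⟩
    rwa [segment_symm]
  · obtain ⟨t, h1, h2, rfl⟩ := (mem_inter_inl hs).1 h
    refine ⟨Sum.inl v.1, bar_strict (fun _ he => hC.edge_ne he) h2 fun _ => ?_⟩
    linarith [hs (v.1, !v.2), neg_one_le_low A u v.1.1 v.2]
  · exact arc_twoSided hC hs d.2 (openSegment_subset_segment _ _ _ (mem_inter_inr.1 h))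

include hL

lemma gateWall_twoSided {v : {e // e ∈ M} × Bool} {z : Pt}
    (hz : z ∈ gateWall (arms c M A D u fin s 0 fun _ => False) v) :
    ∃ j, TwoSided (screen c M A D u fin s j) z := by
  by_cases hx : (arms c M A D u fin s 0 fun _ => False).Cross z
  · exact cross_twoSided hC hL.pos hx
  have : Finite {z | (arms c M A D u fin s 0 fun _ => False).Cross z} := finite_cross hC
  obtain ⟨h1, h2, h3⟩ := hz
  obtain ⟨η, h0, hη⟩ := exists_small
    (ι := {z | (arms c M A D u fin s 0 fun _ => False).Cross z})
    (P := fun x δ => δ ≤ |x.1.2 - z.2|) fun x => by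
      refine ⟨|x.1.2 - z.2|, abs_pos.2 (sub_ne_zero.2 fun h => hx ?_), fun δ _ h => h⟩
      have : x.1 = z := Prod.ext (x.2.1.trans h2.symm) h
      exact this ▸ x.2
  refine ⟨Sum.inr (Sum.inr v), (0, η), by simp [h0.ne'], ⟨h1, by simp [h2], fun x hx => ?_⟩,
    ⟨h1, by simp [h2], fun x hx => ?_⟩⟩
  · have h4 := hη ⟨x, hx⟩
    simp only at h4
    refine ⟨fun h => ?_, fun h => ?_⟩
    · have := (h3 x hx).1 h
      simp; linarith
    · have := (h3 x hx).2 h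
      rw [abs_of_nonneg (by linarith)] at h4
      simp; linarith
  · have h4 := hη ⟨x, hx⟩
    simp only at h4
    refine ⟨fun h => ?_, fun h => ?_⟩
    · have := (h3 x hx).1 h
      rw [abs_of_nonpos (by linarith)] at h4
      simp; linarith
    · have := (h3 x hx).2 h
      simp; linarith

lemma tip_twoSided {v : {e // e ∈ M} × Bool} (hf : fin v) :
    ∃ j, TwoSided (screen c M A D u fin s j) (beyond v.1.1 v.2 (s v)) := by
  rcases hL.hit v trivial hf with (⟨f, hf, h1⟩ | ⟨d, hd, h1⟩ | h1) | ⟨v', _, hne, t, ht, h1, h2⟩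
  · exact ⟨Sum.inl ⟨f, hf⟩, bar_segment (fun _ he => hC.edge_ne he) hL.pos hf h1⟩
  · exact arc_twoSided hC hL.pos hd h1
  · refine gateWall_twoSided (v := v) hC hL ⟨⟨hf, ?_⟩, h1.2, fun x _ => ?_⟩
    · rw [tip_inl hf]; exact h1.2
    · rw [tip_inl hf]; exact ⟨le_of_lt, le_of_lt⟩
  · rw [← h2]
    exact ⟨Sum.inl v'.1, bar_strict (fun _ he => hC.edge_ne he) h1
      fun _ => by linarith [hL.pos (v'.1, !v'.2)]⟩

lemma screen_twoSided : ∀ i, ∀ z ∈ screen c M A D u fin s i,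
    ∃ j, TwoSided (screen c M A D u fin s j) z := by
  rintro (e | d | v) z hz
  · obtain ⟨t, h1, h2, rfl⟩ := hz
    by_cases h3 : fin (e, true) → t < s (e, true)
    · by_cases h4 : fin (e, false) → -1 - t < s (e, false)
      · exact ⟨Sum.inl e, bar_strict (fun _ he => hC.edge_ne he) h3 h4⟩
      · push Not at h4
        have := tip_twoSided hC hL h4.1
        rwa [← le_antisymm (h2 h4.1) h4.2, ← beyond_not] at this
    · push Not at h3
      have := tip_twoSided hC hL h3.1
      rwa [← le_antisymm (h1 h3.1) h3.2] at this
  · exact arc_twoSided hC hL.pos d.2 hz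
  · exact gateWall_twoSided hC hL hz

end Bars

section Core

variable {c : ℝ} {M A D : Finset (Pt × Pt)} {u : Pt × Pt}

/-- The points seen by a red point of `A`; red points on the left do not see the right side. -/
def Lit (c : ℝ) (A : Finset (Pt × Pt)) {ι : Type*} (W : ι → Set Pt) (z : Pt) : Prop :=
  ∃ e ∈ A, Free W e.2 z ∧ (c < z.1 → c < e.2.1)

/-- The pair `(f.1, e.2)` may be joined by a new arc. -/
def Joins (c : ℝ) (M A D : Finset (Pt × Pt)) (u e f : Pt × Pt) : Prop :=
  e ∈ A ∧ f ∈ M ∧ (f ∉ A ∨ f = u) ∧ ¬ (e.2.1 < c ∧ c < f.1.1) ∧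
    ∀ z ∈ openSegment ℝ e.2 f.1, (∀ g ∈ M, z ∉ segment ℝ g.1 g.2) ∧ ∀ d ∈ D, z ∉ segment ℝ d.1 d.2

lemma isWall_vertical (c : ℝ) : IsWall {z : Pt | z.1 = c} where
  closed := isClosed_eq (by fun_prop) (by fun_prop)
  convex := by
    intro y hy z hz a b ha hb hab
    simp only [Set.mem_ofPred_eq] at hy hz ⊢
    simp [hy, hz, ← add_mul, hab]
  line := ⟨(c, 0), (0, 1), by simp, fun z hz => by
    simp only [Set.mem_ofPred_eq] at hz; simp [cr, hz]⟩

/-- A vertical segment free of the vertical line does not change side. -/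
lemma free_vertical {c : ℝ} {p z : Pt} (hp : p.1 ≠ c)
    (h : Free (fun _ : Unit => {z : Pt | z.1 = c}) p z) : c < z.1 ↔ c < p.1 := by
  have key : ∀ t : ℝ, 0 < t → t ≤ 1 → p.1 + t * (z.1 - p.1) ≠ c := by
    intro t h0 h1 he
    exact h t h0 h1 () (by simpa using he)
  constructor
  · intro hz
    by_contra hcon
    have hp' : p.1 < c := lt_of_le_of_ne (not_lt.1 hcon) hp
    refine key ((c - p.1) / (z.1 - p.1)) (by apply div_pos <;> linarith) ?_ ?_
    · rw [div_le_one (by linarith)]; linarith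
    · rw [div_mul_cancel₀ _ (by linarith)]; ring
  · intro hp'
    by_contra hcon
    have hz : z.1 ≤ c := not_lt.1 hcon
    refine key ((c - p.1) / (z.1 - p.1)) (div_pos_of_neg_of_neg (by linarith) (by linarith)) ?_ ?_
    · rw [div_le_one_of_neg (by linarith)]; linarith
    · rw [div_mul_cancel₀ _ (by linarith)]; ring

variable {fin : {e // e ∈ M} × Bool → Prop} {s : {e // e ∈ M} × Bool → ℝ} {ou : Pt}

lemma Free.of_segment {ι : Type*} {W : ι → Set Pt} {p q : Pt}
    (h : ∀ y ∈ segment ℝ p q, ∀ i, y ∉ W i) : Free W p q := by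
  intro t h0 h1 i
  refine h _ ?_ i
  rw [segment_eq_image']
  exact ⟨t, ⟨h0.le, h1⟩, rfl⟩

lemma bar_subset_arms (hs : ∀ v, 0 < s v) {lam : Pt → Prop} {e : {e // e ∈ M}} {z : Pt}
    (hz : z ∈ bar fin s e) :
    (∃ k, z ∈ (arms c M A D u fin s ou lam).arm k) ∨ z ∈ segment ℝ u.2 u.1 := by
  obtain ⟨t, h1, h2, rfl⟩ := hz
  by_cases h3 : low A u e.1 true ≤ t
  · exact Or.inl ⟨Sum.inl (e, true), (mem_arm_inl hs).2 ⟨t, h3, h1, rfl⟩⟩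
  by_cases h4 : low A u e.1 false ≤ -1 - t
  · refine Or.inl ⟨Sum.inl (e, false), (mem_arm_inl hs).2 ⟨-1 - t, h4, h2, ?_⟩⟩
    rw [← beyond_not]; simp
  right
  by_cases heu : e.1 = u
  · rw [heu, low_self] at h3 h4
    rw [heu, segment_symm]
    exact beyond_mem_segment (by linarith) (by linarith)
  · have := low_add (A := A) heu true
    simp only [Bool.not_true] at this
    linarith

lemma vert_on {hC : Conf c M A D u} {x y p : Pt} (hx : Vert M x) (hy : Vert M y) (hp : Vert M p)
    (hxy : x ≠ y) (h : cr (p - x) (y - x) = 0) : p = x ∨ p = y := by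
  by_contra hcon
  push Not at hcon
  exact hC.gen x p y hx hp hy hcon.1.symm hxy hcon.2 h

variable (hC : Conf c M A D u)
  (hL : Elong (fun v : {e // e ∈ M} × Bool => beyond v.1.1 v.2)
    (fun v => obst c M A D u v.1.1 v.2) Set.univ fin s)
include hC

lemma lit_red {ι : Type*} [Finite ι] {W : ι → Set Pt} (hW : ∀ i, IsWall (W i)) {e : Pt × Pt}
    (he : e ∈ A) {d n : Pt} (hdn : cr d n ≠ 0) : Germ (Lit c A W) e.2 d n := by
  have h := germ_free (W := Sum.elim W fun _ : Unit => {z : Pt | z.1 = c})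
    (by rintro (i | _); exacts [hW i, isWall_vertical c]) e.2 hdn
  refine h.mono fun z hz => ⟨e, he, fun t h0 h1 i => hz t h0 h1 (Sum.inl i), fun hlt => ?_⟩
  refine (free_vertical (hC.off _ (Conf.vert_right (hC.AM he))) ?_).1 hlt
  exact fun t h0 h1 i => hz t h0 h1 (Sum.inr i)

include hL

/-- If no new arc can be added then the blue points outside `A` are dark. -/
lemma dark_blue (hN : ∀ e f, ¬ Joins c M A D u e f) {f : Pt × Pt} (hf : f ∈ M)
    (hfA : f ∉ A ∨ f = u) {d n : Pt} (hdn : cr d n ≠ 0) :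
    Germ (fun z => ¬ Lit c A (screen c M A D u fin s) z) f.1 d n := by
  have hW : ∀ i, IsWall (screen c M A D u fin s i) := isWall_screen hC
  have h := germ_free (W := Sum.elim (screen c M A D u fin s) fun _ : Unit => {z : Pt | z.1 = c})
    (by rintro (i | _); exacts [hW i, isWall_vertical c]) f.1 hdn
  refine h.mono fun z hz => ?_
  have hz1 : Free (screen c M A D u fin s) f.1 z := fun t h0 h1 i => hz t h0 h1 (Sum.inl i)
  have hz2 := free_vertical (hC.off _ (Conf.vert_left hf))
    (fun t h0 h1 i => hz t h0 h1 (Sum.inr i))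
  rintro ⟨e, he, hez, hside⟩
  have heM := hC.AM he
  have hpq : e.2 ≠ f.1 := (hC.colour f hf e heM).symm
  have hns : ¬ (e.2.1 < c ∧ c < f.1.1) := fun ⟨h1, h2⟩ => by
    have := hside (hz2.2 h2)
    linarith
  have : ∃ y ∈ openSegment ℝ e.2 f.1, ∃ i, y ∈ screen c M A D u fin s i := by
    by_contra hcon
    push Not at hcon
    refine hN e f ⟨he, hf, hfA, hns, fun y hy => ⟨fun g hg hyg => ?_, fun d' hd hyd => ?_⟩⟩
    · exact hcon y hy (Sum.inl ⟨g, hg⟩) (segment_subset_bar hL.pos hg hyg)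
    · exact hcon y hy (Sum.inr (Sum.inl ⟨d', hd⟩)) hyd
  obtain ⟨y, hy, i, hi⟩ := this
  rw [openSegment_eq_image'] at hy
  obtain ⟨t, ⟨h0, h1⟩, rfl⟩ := hy
  obtain ⟨j, w, hw, hwd, hj1, hj2⟩ := hit_parallel hW (screen_twoSided hC hL) hpq hez hz1 h0 h1 hi
  -- a line through two points at `± w` around `y` contains both `e.2` and `f.1`
  have line : ∀ a v : Pt, v ≠ 0 → cr (e.2 + t • (f.1 - e.2) + w - a) v = 0 →
      cr (e.2 + t • (f.1 - e.2) - w - a) v = 0 → cr (e.2 - a) v = 0 ∧ cr (f.1 - a) v = 0 := by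
    intro a v hv h2 h3
    obtain ⟨m, hm⟩ := exists_smul_of_cr_eq_zero hw
      (show cr w (f.1 - e.2) = 0 by rw [cr_comm, hwd, neg_zero])
    have h4 : cr w v = 0 := by
      simp only [cr_sub_left, cr_add_left] at h2 h3
      linarith
    have h5 : cr (f.1 - e.2) v = 0 := by rw [hm, cr_smul_left, h4, mul_zero]
    have h6 : cr (e.2 - a) v = 0 := by
      have : e.2 - a = (e.2 + t • (f.1 - e.2) + w - a) - t • (f.1 - e.2) - w := by module
      rw [this, cr_sub_left, cr_sub_left, cr_smul_left, h2, h5, h4]; ring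
    refine ⟨h6, ?_⟩
    have : f.1 - a = (f.1 - e.2) + (e.2 - a) := by abel
    rw [this, cr_add_left, h5, h6, add_zero]
  rcases j with g | d' | v
  · obtain ⟨h2, h3⟩ := line _ _ (sub_ne_zero.2 (hC.edge_ne g.2).symm) (bar_line hj1) (bar_line hj2)
    have h4 : e = g.1 := by
      rcases hC.vert_on_line (Conf.vert_right heM) g.2 h2 with h | h
      · exact absurd h.symm (hC.colour _ g.2 _ heM)
      · exact hC.red_inj _ heM _ g.2 h
    have h5 : f = g.1 := by
      rcases hC.vert_on_line (Conf.vert_left hf) g.2 h3 with h | h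
      · exact hC.blue_inj _ hf _ g.2 h
      · exact absurd h (hC.colour _ hf _ g.2)
    have h6 : f = u := hfA.resolve_left fun h => h (h5.trans h4.symm ▸ he)
    have h7 : e = u := h4.trans (h5.symm.trans h6)
    rw [h6, h7] at hns
    exact hns ⟨hC.u_left, hC.u_right⟩
  · obtain ⟨h2, h3⟩ := line _ _ (sub_ne_zero.2 (hC.arc_ne d'.2).symm) (segment_line hj1)
      (segment_line hj2)
    have h4 := vert_on (hC := hC) (hC.arc_vert_left d'.2) (hC.arc_vert_right d'.2)
      (Conf.vert_left hf) (hC.arc_ne d'.2) h3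
    obtain ⟨e', he', f', hf', hfu, _, heq⟩ := hC.arc _ d'.2
    rw [heq] at h4
    rcases h4 with h | h
    · have : f = f' := hC.blue_inj _ hf _ (hC.AM hf') h
      rcases hfA with h' | h'
      · exact h' (this ▸ hf')
      · exact hfu (this.symm.trans h')
    · exact hC.colour _ hf _ (hC.AM he') h
  · have h2 : (e.2 + t • (f.1 - e.2) + w).1 = c := hj1.2.1
    obtain ⟨h3, _⟩ := line (c, 0) (0, 1) (by simp)
      (by simp only [cr, Prod.fst_sub]; rw [h2]; simp)
      (by
        have h3 : (e.2 + t • (f.1 - e.2) - w).1 = c := hj2.2.1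
        simp only [cr, Prod.fst_sub]; rw [Prod.fst_sub] at h3; rw [h3]; simp)
    refine hC.off _ (Conf.vert_right heM) ?_
    simp [cr] at h3
    linarith

lemma mem_screen_cases {lam : Pt → Prop} {z : Pt} {i} (hz : z ∈ screen c M A D u fin s i) :
    (∃ k, z ∈ (arms c M A D u fin s ou lam).arm k) ∨ z ∈ segment ℝ u.2 u.1 ∨ z.1 = c ∧
      ∃ v, z ∈ gateWall (arms c M A D u fin s 0 fun _ => False) v := by
  rcases i with e | d | v
  · rcases bar_subset_arms hL.pos hz with h | h
    · exact Or.inl h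
    · exact Or.inr (Or.inl h)
  · exact Or.inl ⟨Sum.inr d, mem_arm_inr.2 hz⟩
  · exact Or.inr (Or.inr ⟨hz.2.1, v, hz⟩)

lemma valid_arms (hN : ∀ e f, ¬ Joins c M A D u e f) (hou : ou ∈ openSegment ℝ u.2 u.1)
    (houc : ou.1 = c) {g : Pt × Pt} (hg : g ∈ M) {z : Pt} (hz : z ∈ segment ℝ g.1 g.2)
    (hzc : z.1 = c) (hzo : z.2 < ou.2) :
    (arms c M A D u fin s ou (Lit c A (screen c M A D u fin s))).Valid where
  hw := by
    rintro (v | d)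
    · refine smul_ne_zero ?_ (sub_ne_zero.2 fun h => ?_)
      · have h1 := low_le A u v.1.1 v.2
        have h2 := hL.pos v
        split_ifs
        · exact (by linarith : 0 < s v - low A u v.1.1 v.2).ne'
        · exact one_ne_zero
      · exact one_ne_zero (beyond_inj (hC.edge_ne v.1.2) h)
    · exact sub_ne_zero.2 (hC.arc_ne d.2)
  arm_int := arms_arm_int hC hL
  arm_u := arms_arm_u hC hL
  u_int := arms_u_int hC hL
  fin_side := arms_fin_side hC hL
  int_side := arms_int_side hC hL
  o_off := arms_o_off hC
  arm_arm := arms_arm_arm hC hL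
  arm_seg := arms_arm_seg hC hL
  r_left := hC.u_left
  b_right := hC.u_right
  ou_mem := hou
  ou_on := houc
  below := by
    have hgu : g ≠ u := by
      rintro rfl
      have := eq_of_mem_segment_vertical hC.u_left.ne (segment_symm ℝ g.1 g.2 ▸ hz)
        (openSegment_subset_segment _ _ _ hou) hzc houc
      rw [this] at hzo
      exact lt_irrefl _ hzo
    have h1 := low_add (A := A) hgu true
    obtain ⟨i, hi⟩ : ∃ i, low A u g i = -1 := by
      rcases low_eq A u g true with h2 | h2
      · exact ⟨false, by simp only [Bool.not_true] at h1; linarith⟩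
      · exact ⟨true, h2.1⟩
    obtain ⟨t, h2, h3, rfl⟩ := mem_segment_beyond i hz
    refine ⟨Sum.inl (⟨g, hg⟩, i), _, (mem_inter_inl hL.pos).2 ⟨t, ?_, fun _ => ?_, rfl⟩, hzc, hzo⟩
    · simp only [hi]
      refine lt_of_le_of_ne h2 ?_
      rintro rfl
      refine hC.off _ (hC.vert_beyond hg (!i)) ?_
      rw [beyond_not]; simpa using hzc
    · have := hL.pos (⟨g, hg⟩, i)
      linarith
  const := by
    rintro y y' h ⟨e, he, hfree, hside⟩
    have h1 : ∀ x ∈ segment ℝ y y', ∀ i, x ∉ screen c M A D u fin s i := by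
      intro x hx i hi
      rcases mem_screen_cases (ou := ou) (lam := Lit c A (screen c M A D u fin s)) hC hL hi with
        ⟨k, hk⟩ | hk | hk
      · exact h x hx (some (some k)) hk
      · exact h x hx (some none) hk
      · exact h x hx none hk.1
    have hy' : ∀ i, y' ∉ screen c M A D u fin s i := h1 _ (right_mem_segment _ _ _)
    refine ⟨e, he, hfree.extend (isWall_screen hC) (screen_twoSided hC hL) ?_
      (Free.of_segment (segment_symm ℝ y y' ▸ h1)) hy', fun hlt => hside ?_⟩
    · rintro heq
      refine hy' (Sum.inl ⟨e, hC.AM he⟩) (segment_subset_bar hL.pos _ ?_)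
      rw [← heq]; exact right_mem_segment _ _ _
    · refine (free_vertical (p := y) (z := y') ?_ (Free.of_segment fun x hx _ => ?_)).1 hlt
      · exact fun hy => h y (left_mem_segment _ _ _) none hy
      · exact fun hx' => h x hx none hx'
  gate := by
    rintro x hx hxa hxu hg z z' hz hz' hxz hseg ⟨e, he, hfree, -⟩
    have h1 : ∀ y ∈ segment ℝ z z', ∀ i, y ∉ screen c M A D u fin s i := by
      intro y hy i hi
      rcases mem_screen_cases (ou := ou) (lam := Lit c A (screen c M A D u fin s)) hC hL hi with
        ⟨k, hk⟩ | hk | ⟨hk, v, hv⟩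
      · exact (hseg y hy).1 k hk
      · exact (hseg y hy).2 hk
      · obtain rfl : y = x := eq_of_mem_segment_vertical hz.ne' hy hxz hk hx
        obtain ⟨hv1, hv2, hv3⟩ := hv
        obtain ⟨q, hq, hq1 | hq1⟩ := hg (Sum.inl v) hv1
        · have := (hv3 q hq).1 hq1.2
          linarith [hq1.1]
        · have := (hv3 q hq).2 hq1.1
          linarith [hq1.2]
    have hy' : ∀ i, z' ∉ screen c M A D u fin s i := h1 _ (right_mem_segment _ _ _)
    refine ⟨e, he, hfree.extend (isWall_screen hC) (screen_twoSided hC hL) ?_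
      (Free.of_segment (segment_symm ℝ z z' ▸ h1)) hy', fun hlt => absurd hlt (not_lt.2 hz'.le)⟩
    rintro heq
    refine hy' (Sum.inl ⟨e, hC.AM he⟩) (segment_subset_bar hL.pos _ ?_)
    rw [← heq]; exact right_mem_segment _ _ _
  germ_o := by
    rintro (v | d) w n hwn hτ
    · have : lab A u v.1.1 v.2 := hτ
      change Germ _ (org A u v.1.1 v.2) _ _
      rw [org, if_pos this]
      refine lit_red hC (isWall_screen hC) ?_ hwn
      by_cases h : v.1.1 = u
      · rw [h]; exact hC.uA
      · simpa [lab, h] using this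
    · obtain ⟨e, he, f, hf, _, _, heq⟩ := hC.arc _ d.2
      change Germ _ d.1.2 _ _
      rw [heq]
      exact lit_red hC (isWall_screen hC) he hwn
  germ_o' := by
    rintro (v | d) w n hwn hτ
    · have : ¬ lab A u v.1.1 v.2 := hτ
      change Germ _ (org A u v.1.1 v.2) _ _
      rw [org, if_neg this]
      refine dark_blue hC hL hN v.1.2 ?_ hwn
      by_cases h : v.1.1 = u
      · exact Or.inr h
      · left; simpa [lab, h] using this
    · exact absurd trivial hτ
  germ_r := fun d n hdn => lit_red hC (isWall_screen hC) hC.uA hdn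
  germ_b := fun d n hdn => dark_blue hC hL hN hC.uM (Or.inr rfl) hdn

omit hL in
/-- If some edge crosses the vertical line below `u` then the arcs can be extended. -/
theorem exists_joins (hou : ou ∈ openSegment ℝ u.2 u.1)
    (houc : ou.1 = c) {g : Pt × Pt} (hg : g ∈ M) {z : Pt} (hz : z ∈ segment ℝ g.1 g.2)
    (hzc : z.1 = c) (hzo : z.2 < ou.2) : ∃ e f, Joins c M A D u e f := by
  by_contra hN
  push Not at hN
  obtain ⟨fin, s, hL⟩ := hC.exists_extension
  exact (valid_arms hC hL hN hou houc hg hz hzc hzo).false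

end Core

section Growth

variable {c : ℝ} {M A D : Finset (Pt × Pt)} {u : Pt × Pt}

/-- The arcs of `N` join the edges of `C` into a path from `u` to `e`. -/
structure Track (A D C N : Finset (Pt × Pt)) (u e : Pt × Pt) : Prop where
  CA : C ⊆ A
  ND : N ⊆ D
  uC : u ∈ C
  eC : e ∈ C
  blue : ∀ f ∈ C, f ≠ u → ∃ n ∈ N, n.1 = f.1
  red : ∀ f ∈ C, f ≠ e → ∃ n ∈ N, n.2 = f.2
  blue' : ∀ n ∈ N, ∃ f ∈ C, f ≠ u ∧ n.1 = f.1
  red' : ∀ n ∈ N, ∃ f ∈ C, f ≠ e ∧ n.2 = f.2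
  blue_inj : ∀ n ∈ N, ∀ n' ∈ N, n.1 = n'.1 → n = n'
  red_inj : ∀ n ∈ N, ∀ n' ∈ N, n.2 = n'.2 → n = n'

lemma Track.mono {A' D' C N : Finset (Pt × Pt)} {e : Pt × Pt} (h : Track A D C N u e)
    (hA : A ⊆ A') (hD : D ⊆ D') : Track A' D' C N u e :=
  { h with CA := h.CA.trans hA, ND := h.ND.trans hD }

lemma Track.extend (hC : Conf c M A D u) {C N : Finset (Pt × Pt)} {e f : Pt × Pt}
    (h : Track A D C N u e) (hfM : f ∈ M) (hfA : f ∉ A) :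
    Track (insert f A) (insert (f.1, e.2) D) (insert f C) (insert (f.1, e.2) N) u f := by
  have hfC : f ∉ C := fun h' => hfA (h.CA h')
  have hCM : ∀ g ∈ C, g ∈ M := fun g hg => hC.AM (h.CA hg)
  have hef : e ≠ f := fun h' => hfC (h' ▸ h.eC)
  have hfu : f ≠ u := fun h' => hfC (h' ▸ h.uC)
  have hb : ∀ n ∈ N, n.1 ≠ f.1 := by
    intro n hn heq
    obtain ⟨g, hg, _, h1⟩ := h.blue' n hn
    exact hfC (hC.blue_inj g (hCM g hg) f hfM (h1.symm.trans heq) ▸ hg)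
  have hr : ∀ n ∈ N, n.2 ≠ e.2 := by
    intro n hn heq
    obtain ⟨g, hg, h1, h2⟩ := h.red' n hn
    exact h1 (hC.red_inj g (hCM g hg) e (hCM e h.eC) (h2.symm.trans heq))
  refine ⟨insert_subset_insert _ h.CA, insert_subset_insert _ h.ND, mem_insert_of_mem h.uC,
    mem_insert_self _ _, ?_, ?_, ?_, ?_, ?_, ?_⟩
  · intro g hg hgu
    rcases mem_insert.1 hg with rfl | hg
    · exact ⟨_, mem_insert_self _ _, rfl⟩
    · obtain ⟨n, hn, h1⟩ := h.blue g hg hgu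
      exact ⟨n, mem_insert_of_mem hn, h1⟩
  · intro g hg hgf
    replace hg := (mem_insert.1 hg).resolve_left hgf
    by_cases hge : g = e
    · exact ⟨_, mem_insert_self _ _, by rw [hge]⟩
    · obtain ⟨n, hn, h1⟩ := h.red g hg hge
      exact ⟨n, mem_insert_of_mem hn, h1⟩
  · intro n hn
    rcases mem_insert.1 hn with rfl | hn
    · exact ⟨f, mem_insert_self _ _, hfu, rfl⟩
    · obtain ⟨g, hg, h1⟩ := h.blue' n hn
      exact ⟨g, mem_insert_of_mem hg, h1⟩
  · intro n hn
    rcases mem_insert.1 hn with rfl | hn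
    · exact ⟨e, mem_insert_of_mem h.eC, hef, rfl⟩
    · obtain ⟨g, hg, _, h2⟩ := h.red' n hn
      exact ⟨g, mem_insert_of_mem hg, fun h' => hfC (h' ▸ hg), h2⟩
  · intro n hn n' hn' heq
    rcases mem_insert.1 hn with rfl | hn <;> rcases mem_insert.1 hn' with rfl | hn'
    · rfl
    · exact absurd heq.symm (hb n' hn')
    · exact absurd heq (hb n hn)
    · exact h.blue_inj n hn n' hn' heq
  · intro n hn n' hn' heq
    rcases mem_insert.1 hn with rfl | hn <;> rcases mem_insert.1 hn' with rfl | hn'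
    · rfl
    · exact absurd heq.symm (hr n' hn')
    · exact absurd heq (hr n hn)
    · exact h.red_inj n hn n' hn' heq

section
variable (hC : Conf c M A D u) {e f : Pt × Pt} (hj : Joins c M A D u e f)
include hC hj

lemma joins_arc_edge : ∀ d ∈ insert (f.1, e.2) D, ∀ g ∈ M, ∀ z ∈ openSegment ℝ d.1 d.2,
    z ∉ segment ℝ g.1 g.2 := by
  intro d hd g hg z hz
  rcases mem_insert.1 hd with rfl | hd
  · rw [openSegment_symm] at hz
    exact (hj.2.2.2.2 z hz).1 g hg
  · exact hC.arc_edge d hd g hg z hz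

lemma joins_arc_arc : ∀ d ∈ insert (f.1, e.2) D, ∀ d' ∈ insert (f.1, e.2) D, d ≠ d' →
    ∀ z ∈ openSegment ℝ d.1 d.2, z ∉ segment ℝ d'.1 d'.2 := by
  intro d hd d' hd' hne z hz hz'
  rcases mem_insert.1 hd with rfl | hd
  · rcases mem_insert.1 hd' with rfl | hd'
    · exact hne rfl
    · rw [openSegment_symm] at hz
      exact (hj.2.2.2.2 z hz).2 d' hd' hz'
  · rcases mem_insert.1 hd' with rfl | hd'
    · by_cases ho : z ∈ openSegment ℝ f.1 e.2
      · rw [openSegment_symm] at ho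
        exact (hj.2.2.2.2 z ho).2 d hd (openSegment_subset_segment _ _ _ hz)
      · rcases endpoint_of_not_open hz' ho with rfl | rfl
        · exact hC.arc_edge d hd f hj.2.1 _ hz (left_mem_segment _ _ _)
        · exact hC.arc_edge d hd e (hC.AM hj.1) _ hz (right_mem_segment _ _ _)
    · exact hC.arc_arc d hd d' hd' hne z hz hz'

lemma Conf.extend (hfA : f ∉ A) : Conf c M (insert f A) (insert (f.1, e.2) D) u where
  gen := hC.gen
  blue_inj := hC.blue_inj
  red_inj := hC.red_inj
  colour := hC.colour
  plane := hC.plane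
  off := hC.off
  lines := hC.lines
  uM := hC.uM
  u_left := hC.u_left
  u_right := hC.u_right
  uniq := hC.uniq
  AM := insert_subset hj.2.1 hC.AM
  uA := mem_insert_of_mem hC.uA
  arc := by
    intro d hd
    rcases mem_insert.1 hd with rfl | hd
    · exact ⟨e, mem_insert_of_mem hj.1, f, mem_insert_self _ _, fun h => hfA (h ▸ hC.uA),
        fun h => hfA (h ▸ hj.1), rfl⟩
    · obtain ⟨e', he', f', hf', h⟩ := hC.arc d hd
      exact ⟨e', mem_insert_of_mem he', f', mem_insert_of_mem hf', h⟩
  arc_side := by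
    intro d hd
    rcases mem_insert.1 hd with rfl | hd
    · exact hj.2.2.2.1
    · exact hC.arc_side d hd
  arc_edge := joins_arc_edge hC hj
  arc_arc := joins_arc_arc hC hj

end

lemma exchange {B R : Finset Pt} (hM : IsBRMatching B R M) (hC : Conf c M A D u) {e : Pt × Pt}
    (hj : Joins c M A D u e u) {C N : Finset (Pt × Pt)} (h : Track A D C N u e) :
    ∃ M', IsBRMatching B R M' ∧ Compatible M M' ∧ ∀ e ∈ M', ¬ (e.2.1 < c ∧ c < e.1.1) := by
  set D' := insert (u.1, e.2) D with hD'
  set N' := insert (u.1, e.2) N with hN'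
  have hCM : ∀ g ∈ C, g ∈ M := fun g hg => hC.AM (h.CA hg)
  have hND : N' ⊆ D' := insert_subset_insert _ h.ND
  have ae := joins_arc_edge hC hj
  have aa := joins_arc_arc hC hj
  have blue : ∀ f ∈ C, ∃ n ∈ N', n.1 = f.1 := by
    intro f hf
    by_cases hfu : f = u
    · exact ⟨_, mem_insert_self _ _, by rw [hfu]⟩
    · obtain ⟨n, hn, h1⟩ := h.blue f hf hfu
      exact ⟨n, mem_insert_of_mem hn, h1⟩
  have red : ∀ f ∈ C, ∃ n ∈ N', n.2 = f.2 := by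
    intro f hf
    by_cases hfe : f = e
    · exact ⟨_, mem_insert_self _ _, by rw [hfe]⟩
    · obtain ⟨n, hn, h1⟩ := h.red f hf hfe
      exact ⟨n, mem_insert_of_mem hn, h1⟩
  have blue' : ∀ n ∈ N', ∃ f ∈ C, n.1 = f.1 := by
    intro n hn
    rcases mem_insert.1 hn with rfl | hn
    · exact ⟨u, h.uC, rfl⟩
    · obtain ⟨f, hf, _, h1⟩ := h.blue' n hn
      exact ⟨f, hf, h1⟩
  have red' : ∀ n ∈ N', ∃ f ∈ C, n.2 = f.2 := by
    intro n hn
    rcases mem_insert.1 hn with rfl | hn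
    · exact ⟨e, h.eC, rfl⟩
    · obtain ⟨f, hf, _, h1⟩ := h.red' n hn
      exact ⟨f, hf, h1⟩
  have hb : ∀ n ∈ N, n.1 ≠ u.1 := by
    intro n hn heq
    obtain ⟨g, hg, h0, h1⟩ := h.blue' n hn
    exact h0 (hC.blue_inj g (hCM g hg) u hC.uM (h1.symm.trans heq))
  have hr : ∀ n ∈ N, n.2 ≠ e.2 := by
    intro n hn heq
    obtain ⟨g, hg, h1, h2⟩ := h.red' n hn
    exact h1 (hC.red_inj g (hCM g hg) e (hCM e h.eC) (h2.symm.trans heq))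
  have binj : ∀ n ∈ N', ∀ n' ∈ N', n.1 = n'.1 → n = n' := by
    intro n hn n' hn' heq
    rcases mem_insert.1 hn with rfl | hn <;> rcases mem_insert.1 hn' with rfl | hn'
    · rfl
    · exact absurd heq.symm (hb n' hn')
    · exact absurd heq (hb n hn)
    · exact h.blue_inj n hn n' hn' heq
  have rinj : ∀ n ∈ N', ∀ n' ∈ N', n.2 = n'.2 → n = n' := by
    intro n hn n' hn' heq
    rcases mem_insert.1 hn with rfl | hn <;> rcases mem_insert.1 hn' with rfl | hn'
    · rfl
    · exact absurd heq.symm (hr n' hn')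
    · exact absurd heq (hr n hn)
    · exact h.red_inj n hn n' hn' heq
  have vert : ∀ n ∈ N', ∀ p, p = n.1 ∨ p = n.2 → ∃ f ∈ C, p = f.1 ∨ p = f.2 := by
    rintro n hn p (rfl | rfl)
    · obtain ⟨f, hf, h1⟩ := blue' n hn
      exact ⟨f, hf, Or.inl h1⟩
    · obtain ⟨f, hf, h1⟩ := red' n hn
      exact ⟨f, hf, Or.inr h1⟩
  have end_mem : ∀ (f : Pt × Pt) (p : Pt), p = f.1 ∨ p = f.2 → p ∈ segment ℝ f.1 f.2 := by
    rintro f p (rfl | rfl)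
    · exact left_mem_segment _ _ _
    · exact right_mem_segment _ _ _
  have edge_arc : ∀ g ∈ M, g ∉ C → ∀ n ∈ N', ∀ z ∈ segment ℝ g.1 g.2, z ∉ segment ℝ n.1 n.2 := by
    intro g hg hgC n hn z hz hz'
    by_cases ho : z ∈ openSegment ℝ n.1 n.2
    · exact ae n (hND hn) g hg z ho hz
    · obtain ⟨f, hf, h1⟩ := vert n hn z (endpoint_of_not_open hz' ho)
      exact hC.plane f (hCM f hf) g hg (fun h' => hgC (h' ▸ hf)) z (end_mem f z h1) hz
  have arc_arc : ∀ n ∈ N', ∀ n' ∈ N', n ≠ n' → ∀ z ∈ segment ℝ n.1 n.2,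
      z ∉ segment ℝ n'.1 n'.2 := by
    intro n hn n' hn' hne z hz hz'
    by_cases ho : z ∈ openSegment ℝ n.1 n.2
    · exact aa n (hND hn) n' (hND hn') hne z ho hz'
    by_cases ho' : z ∈ openSegment ℝ n'.1 n'.2
    · exact aa n' (hND hn') n (hND hn) hne.symm z ho' hz
    obtain ⟨f, hf, h1⟩ := blue' n hn
    obtain ⟨f', hf', h1'⟩ := blue' n' hn'
    obtain ⟨g, hg, h2⟩ := red' n hn
    obtain ⟨g', hg', h2'⟩ := red' n' hn'
    rcases endpoint_of_not_open hz ho with h3 | h3 <;>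
      rcases endpoint_of_not_open hz' ho' with h4 | h4
    · exact hne (binj n hn n' hn' (h3.symm.trans h4))
    · exact hC.colour f (hCM f hf) g' (hCM g' hg') (by rw [← h1, ← h2', ← h3, h4])
    · exact hC.colour f' (hCM f' hf') g (hCM g hg) (by rw [← h1', ← h2, ← h3, h4])
    · exact hne (rinj n hn n' hn' (h3.symm.trans h4))
  refine ⟨M \ C ∪ N', ⟨?_, ?_, ?_, ?_⟩, ?_, ?_⟩
  · intro g hg
    rcases mem_union.1 hg with hg | hg
    · exact hM.1 g (mem_sdiff.1 hg).1
    · obtain ⟨f, hf, h1⟩ := blue' g hg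
      obtain ⟨f', hf', h2⟩ := red' g hg
      rw [h1, h2]
      exact ⟨(hM.1 f (hCM f hf)).1, (hM.1 f' (hCM f' hf')).2⟩
  · intro b hb
    obtain ⟨f, ⟨hf, rfl⟩, -⟩ := hM.2.1 b hb
    by_cases hfC : f ∈ C
    · obtain ⟨n, hn, h1⟩ := blue f hfC
      refine ⟨n, ⟨mem_union_right _ hn, h1⟩, fun g ⟨hg, h2⟩ => ?_⟩
      rcases mem_union.1 hg with hg | hg
      · obtain ⟨hg, hgC⟩ := mem_sdiff.1 hg
        exact absurd (hC.blue_inj g hg f hf h2 ▸ hfC) hgC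
      · exact binj g hg n hn (h2.trans h1.symm)
    · refine ⟨f, ⟨mem_union_left _ (mem_sdiff.2 ⟨hf, hfC⟩), rfl⟩, fun g ⟨hg, h2⟩ => ?_⟩
      rcases mem_union.1 hg with hg | hg
      · exact hC.blue_inj g (mem_sdiff.1 hg).1 f hf h2
      · obtain ⟨f', hf', h1⟩ := blue' g hg
        exact absurd (hC.blue_inj f' (hCM f' hf') f hf (h1.symm.trans h2) ▸ hf') hfC
  · intro b hb
    obtain ⟨f, ⟨hf, rfl⟩, -⟩ := hM.2.2.1 b hb
    by_cases hfC : f ∈ C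
    · obtain ⟨n, hn, h1⟩ := red f hfC
      refine ⟨n, ⟨mem_union_right _ hn, h1⟩, fun g ⟨hg, h2⟩ => ?_⟩
      rcases mem_union.1 hg with hg | hg
      · obtain ⟨hg, hgC⟩ := mem_sdiff.1 hg
        exact absurd (hC.red_inj g hg f hf h2 ▸ hfC) hgC
      · exact rinj g hg n hn (h2.trans h1.symm)
    · refine ⟨f, ⟨mem_union_left _ (mem_sdiff.2 ⟨hf, hfC⟩), rfl⟩, fun g ⟨hg, h2⟩ => ?_⟩
      rcases mem_union.1 hg with hg | hg
      · exact hC.red_inj g (mem_sdiff.1 hg).1 f hf h2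
      · obtain ⟨f', hf', h1⟩ := red' g hg
        exact absurd (hC.red_inj f' (hCM f' hf') f hf (h1.symm.trans h2) ▸ hf') hfC
  · intro g hg g' hg' hne
    rw [← Set.disjoint_iff_inter_eq_empty, Set.disjoint_left]
    intro z hz hz'
    rcases mem_union.1 hg with hg | hg <;> rcases mem_union.1 hg' with hg' | hg'
    · exact hC.plane g (mem_sdiff.1 hg).1 g' (mem_sdiff.1 hg').1 hne z hz hz'
    · exact edge_arc g (mem_sdiff.1 hg).1 (mem_sdiff.1 hg).2 g' hg' z hz hz'
    · exact edge_arc g' (mem_sdiff.1 hg').1 (mem_sdiff.1 hg').2 g hg z hz' hz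
    · exact arc_arc g hg g' hg' hne z hz hz'
  · intro g hg g' hg'
    rcases mem_union.1 hg' with hg' | hg'
    · by_cases hne : g = g'
      · exact Or.inl hne
      · exact Or.inr fun z hz => absurd hz.2 (hC.plane g hg g' (mem_sdiff.1 hg').1 hne z hz.1)
    · refine Or.inr fun z hz => ?_
      have h1 : z = g'.1 ∨ z = g'.2 := endpoint_of_not_open hz.2 fun ho =>
        ae g' (hND hg') g hg z ho hz.1
      refine ⟨?_, h1⟩
      obtain ⟨f, hf, h2⟩ := vert g' hg' z h1
      exact hC.vert_on_edge ⟨f, hCM f hf, h2⟩ hg hz.1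
  · intro g hg
    rcases mem_union.1 hg with hg | hg
    · obtain ⟨hg, hgC⟩ := mem_sdiff.1 hg
      exact fun h' => hgC (hC.uniq g hg h'.1 h'.2 ▸ h.uC)
    · rcases mem_insert.1 hg with rfl | hg
      · exact hj.2.2.2.1
      · exact hC.arc_side g (h.ND hg)

/-- Growing arcs from `u` until they reach `u` again. -/
lemma exists_exchange {B R : Finset Pt} (hM : IsBRMatching B R M) {ou : Pt}
    (hou : ou ∈ openSegment ℝ u.2 u.1) (houc : ou.1 = c) {g : Pt × Pt} (hg : g ∈ M) {z : Pt}
    (hz : z ∈ segment ℝ g.1 g.2) (hzc : z.1 = c) (hzo : z.2 < ou.2) (k : ℕ) :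
    ∀ A D : Finset (Pt × Pt), (M \ A).card = k → Conf c M A D u →
      (∀ e ∈ A, ∃ C N, Track A D C N u e) →
      ∃ M', IsBRMatching B R M' ∧ Compatible M M' ∧ ∀ e ∈ M', ¬ (e.2.1 < c ∧ c < e.1.1) := by
  induction k with
  | zero =>
    intro A D hk hC ht
    obtain ⟨e, f, hj⟩ := exists_joins hC hou houc hg hz hzc hzo
    have hfA : f ∈ A := sdiff_eq_empty_iff_subset.1 (card_eq_zero.1 hk) hj.2.1
    have := hj.2.2.1.resolve_left fun h => h hfA
    subst this
    obtain ⟨C, N, h⟩ := ht e hj.1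
    exact exchange hM hC hj h
  | succ k ih =>
    intro A D hk hC ht
    obtain ⟨e, f, hj⟩ := exists_joins hC hou houc hg hz hzc hzo
    obtain ⟨C, N, h⟩ := ht e hj.1
    rcases hj.2.2.1 with hfA | rfl
    · refine ih (insert f A) (insert (f.1, e.2) D) ?_ (hC.extend hj hfA) fun e' he' => ?_
      · rw [sdiff_insert, card_erase_of_mem (mem_sdiff.2 ⟨hj.2.1, hfA⟩), hk]; rfl
      · rcases mem_insert.1 he' with rfl | he'
        · exact ⟨_, _, h.extend hC hj.2.1 hfA⟩
        · obtain ⟨C', N', h'⟩ := ht e' he'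
          exact ⟨C', N', h'.mono (subset_insert _ _) (subset_insert _ _)⟩
    · exact exchange hM hC hj h

end Growth

/-- A bichromatic point set in general position. -/
structure Bichromatic (B R : Finset Pt) : Prop where
  disj : ∀ p ∈ B, p ∉ R
  gen : ∀ p ∈ B ∪ R, ∀ q ∈ B ∪ R, ∀ r ∈ B ∪ R, p ≠ q → p ≠ r → q ≠ r → cr (q - p) (r - p) ≠ 0

/-- The vertical line `x = c` avoids the points of `P` and the crossings of the lines they span. -/
structure GenericLine (P : Finset Pt) (c : ℝ) : Prop where
  off : ∀ p ∈ P, p.1 ≠ c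
  lines : ∀ p ∈ P, ∀ q ∈ P, ∀ p' ∈ P, ∀ q' ∈ P, p ≠ q → p' ≠ q' → ∀ z : Pt,
    z.1 = c → cr (z - p) (q - p) = 0 → cr (z - p') (q' - p') = 0 →
    p' = p ∧ q' = q ∨ p' = q ∧ q' = p

lemma Bichromatic.mono {B R B' R' : Finset Pt} (h : Bichromatic B R) (hB : B' ⊆ B) (hR : R' ⊆ R) :
    Bichromatic B' R' :=
  ⟨fun p hp hp' => h.disj p (hB hp) (hR hp'), fun p hp q hq r hr =>
    h.gen p (union_subset_union hB hR hp) q (union_subset_union hB hR hq) r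
      (union_subset_union hB hR hr)⟩

lemma Bichromatic.swap {B R : Finset Pt} (h : Bichromatic B R) : Bichromatic R B :=
  ⟨fun p hp hp' => h.disj p hp' hp, by rw [union_comm]; exact h.gen⟩

lemma GenPos.cr_ne {S : Finset Pt} (h : GenPos S) : ∀ p ∈ S, ∀ q ∈ S, ∀ r ∈ S,
    p ≠ q → p ≠ r → q ≠ r → cr (q - p) (r - p) ≠ 0 := by
  intro p hp q hq r hr hpq hpr hqr h0
  refine h p hp q hq r hr hpq hpr hqr ?_
  obtain ⟨t, ht⟩ := exists_smul_of_cr_eq_zero (sub_ne_zero.2 hpq.symm) h0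
  rw [collinear_iff_of_mem (p₀ := p) (by simp)]
  refine ⟨q - p, ?_⟩
  rintro x (rfl | rfl | rfl)
  · exact ⟨0, by simp⟩
  · exact ⟨1, by simp⟩
  · exact ⟨t, by rw [← ht]; simp⟩

/-- All but finitely many vertical lines are generic. -/
lemma Bichromatic.exists_finset {B R : Finset Pt} (h : Bichromatic B R) :
    ∃ F : Finset ℝ, ∀ c ∉ F, GenericLine (B ∪ R) c := by
  set P := B ∪ R
  have key : ∀ p q p' q' : Pt, ∃ F : Finset ℝ, ∀ c ∉ F, p ∈ P → q ∈ P → p' ∈ P → q' ∈ P →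
      p ≠ q → p' ≠ q' → ∀ z : Pt, z.1 = c → cr (z - p) (q - p) = 0 → cr (z - p') (q' - p') = 0 →
      p' = p ∧ q' = q ∨ p' = q ∧ q' = p := by
    intro p q p' q'
    by_cases hs : p ∈ P ∧ q ∈ P ∧ p' ∈ P ∧ q' ∈ P ∧ p ≠ q ∧ p' ≠ q' ∧
        ¬ (p' = p ∧ q' = q ∨ p' = q ∧ q' = p)
    · obtain ⟨hp, hq, hp', hq', hpq, hpq', hne⟩ := hs
      have hcr : cr (q - p) (q' - p') ≠ 0 ∨ ∀ z, cr (z - p) (q - p) = 0 →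
          cr (z - p') (q' - p') ≠ 0 := by
        by_contra! hcon
        obtain ⟨h0, z, h1, h2⟩ := hcon
        have hd : q - p ≠ 0 := sub_ne_zero.2 hpq.symm
        obtain ⟨t, ht⟩ := exists_smul_of_cr_eq_zero hd h0
        have ht0 : t ≠ 0 := by
          rintro rfl; simp [sub_eq_zero] at ht; exact hpq' ht.symm
        have e1 : cr (q - p) (p' - p) = 0 := by
          have h3 : cr (z - p') (q - p) = 0 := by
            rw [ht, cr_smul_right] at h2
            exact (mul_eq_zero.1 h2).resolve_left ht0
          have : cr (q - p) (p' - p) = cr (z - p') (q - p) - cr (z - p) (q - p) := by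
            simp only [cr, Prod.fst_sub, Prod.snd_sub]; ring
          rw [this, h3, h1, sub_zero]
        have e2 : cr (q - p) (q' - p) = 0 := by
          have : q' - p = (q' - p') + (p' - p) := by abel
          rw [this, cr_add_right, h0, e1, add_zero]
        have h3 : p' = p ∨ p' = q := by
          by_contra! h4
          exact h.gen p hp q hq p' hp' hpq h4.1.symm h4.2.symm e1
        have h5 : q' = p ∨ q' = q := by
          by_contra! h4
          exact h.gen p hp q hq q' hq' hpq h4.1.symm h4.2.symm e2
        rcases h3 with h3 | h3 <;> rcases h5 with h5 | h5
        · exact hpq' (h3.trans h5.symm)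
        · exact hne (Or.inl ⟨h3, h5⟩)
        · exact hne (Or.inr ⟨h3, h5⟩)
        · exact hpq' (h3.trans h5.symm)
      rcases hcr with hcr | hcr
      · set d := q - p
        set d' := q' - p'
        refine ⟨{(p + (cr (p' - p) d' / cr d d') • d).1}, fun c hc _ _ _ _ _ _ z hz h1 h2 => ?_⟩
        exfalso
        apply hc
        rw [mem_singleton, ← hz]
        obtain ⟨s, hs⟩ := exists_smul_of_cr_eq_zero (ne_zero_of_cr_left hcr)
          (show cr d (z - p) = 0 by rw [cr_comm, h1, neg_zero])
        have hz' : z = p + s • d := by rw [← hs]; abel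
        have : cr (p' - p) d' = s * cr d d' := by
          have : p' - p = (z - p) - (z - p') := by abel
          rw [this, cr_sub_left (z - p) (z - p'), h2, hs, cr_smul_left, sub_zero]
        rw [this, mul_div_cancel_right₀ _ hcr, ← hz']
      · exact ⟨∅, fun c hc _ _ _ _ _ _ z hz h1 h2 => absurd h2 (hcr z h1)⟩
    · refine ⟨∅, fun c hc hp hq hp' hq' h1 h2 z _ _ _ => ?_⟩
      by_contra h3
      exact hs ⟨hp, hq, hp', hq', h1, h2, h3⟩
  choose F hF using key
  refine ⟨P.image Prod.fst ∪ P.biUnion fun p => P.biUnion fun q => P.biUnion fun p' =>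
    P.biUnion fun q' => F p q p' q', fun c hc => ?_⟩
  rw [mem_union, not_or] at hc
  refine ⟨fun p hp h => hc.1 (mem_image.2 ⟨p, hp, h⟩), ?_⟩
  intro p hp q hq p' hp' q' hq' h1 h2 z hz h3 h4
  refine hF p q p' q' c (fun hcF => hc.2 ?_) hp hq hp' hq' h1 h2 z hz h3 h4
  simp only [mem_biUnion]
  exact ⟨p, hp, q, hq, p', hp', q', hq', hcF⟩

/-- A generic vertical line can be found in every open interval. -/
lemma Bichromatic.exists_generic {B R : Finset Pt} (h : Bichromatic B R) {a b : ℝ} (hab : a < b) :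
    ∃ c, a < c ∧ c < b ∧ GenericLine (B ∪ R) c := by
  obtain ⟨F, hF⟩ := h.exists_finset
  obtain ⟨c, hc, hcF⟩ := (Set.Ioo_infinite hab).exists_notMem_finset F
  exact ⟨c, hc.1, hc.2, hF c hcF⟩

section Transport

variable (L : Pt ≃ₗ[ℝ] Pt)

/-- The image of a matching under a linear map. -/
noncomputable def moved (M : Finset (Pt × Pt)) : Finset (Pt × Pt) := M.image (Prod.map L L)

variable {L}

lemma mem_moved {M : Finset (Pt × Pt)} {e : Pt × Pt} :
    e ∈ moved L M ↔ (L.symm e.1, L.symm e.2) ∈ M := by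
  simp only [moved, mem_image]
  constructor
  · rintro ⟨f, hf, rfl⟩; simpa using hf
  · exact fun h => ⟨_, h, by simp⟩

lemma forall_mem_moved {M : Finset (Pt × Pt)} {p : Pt × Pt → Prop} :
    (∀ e ∈ moved L M, p e) ↔ ∀ e ∈ M, p (L e.1, L e.2) := by
  simp only [moved, forall_mem_image]
  rfl

@[simp] lemma moved_symm_moved (M : Finset (Pt × Pt)) : moved L.symm (moved L M) = M := by
  ext e; simp [mem_moved]

lemma mem_image_linear {S : Finset Pt} {p : Pt} : p ∈ S.image L ↔ L.symm p ∈ S := by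
  rw [mem_image]
  constructor
  · rintro ⟨f, hf, rfl⟩; simpa using hf
  · exact fun h => ⟨_, h, by simp⟩

lemma image_symm_image (S : Finset Pt) : (S.image L).image L.symm = S := by
  ext e; rw [mem_image_linear, mem_image_linear]; simp

lemma mem_segment_linear {a b z : Pt} :
    z ∈ segment ℝ (L a) (L b) ↔ L.symm z ∈ segment ℝ a b := by
  constructor
  · rintro ⟨s, t, hs, ht, hst, rfl⟩
    exact ⟨s, t, hs, ht, hst, by simp⟩
  · rintro ⟨s, t, hs, ht, hst, h⟩
    refine ⟨s, t, hs, ht, hst, ?_⟩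
    rw [← L.apply_symm_apply z, ← h]; simp

lemma cr_linear (L : Pt ≃ₗ[ℝ] Pt) : ∃ κ : ℝ, κ ≠ 0 ∧ ∀ a b, cr (L a) (L b) = κ * cr a b := by
  have h : ∀ (T : Pt ≃ₗ[ℝ] Pt) a b, cr (T a) (T b) = cr (T (1, 0)) (T (0, 1)) * cr a b := by
    intro T a b
    have e : ∀ v : Pt, T v = v.1 • T (1, 0) + v.2 • T (0, 1) := by
      intro v
      rw [← map_smul, ← map_smul, ← map_add]
      congr 1
      ext <;> simp
    rw [e a, e b]
    simp only [cr, Prod.fst_add, Prod.snd_add, Prod.smul_fst, Prod.smul_snd, smul_eq_mul]; ring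
  refine ⟨_, fun h0 => ?_, h L⟩
  have := h L (L.symm (1, 0)) (L.symm (0, 1))
  rw [h0] at this
  simp [cr] at this

lemma cr_linear_eq_zero {a b : Pt} : cr (L a) (L b) = 0 ↔ cr a b = 0 := by
  obtain ⟨κ, h0, h⟩ := cr_linear L
  rw [h, mul_eq_zero, or_iff_right h0]

lemma _root_.IsBRMatching.moved {B R : Finset Pt} {M : Finset (Pt × Pt)} (h : IsBRMatching B R M) :
    IsBRMatching (B.image L) (R.image L) (moved L M) := by
  obtain ⟨h1, h2, h3, h4⟩ := h
  refine ⟨?_, ?_, ?_, ?_⟩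
  · rw [forall_mem_moved]
    exact fun e he => ⟨mem_image_of_mem _ (h1 e he).1, mem_image_of_mem _ (h1 e he).2⟩
  · rw [forall_mem_image]
    intro b hb
    obtain ⟨e, ⟨he, heb⟩, hu⟩ := h2 b hb
    refine ⟨(L e.1, L e.2), ⟨mem_moved.2 (by simpa using he), by rw [heb]⟩, ?_⟩
    rintro f ⟨hf, hfb⟩
    have := hu _ ⟨mem_moved.1 hf, by simp [hfb]⟩
    rw [← this]; simp
  · rw [forall_mem_image]
    intro b hb
    obtain ⟨e, ⟨he, heb⟩, hu⟩ := h3 b hb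
    refine ⟨(L e.1, L e.2), ⟨mem_moved.2 (by simpa using he), by rw [heb]⟩, ?_⟩
    rintro f ⟨hf, hfb⟩
    have := hu _ ⟨mem_moved.1 hf, by simp [hfb]⟩
    rw [← this]; simp
  · rw [forall_mem_moved]
    intro e he
    rw [forall_mem_moved]
    intro f hf hne
    rw [Set.eq_empty_iff_forall_notMem]
    rintro z ⟨hz, hz'⟩
    rw [mem_segment_linear] at hz hz'
    have := h4 e he f hf fun h => hne (by rw [h])
    exact Set.eq_empty_iff_forall_notMem.1 this _ ⟨hz, hz'⟩

lemma _root_.Compatible.moved {M N : Finset (Pt × Pt)} (h : Compatible M N) :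
    Compatible (moved L M) (moved L N) := by
  unfold Compatible
  rw [forall_mem_moved]
  intro e he
  rw [forall_mem_moved]
  intro f hf
  rcases h e he f hf with rfl | h
  · exact Or.inl rfl
  · refine Or.inr ?_
    rintro z ⟨hz, hz'⟩
    rw [mem_segment_linear] at hz hz'
    have := h ⟨hz, hz'⟩
    simpa only [Set.mem_ofPred_eq, LinearEquiv.symm_apply_eq] using this

lemma Bichromatic.image {B R : Finset Pt} (h : Bichromatic B R) :
    Bichromatic (B.image L) (R.image L) := by
  refine ⟨?_, ?_⟩
  · rw [forall_mem_image]
    intro p hp hp'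
    rw [mem_image_linear, LinearEquiv.symm_apply_apply] at hp'
    exact h.disj p hp hp'
  · rw [← image_union]
    simp only [forall_mem_image]
    intro p hp q hq r hr h1 h2 h3 h0
    rw [← map_sub, ← map_sub, cr_linear_eq_zero] at h0
    exact h.gen p hp q hq r hr (fun h => h1 (by rw [h])) (fun h => h2 (by rw [h]))
      (fun h => h3 (by rw [h])) h0

lemma GenericLine.image {P : Finset Pt} {c c' : ℝ} (h : GenericLine P c)
    (hL : ∀ z, (L z).1 = c' ↔ z.1 = c) : GenericLine (P.image L) c' := by
  refine ⟨?_, ?_⟩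
  · rw [forall_mem_image]
    exact fun p hp h0 => h.off p hp ((hL p).1 h0)
  · simp only [forall_mem_image]
    intro p hp q hq p' hp' q' hq' h1 h2 z hz h3 h4
    obtain ⟨w, rfl⟩ := L.surjective z
    rw [← map_sub, ← map_sub, cr_linear_eq_zero] at h3 h4
    have := h.lines p hp q hq p' hp' q' hq' (fun h => h1 (by rw [h])) (fun h => h2 (by rw [h])) w
      ((hL w).1 hz) h3 h4
    simpa only [L.injective.eq_iff] using this

end Transport

section

/-- The reflection `(x, y) ↦ (x, -y)`. -/
def flipY : Pt ≃ₗ[ℝ] Pt := LinearEquiv.prodCongr (LinearEquiv.refl ℝ ℝ) (LinearEquiv.neg ℝ)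

/-- The reflection `(x, y) ↦ (-x, y)`. -/
def flipX : Pt ≃ₗ[ℝ] Pt := LinearEquiv.prodCongr (LinearEquiv.neg ℝ) (LinearEquiv.refl ℝ ℝ)

@[simp] lemma flipY_fst (z : Pt) : (flipY z).1 = z.1 := rfl
@[simp] lemma flipY_snd (z : Pt) : (flipY z).2 = -z.2 := rfl
@[simp] lemma flipX_fst (z : Pt) : (flipX z).1 = -z.1 := rfl
@[simp] lemma flipX_snd (z : Pt) : (flipX z).2 = z.2 := rfl
@[simp] lemma flipX_symm_fst (z : Pt) : (flipX.symm z).1 = -z.1 := rfl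

variable {B R : Finset Pt} {M : Finset (Pt × Pt)} {c : ℝ}

lemma plane_of_isBRMatching (hM : IsBRMatching B R M) {e f : Pt × Pt} (he : e ∈ M) (hf : f ∈ M)
    (hne : e ≠ f) : ∀ z ∈ segment ℝ e.1 e.2, z ∉ segment ℝ f.1 f.2 := fun z hz hz' =>
  Set.eq_empty_iff_forall_notMem.1 (hM.2.2.2 e he f hf hne) z ⟨hz, hz'⟩

lemma mem_union_of_vert (hM : IsBRMatching B R M) {p : Pt} (hp : Vert M p) : p ∈ B ∪ R := by
  obtain ⟨e, he, rfl | rfl⟩ := hp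
  · exact mem_union_left _ (hM.1 e he).1
  · exact mem_union_right _ (hM.1 e he).2

lemma conf_of_isBRMatching (hM : IsBRMatching B R M) (hP : Bichromatic B R)
    (hc : GenericLine (B ∪ R) c) {u : Pt × Pt} (hu : u ∈ M) (hl : u.2.1 < c) (hr : c < u.1.1)
    (huniq : ∀ e ∈ M, e.2.1 < c → c < e.1.1 → e = u) : Conf c M {u} ∅ u where
  gen p q r hp hq hr := hP.gen p (mem_union_of_vert hM hp) q (mem_union_of_vert hM hq) r
    (mem_union_of_vert hM hr)
  blue_inj e he f hf h := (hM.2.1 e.1 (hM.1 e he).1).unique ⟨he, rfl⟩ ⟨hf, h.symm⟩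
  red_inj e he f hf h := (hM.2.2.1 e.2 (hM.1 e he).2).unique ⟨he, rfl⟩ ⟨hf, h.symm⟩
  colour e he f hf h := hP.disj e.1 (hM.1 e he).1 (h ▸ (hM.1 f hf).2)
  plane e he f hf := plane_of_isBRMatching hM he hf
  off p hp := hc.off p (mem_union_of_vert hM hp)
  lines p q p' q' hp hq hp' hq' := hc.lines p (mem_union_of_vert hM hp) q (mem_union_of_vert hM hq)
    p' (mem_union_of_vert hM hp') q' (mem_union_of_vert hM hq')
  uM := hu
  u_left := hl
  u_right := hr
  uniq := huniq
  AM := singleton_subset_iff.2 hu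
  uA := mem_singleton_self u
  arc := by simp
  arc_side := by simp
  arc_edge := by simp
  arc_arc := by simp

lemma exists_openSegment_fst_eq {p q : Pt} (hp : p.1 < c) (hq : c < q.1) :
    ∃ z ∈ openSegment ℝ p q, z.1 = c := by
  have h : 0 < q.1 - p.1 := by linarith
  refine ⟨((q.1 - c) / (q.1 - p.1)) • p + ((c - p.1) / (q.1 - p.1)) • q,
    ⟨_, _, div_pos (by linarith) h, div_pos (by linarith) h, by field_simp; ring, rfl⟩, ?_⟩
  simp only [Prod.fst_add, Prod.smul_fst, smul_eq_mul]
  field_simp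
  ring

lemma track_singleton (u : Pt × Pt) : Track {u} ∅ {u} ∅ u u where
  CA := subset_refl _
  ND := subset_refl _
  uC := mem_singleton_self u
  eC := mem_singleton_self u
  blue f hf h := absurd (mem_singleton.1 hf) h
  red f hf h := absurd (mem_singleton.1 hf) h
  blue' := by simp
  red' := by simp
  blue_inj := by simp
  red_inj := by simp

lemma exists_clear_of_below (hM : IsBRMatching B R M) (hP : Bichromatic B R)
    (hc : GenericLine (B ∪ R) c) {u : Pt × Pt} (hu : u ∈ M) (hl : u.2.1 < c) (hr : c < u.1.1)
    (huniq : ∀ e ∈ M, e.2.1 < c → c < e.1.1 → e = u) {o : Pt} (ho : o ∈ openSegment ℝ u.2 u.1)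
    (hoc : o.1 = c) {g : Pt × Pt} (hg : g ∈ M) {z : Pt} (hz : z ∈ segment ℝ g.1 g.2)
    (hzc : z.1 = c) (hzo : z.2 < o.2) :
    ∃ M', IsBRMatching B R M' ∧ Compatible M M' ∧ ∀ e ∈ M', ¬ (e.2.1 < c ∧ c < e.1.1) := by
  refine exists_exchange hM ho hoc hg hz hzc hzo _ {u} ∅ rfl
    (conf_of_isBRMatching hM hP hc hu hl hr huniq) fun e he => ?_
  rw [mem_singleton.1 he]
  exact ⟨_, _, track_singleton u⟩

/-- If a single edge crosses `x = c` with its red end on the left and some other edge crosses too,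
then a compatible matching has no edge of the former kind. -/
lemma exists_clear (hM : IsBRMatching B R M) (hP : Bichromatic B R)
    (hc : GenericLine (B ∪ R) c) {u : Pt × Pt} (hu : u ∈ M) (hl : u.2.1 < c) (hr : c < u.1.1)
    (huniq : ∀ e ∈ M, e.2.1 < c → c < e.1.1 → e = u) {g : Pt × Pt} (hg : g ∈ M) (hgl : g.1.1 < c)
    (hgr : c < g.2.1) :
    ∃ M', IsBRMatching B R M' ∧ Compatible M M' ∧ ∀ e ∈ M', ¬ (e.2.1 < c ∧ c < e.1.1) := by
  obtain ⟨o, ho, hoc⟩ := exists_openSegment_fst_eq hl hr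
  obtain ⟨z, hz, hzc⟩ := exists_openSegment_fst_eq hgl hgr
  replace hz := openSegment_subset_segment _ _ _ hz
  have hgu : g ≠ u := by rintro rfl; linarith
  rcases lt_trichotomy z.2 o.2 with h | h | h
  · exact exists_clear_of_below hM hP hc hu hl hr huniq ho hoc hg hz hzc h
  · exfalso
    have : z = o := Prod.ext (hzc.trans hoc.symm) h
    refine plane_of_isBRMatching hM hg hu hgu z hz ?_
    rw [this, segment_symm]
    exact openSegment_subset_segment _ _ _ ho
  · obtain ⟨M', h1, h2, h3⟩ := exists_clear_of_below (hM.moved (L := flipY)) hP.image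
      (u := (flipY u.1, flipY u.2)) (o := flipY o) (g := (flipY g.1, flipY g.2)) (z := flipY z)
      (c := c)
      (by rw [← image_union]; exact hc.image fun z => Iff.rfl) (by simpa [mem_moved] using hu)
      hl hr (by
        rw [forall_mem_moved]
        intro e he h1 h2
        rw [huniq e he h1 h2])
      (by
        obtain ⟨s, t, hs, ht, hst, h⟩ := ho
        exact ⟨s, t, hs, ht, hst, by rw [← h]; simp⟩) hoc (by simpa [mem_moved] using hg)
      (by rw [mem_segment_linear]; simpa using hz) hzc (by simpa using h)
    refine ⟨moved flipY.symm M', ?_, ?_, ?_⟩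
    · simpa only [image_symm_image] using h1.moved (L := flipY.symm)
    · simpa only [moved_symm_moved] using h2.moved (L := flipY.symm)
    · rw [forall_mem_moved]
      exact fun e he => h3 e he

/-- The mirror image of `exists_clear`. -/
lemma exists_clear' (hM : IsBRMatching B R M) (hP : Bichromatic B R)
    (hc : GenericLine (B ∪ R) c) {u : Pt × Pt} (hu : u ∈ M) (hl : u.1.1 < c) (hr : c < u.2.1)
    (huniq : ∀ e ∈ M, e.1.1 < c → c < e.2.1 → e = u) {g : Pt × Pt} (hg : g ∈ M) (hgl : g.2.1 < c)
    (hgr : c < g.1.1) :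
    ∃ M', IsBRMatching B R M' ∧ Compatible M M' ∧ ∀ e ∈ M', ¬ (e.1.1 < c ∧ c < e.2.1) := by
  obtain ⟨M', h1, h2, h3⟩ := exists_clear (hM.moved (L := flipX)) hP.image
      (u := (flipX u.1, flipX u.2)) (g := (flipX g.1, flipX g.2)) (c := -c)
      (by rw [← image_union]; exact hc.image fun z => by simp) (by simpa [mem_moved] using hu)
      (by simpa using hr) (by simpa using hl) (by
        rw [forall_mem_moved]
        intro e he h1 h2
        rw [huniq e he (by simpa using h2) (by simpa using h1)])
      (by simpa [mem_moved] using hg) (by simpa using hgr) (by simpa using hgl)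
  refine ⟨moved flipX.symm M', ?_, ?_, ?_⟩
  · simpa only [image_symm_image] using h1.moved (L := flipX.symm)
  · simpa only [moved_symm_moved] using h2.moved (L := flipX.symm)
  · rw [forall_mem_moved]
    intro e he h
    refine h3 e he ⟨?_, ?_⟩
    · have := h.2; simp at this; linarith
    · have := h.1; simp at this; linarith

end

section

variable {B R : Finset Pt} {M N : Finset (Pt × Pt)} {c : ℝ}

/-- `N` is reached from `M` by exactly `t` steps. -/
def Reach (B R : Finset Pt) : ℕ → Finset (Pt × Pt) → Finset (Pt × Pt) → Prop
  | 0, M, N => M = N ∧ IsBRMatching B R M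
  | t + 1, M, N => ∃ K, Reach B R t M K ∧ IsBRMatching B R N ∧ Compatible K N

lemma compatible_self (hM : IsBRMatching B R M) : Compatible M M := by
  intro e he f hf
  by_cases h : e = f
  · exact Or.inl h
  · right
    rw [hM.2.2.2 e he f hf h]
    exact Set.empty_subset _

lemma compatible_symm (h : Compatible M N) : Compatible N M := by
  intro e he f hf
  rcases h f hf e he with rfl | h
  · exact Or.inl rfl
  · right
    rintro z ⟨hz, hz'⟩
    exact (h ⟨hz', hz⟩).symm

namespace Reach

lemma right {t : ℕ} (h : Reach B R t M N) : IsBRMatching B R N := by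
  cases t with
  | zero => exact h.1 ▸ h.2
  | succ t => obtain ⟨K, -, h, -⟩ := h; exact h

lemma mono {s t : ℕ} (h : Reach B R s M N) (hst : s ≤ t) : Reach B R t M N := by
  induction t, hst using Nat.le_induction with
  | base => exact h
  | succ t _ ih => exact ⟨N, ih, h.right, compatible_self h.right⟩

lemma trans {s t : ℕ} {K : Finset (Pt × Pt)} (h : Reach B R s M N) (h' : Reach B R t N K) :
    Reach B R (s + t) M K := by
  induction t generalizing K with
  | zero => exact h'.1 ▸ h
  | succ t ih => obtain ⟨K', h1, h2, h3⟩ := h'; exact ⟨K', ih h1, h2, h3⟩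

lemma symm {t : ℕ} (h : Reach B R t M N) : Reach B R t N M := by
  induction t generalizing N with
  | zero => exact ⟨h.1.symm, h.1 ▸ h.2⟩
  | succ t ih =>
    obtain ⟨K, h1, h2, h3⟩ := h
    have : Reach B R 1 N K := ⟨N, ⟨rfl, h2⟩, h1.right, compatible_symm h3⟩
    rw [add_comm]
    exact this.trans (ih h1)

lemma tCompatible {t : ℕ} (h : Reach B R t M N) : TCompatible B R t M N := by
  have : ∃ f : ℕ → Finset (Pt × Pt), f 0 = M ∧ f t = N ∧ (∀ i ≤ t, IsBRMatching B R (f i)) ∧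
      ∀ i < t, Compatible (f i) (f (i + 1)) := by
    induction t generalizing N with
    | zero => exact ⟨fun _ => M, rfl, h.1, fun _ _ => h.2, fun i hi => absurd hi (Nat.not_lt_zero i)⟩
    | succ t ih =>
      obtain ⟨K, h1, h2, h3⟩ := h
      obtain ⟨f, f0, ft, hf, hf'⟩ := ih h1
      refine ⟨fun i => if i ≤ t then f i else N, by simp [f0], by simp, fun i hi => ?_,
        fun i hi => ?_⟩
      · dsimp only
        split_ifs with h
        · exact hf i h
        · exact h2
      · dsimp only
        rw [if_pos (Nat.lt_succ_iff.1 hi)]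
        split_ifs with h
        · exact hf' i h
        · rw [show i = t by omega, ft]; exact h3
  obtain ⟨f, hf⟩ := this
  exact ⟨t, le_rfl, f, hf⟩

lemma moved {L : Pt ≃ₗ[ℝ] Pt} {t : ℕ} (h : Reach B R t M N) :
    Reach (B.image L) (R.image L) t (moved L M) (moved L N) := by
  induction t generalizing N with
  | zero => exact ⟨by rw [h.1], h.2.moved⟩
  | succ t ih => obtain ⟨K, h1, h2, h3⟩ := h; exact ⟨_, ih h1, h2.moved, h3.moved⟩

end Reach

section Parallel

variable {B₁ B₂ R₁ R₂ : Finset Pt} {M₁ M₂ N₁ N₂ : Finset (Pt × Pt)}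

lemma fst_lt_of_mem_segment {p q z : Pt} (hp : p.1 < c) (hq : q.1 < c) (hz : z ∈ segment ℝ p q) :
    z.1 < c :=
  (convex_halfSpace_lt (f := Prod.fst) ⟨fun _ _ => rfl, fun _ _ => rfl⟩ c).segment_subset hp hq hz

lemma lt_fst_of_mem_segment {p q z : Pt} (hp : c < p.1) (hq : c < q.1) (hz : z ∈ segment ℝ p q) :
    c < z.1 :=
  (convex_halfSpace_gt (f := Prod.fst) ⟨fun _ _ => rfl, fun _ _ => rfl⟩ c).segment_subset hp hq hz

lemma isBRMatching_union (h₁ : ∀ p ∈ B₁ ∪ R₁, p.1 < c) (h₂ : ∀ p ∈ B₂ ∪ R₂, c < p.1)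
    (hM₁ : IsBRMatching B₁ R₁ M₁) (hM₂ : IsBRMatching B₂ R₂ M₂) :
    IsBRMatching (B₁ ∪ B₂) (R₁ ∪ R₂) (M₁ ∪ M₂) := by
  have a₁ : ∀ e ∈ M₁, e.1.1 < c ∧ e.2.1 < c := fun e he =>
    ⟨h₁ _ (mem_union_left _ (hM₁.1 e he).1), h₁ _ (mem_union_right _ (hM₁.1 e he).2)⟩
  have a₂ : ∀ e ∈ M₂, c < e.1.1 ∧ c < e.2.1 := fun e he =>
    ⟨h₂ _ (mem_union_left _ (hM₂.1 e he).1), h₂ _ (mem_union_right _ (hM₂.1 e he).2)⟩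
  refine ⟨?_, ?_, ?_, ?_⟩
  · intro e he
    rcases mem_union.1 he with he | he
    · exact ⟨mem_union_left _ (hM₁.1 e he).1, mem_union_left _ (hM₁.1 e he).2⟩
    · exact ⟨mem_union_right _ (hM₂.1 e he).1, mem_union_right _ (hM₂.1 e he).2⟩
  · intro b hb
    rcases mem_union.1 hb with hb | hb
    · obtain ⟨e, ⟨he, heb⟩, hu⟩ := hM₁.2.1 b hb
      refine ⟨e, ⟨mem_union_left _ he, heb⟩, ?_⟩
      rintro f ⟨hf, rfl⟩
      rcases mem_union.1 hf with hf | hf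
      · exact hu f ⟨hf, rfl⟩
      · exact absurd (h₁ _ (mem_union_left _ hb)) (a₂ f hf).1.not_gt
    · obtain ⟨e, ⟨he, heb⟩, hu⟩ := hM₂.2.1 b hb
      refine ⟨e, ⟨mem_union_right _ he, heb⟩, ?_⟩
      rintro f ⟨hf, rfl⟩
      rcases mem_union.1 hf with hf | hf
      · exact absurd (h₂ _ (mem_union_left _ hb)) (a₁ f hf).1.not_gt
      · exact hu f ⟨hf, rfl⟩
  · intro b hb
    rcases mem_union.1 hb with hb | hb
    · obtain ⟨e, ⟨he, heb⟩, hu⟩ := hM₁.2.2.1 b hb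
      refine ⟨e, ⟨mem_union_left _ he, heb⟩, ?_⟩
      rintro f ⟨hf, rfl⟩
      rcases mem_union.1 hf with hf | hf
      · exact hu f ⟨hf, rfl⟩
      · exact absurd (h₁ _ (mem_union_right _ hb)) (a₂ f hf).2.not_gt
    · obtain ⟨e, ⟨he, heb⟩, hu⟩ := hM₂.2.2.1 b hb
      refine ⟨e, ⟨mem_union_right _ he, heb⟩, ?_⟩
      rintro f ⟨hf, rfl⟩
      rcases mem_union.1 hf with hf | hf
      · exact absurd (h₂ _ (mem_union_right _ hb)) (a₁ f hf).2.not_gt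
      · exact hu f ⟨hf, rfl⟩
  · intro e he f hf hne
    rw [Set.eq_empty_iff_forall_notMem]
    rintro z ⟨hz, hz'⟩
    rcases mem_union.1 he with he | he <;> rcases mem_union.1 hf with hf | hf
    · exact plane_of_isBRMatching hM₁ he hf hne z hz hz'
    · exact (fst_lt_of_mem_segment (a₁ e he).1 (a₁ e he).2 hz).not_gt
        (lt_fst_of_mem_segment (a₂ f hf).1 (a₂ f hf).2 hz')
    · exact (fst_lt_of_mem_segment (a₁ f hf).1 (a₁ f hf).2 hz').not_gt
        (lt_fst_of_mem_segment (a₂ e he).1 (a₂ e he).2 hz)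
    · exact plane_of_isBRMatching hM₂ he hf hne z hz hz'

lemma compatible_union (h₁ : ∀ p ∈ B₁ ∪ R₁, p.1 < c) (h₂ : ∀ p ∈ B₂ ∪ R₂, c < p.1)
    (hM₁ : IsBRMatching B₁ R₁ M₁) (hM₂ : IsBRMatching B₂ R₂ M₂)
    (hN₁ : IsBRMatching B₁ R₁ N₁) (hN₂ : IsBRMatching B₂ R₂ N₂)
    (hc₁ : Compatible M₁ N₁) (hc₂ : Compatible M₂ N₂) : Compatible (M₁ ∪ M₂) (N₁ ∪ N₂) := by
  have a₁ : ∀ K, IsBRMatching B₁ R₁ K → ∀ e ∈ K, ∀ z ∈ segment ℝ e.1 e.2, z.1 < c :=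
    fun K hK e he z hz => fst_lt_of_mem_segment (h₁ _ (mem_union_left _ (hK.1 e he).1))
      (h₁ _ (mem_union_right _ (hK.1 e he).2)) hz
  have a₂ : ∀ K, IsBRMatching B₂ R₂ K → ∀ e ∈ K, ∀ z ∈ segment ℝ e.1 e.2, c < z.1 :=
    fun K hK e he z hz => lt_fst_of_mem_segment (h₂ _ (mem_union_left _ (hK.1 e he).1))
      (h₂ _ (mem_union_right _ (hK.1 e he).2)) hz
  intro e he f hf
  rcases mem_union.1 he with he | he <;> rcases mem_union.1 hf with hf | hf
  · exact hc₁ e he f hf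
  · exact Or.inr fun z hz => absurd (a₁ _ hM₁ e he z hz.1) (a₂ _ hN₂ f hf z hz.2).not_gt
  · exact Or.inr fun z hz => absurd (a₁ _ hN₁ f hf z hz.2) (a₂ _ hM₂ e he z hz.1).not_gt
  · exact hc₂ e he f hf

lemma Reach.union {t : ℕ} (h₁ : ∀ p ∈ B₁ ∪ R₁, p.1 < c) (h₂ : ∀ p ∈ B₂ ∪ R₂, c < p.1)
    (hr₁ : Reach B₁ R₁ t M₁ N₁) (hr₂ : Reach B₂ R₂ t M₂ N₂) :
    Reach (B₁ ∪ B₂) (R₁ ∪ R₂) t (M₁ ∪ M₂) (N₁ ∪ N₂) := by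
  induction t generalizing N₁ N₂ with
  | zero => exact ⟨by rw [hr₁.1, hr₂.1], isBRMatching_union h₁ h₂ hr₁.2 hr₂.2⟩
  | succ t ih =>
    obtain ⟨K₁, a₁, b₁, c₁⟩ := hr₁
    obtain ⟨K₂, a₂, b₂, c₂⟩ := hr₂
    exact ⟨_, ih a₁ a₂, isBRMatching_union h₁ h₂ b₁ b₂,
      compatible_union h₁ h₂ a₁.right a₂.right b₁ b₂ c₁ c₂⟩

/-- The edges of a matching in one of two parts that no edge joins. -/
lemma isBRMatching_filter (hM : IsBRMatching B R M) (p : Pt → Prop) [DecidablePred p]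
    (h : ∀ e ∈ M, p e.1 ↔ p e.2) :
    IsBRMatching (B.filter p) (R.filter p) (M.filter fun e => p e.1) := by
  refine ⟨?_, ?_, ?_, ?_⟩
  · intro e he
    rw [mem_filter] at he
    exact ⟨mem_filter.2 ⟨(hM.1 e he.1).1, he.2⟩,
      mem_filter.2 ⟨(hM.1 e he.1).2, (h e he.1).1 he.2⟩⟩
  · intro b hb
    rw [mem_filter] at hb
    obtain ⟨e, ⟨he, heb⟩, hu⟩ := hM.2.1 b hb.1
    refine ⟨e, ⟨mem_filter.2 ⟨he, heb ▸ hb.2⟩, heb⟩, ?_⟩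
    rintro f ⟨hf, hfb⟩
    exact hu f ⟨(mem_filter.1 hf).1, hfb⟩
  · intro b hb
    rw [mem_filter] at hb
    obtain ⟨e, ⟨he, heb⟩, hu⟩ := hM.2.2.1 b hb.1
    refine ⟨e, ⟨mem_filter.2 ⟨he, (h e he).2 (heb ▸ hb.2)⟩, heb⟩, ?_⟩
    rintro f ⟨hf, hfb⟩
    exact hu f ⟨(mem_filter.1 hf).1, hfb⟩
  · intro e he f hf
    exact hM.2.2.2 e (mem_filter.1 he).1 f (mem_filter.1 hf).1

end Parallel

end

section

variable {B R : Finset Pt} {M N : Finset (Pt × Pt)} {c c' : ℝ}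

/-- No edge crosses `x = c` with its red end on the left. -/
def NoRedLeft (c : ℝ) (M : Finset (Pt × Pt)) : Prop := ∀ e ∈ M, ¬ (e.2.1 < c ∧ c < e.1.1)

/-- No edge crosses `x = c` with its blue end on the left. -/
def NoBlueLeft (c : ℝ) (M : Finset (Pt × Pt)) : Prop := ∀ e ∈ M, ¬ (e.1.1 < c ∧ c < e.2.1)

/-- The number of points of `S` to the left of `x = c`. -/
noncomputable def leftCount (c : ℝ) (S : Finset Pt) : ℕ := (S.filter fun p => p.1 < c).card

/-- The matching with the colours exchanged. -/
noncomputable def recolour (M : Finset (Pt × Pt)) : Finset (Pt × Pt) := M.image Prod.swap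

lemma mem_recolour {e : Pt × Pt} : e ∈ recolour M ↔ (e.2, e.1) ∈ M := by
  simp only [recolour, mem_image]
  constructor
  · rintro ⟨f, hf, rfl⟩; simpa using hf
  · exact fun h => ⟨_, h, by simp⟩

lemma forall_mem_recolour {p : Pt × Pt → Prop} :
    (∀ e ∈ recolour M, p e) ↔ ∀ e ∈ M, p (e.2, e.1) := by
  simp only [recolour, forall_mem_image]
  rfl

@[simp] lemma recolour_recolour : recolour (recolour M) = M := by
  ext e; simp [mem_recolour]

lemma isBRMatching_recolour (h : IsBRMatching B R M) : IsBRMatching R B (recolour M) := by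
  obtain ⟨h1, h2, h3, h4⟩ := h
  refine ⟨?_, ?_, ?_, ?_⟩
  · rw [forall_mem_recolour]
    exact fun e he => (h1 e he).symm
  · intro b hb
    obtain ⟨e, ⟨he, heb⟩, hu⟩ := h3 b hb
    refine ⟨(e.2, e.1), ⟨mem_recolour.2 he, heb⟩, ?_⟩
    rintro f ⟨hf, hfb⟩
    rw [← hu _ ⟨mem_recolour.1 hf, hfb⟩]
  · intro b hb
    obtain ⟨e, ⟨he, heb⟩, hu⟩ := h2 b hb
    refine ⟨(e.2, e.1), ⟨mem_recolour.2 he, heb⟩, ?_⟩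
    rintro f ⟨hf, hfb⟩
    rw [← hu _ ⟨mem_recolour.1 hf, hfb⟩]
  · rw [forall_mem_recolour]
    intro e he
    rw [forall_mem_recolour]
    intro f hf hne
    rw [segment_symm ℝ e.2, segment_symm ℝ f.2]
    exact h4 e he f hf fun h => hne (by rw [h])

lemma compatible_recolour (h : Compatible M N) : Compatible (recolour M) (recolour N) := by
  unfold Compatible
  rw [forall_mem_recolour]
  intro e he
  rw [forall_mem_recolour]
  intro f hf
  rcases h e he f hf with rfl | h
  · exact Or.inl rfl
  · right
    rw [segment_symm ℝ e.2, segment_symm ℝ f.2]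
    exact fun z hz => ⟨(h hz).1.symm, (h hz).2.symm⟩

lemma noRedLeft_recolour : NoRedLeft c (recolour M) ↔ NoBlueLeft c M := forall_mem_recolour

lemma noBlueLeft_recolour : NoBlueLeft c (recolour M) ↔ NoRedLeft c M := forall_mem_recolour

/-- If only edges with their red end on the left cross, then more red than blue points are on
the left. -/
lemma leftCount_lt (hM : IsBRMatching B R M) (hc : GenericLine (B ∪ R) c) (hV : NoBlueLeft c M)
    (hU : ¬ NoRedLeft c M) : leftCount c B < leftCount c R := by
  have hex : ∀ b ∈ B, ∃ e ∈ M, e.1 = b := fun b hb => by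
    obtain ⟨e, ⟨he, h⟩, -⟩ := hM.2.1 b hb
    exact ⟨e, he, h⟩
  choose! f hf hfb using hex
  unfold NoRedLeft at hU
  push Not at hU
  obtain ⟨u, hu, hul, hur⟩ := hU
  have hred : ∀ b ∈ B, b.1 < c → (f b).2.1 < c := by
    intro b hb hbc
    have h1 := hV (f b) (hf b hb)
    rw [hfb b hb] at h1
    have h2 := hc.off (f b).2 (mem_union_right _ (hM.1 _ (hf b hb)).2)
    exact lt_of_le_of_ne (not_lt.1 fun h => h1 ⟨hbc, h⟩) h2
  have hsub : (B.filter fun p => p.1 < c).image (fun b => (f b).2) ⊆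
      (R.filter fun p => p.1 < c).erase u.2 := by
    intro r hr
    obtain ⟨b, hb, rfl⟩ := mem_image.1 hr
    obtain ⟨hb, hbc⟩ := mem_filter.1 hb
    refine mem_erase.2 ⟨fun h => ?_, mem_filter.2 ⟨(hM.1 _ (hf b hb)).2, hred b hb hbc⟩⟩
    have : f b = u := (hM.2.2.1 u.2 (hM.1 u hu).2).unique ⟨hf b hb, h⟩ ⟨hu, rfl⟩
    rw [← this, hfb b hb] at hur
    exact hbc.not_gt hur
  have hinj : Set.InjOn (fun b => (f b).2) (B.filter fun p => p.1 < c) := by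
    intro b hb b' hb' h
    have hb := (mem_filter.1 (mem_coe.1 hb)).1
    have hb' := (mem_filter.1 (mem_coe.1 hb')).1
    have : f b = f b' := (hM.2.2.1 _ (hM.1 _ (hf b hb)).2).unique ⟨hf b hb, rfl⟩ ⟨hf b' hb', h.symm⟩
    rw [← hfb b hb, ← hfb b' hb', this]
  have h1 := card_le_card hsub
  rw [card_image_of_injOn hinj] at h1
  have hmem : u.2 ∈ R.filter fun p => p.1 < c := mem_filter.2 ⟨(hM.1 u hu).2, hul⟩
  exact h1.trans_lt (card_erase_lt_of_mem hmem)

lemma leftCount_lt' (hM : IsBRMatching B R M) (hc : GenericLine (B ∪ R) c) (hU : NoRedLeft c M)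
    (hV : ¬ NoBlueLeft c M) : leftCount c R < leftCount c B :=
  leftCount_lt (isBRMatching_recolour hM) (by rwa [union_comm]) (noBlueLeft_recolour.2 hU)
    (by rwa [noRedLeft_recolour])

/-- Sweeping the line over a blue point. -/
lemma sweep_blue (hP : Bichromatic B R) (hN : IsBRMatching B R N) (hc : GenericLine (B ∪ R) c)
    (hc' : GenericLine (B ∪ R) c') {p : Pt} (hp : p ∈ B) (hpc' : c' < p.1) (hpc : p.1 < c)
    (hq : ∀ q ∈ B ∪ R, q ≠ p → (q.1 < c ↔ q.1 < c'))
    (h : NoRedLeft c' N ∨ NoBlueLeft c' N) :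
    ∃ K, IsBRMatching B R K ∧
      (K = N ∨ Compatible N K ∧ leftCount c' B < leftCount c' R) ∧
      (NoRedLeft c K ∨ NoBlueLeft c K) := by
  obtain ⟨e₀, ⟨he₀, rfl⟩, hu₀⟩ := hN.2.1 p hp
  have hlt : ∀ q ∈ B ∪ R, q ≠ e₀.1 → (c < q.1 ↔ c' < q.1) := by
    intro q hqm hne
    have h1 := hc.off q hqm
    have h2 := hc'.off q hqm
    have h3 := hq q hqm hne
    constructor
    · intro h4
      exact lt_of_le_of_ne (not_lt.1 fun h5 => (h3.2 h5).not_gt h4) h2.symm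
    · intro h4
      exact lt_of_le_of_ne (not_lt.1 fun h5 => (h3.1 h5).not_gt h4) h1.symm
  have m1 : ∀ e ∈ N, e.1 ∈ B ∪ R := fun e he => mem_union_left _ (hN.1 e he).1
  have m2 : ∀ e ∈ N, e.2 ∈ B ∪ R := fun e he => mem_union_right _ (hN.1 e he).2
  have n1 : ∀ e ∈ N, e ≠ e₀ → e.1 ≠ e₀.1 := fun e he hne h => hne (hu₀ e ⟨he, h⟩)
  have n2 : ∀ e ∈ N, e.2 ≠ e₀.1 := fun e he h => hP.disj e₀.1 hp (h ▸ (hN.1 e he).2)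
  have hUe : NoRedLeft c' N → NoRedLeft c N := by
    intro hU e he ⟨h1, h2⟩
    by_cases hne : e = e₀
    · subst hne; exact hpc.not_gt h2
    · exact hU e he ⟨(hq _ (m2 e he) (n2 e he)).1 h1, (hlt _ (m1 e he) (n1 e he hne)).1 h2⟩
  have hV : NoBlueLeft c' N → ∀ e ∈ N, e.1.1 < c → c < e.2.1 → e = e₀ := by
    intro hV e he h1 h2
    by_contra hne
    exact hV e he ⟨(hq _ (m1 e he) (n1 e he hne)).1 h1, (hlt _ (m2 e he) (n2 e he)).1 h2⟩
  by_cases hU' : NoRedLeft c' N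
  · exact ⟨N, hN, Or.inl rfl, Or.inl (hUe hU')⟩
  have hV' := h.resolve_left hU'
  by_cases hU : NoRedLeft c N
  · exact ⟨N, hN, Or.inl rfl, Or.inl hU⟩
  by_cases hr : c < e₀.2.1
  · unfold NoRedLeft at hU
    push Not at hU
    obtain ⟨g, hg, hgl, hgr⟩ := hU
    obtain ⟨K, h1, h2, h3⟩ := exists_clear' hN hP hc he₀ hpc hr (hV hV') hg hgl hgr
    exact ⟨K, h1, Or.inr ⟨h2, leftCount_lt hN hc' hV' hU'⟩, Or.inr h3⟩
  · refine ⟨N, hN, Or.inl rfl, Or.inr fun e he ⟨h1, h2⟩ => ?_⟩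
    rw [hV hV' e he h1 h2] at h2
    exact hr h2

lemma sweep_red (hP : Bichromatic B R) (hN : IsBRMatching B R N) (hc : GenericLine (B ∪ R) c)
    (hc' : GenericLine (B ∪ R) c') {p : Pt} (hp : p ∈ R) (hpc' : c' < p.1) (hpc : p.1 < c)
    (hq : ∀ q ∈ B ∪ R, q ≠ p → (q.1 < c ↔ q.1 < c'))
    (h : NoRedLeft c' N ∨ NoBlueLeft c' N) :
    ∃ K, IsBRMatching B R K ∧
      (K = N ∨ Compatible N K ∧ leftCount c' R < leftCount c' B) ∧
      (NoRedLeft c K ∨ NoBlueLeft c K) := by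
  rw [union_comm] at hc hc' hq
  obtain ⟨K, h1, h2, h3⟩ := sweep_blue hP.swap (isBRMatching_recolour hN) hc hc' hp hpc' hpc hq
    (by rwa [noRedLeft_recolour, noBlueLeft_recolour, or_comm])
  refine ⟨recolour K, isBRMatching_recolour h1, ?_, ?_⟩
  · rcases h2 with rfl | ⟨h2, h4⟩
    · exact Or.inl recolour_recolour
    · refine Or.inr ⟨?_, h4⟩
      simpa using compatible_recolour h2
  · rwa [noRedLeft_recolour, noBlueLeft_recolour, or_comm]

lemma leftCount_insert {S : Finset Pt} {p : Pt} (hp : p ∈ S) (hpc' : c' < p.1) (hpc : p.1 < c)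
    (hq : ∀ q ∈ S, q ≠ p → (q.1 < c ↔ q.1 < c')) : leftCount c S = leftCount c' S + 1 := by
  unfold leftCount
  have : (S.filter fun q => q.1 < c) = insert p (S.filter fun q => q.1 < c') := by
    ext q
    simp only [mem_filter, mem_insert]
    by_cases h : q = p
    · subst h; simp [hp, hpc]
    · simp only [h, false_or]
      exact and_congr_right fun hS => hq q hS h
  rw [this, card_insert_of_notMem]
  simp [hpc'.le]

lemma leftCount_congr {S : Finset Pt} (hq : ∀ q ∈ S, (q.1 < c ↔ q.1 < c')) :
    leftCount c S = leftCount c' S := by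
  unfold leftCount
  rw [filter_congr hq]

lemma exists_sweep (hP : Bichromatic B R) (hM : IsBRMatching B R M)
    (hx : ∀ p ∈ B ∪ R, ∀ q ∈ B ∪ R, p.1 = q.1 → p = q) (j : ℕ) :
    ∀ c, GenericLine (B ∪ R) c → leftCount c (B ∪ R) = j →
      ∃ s N, Reach B R s M N ∧ s ≤ leftCount c B ∧ s ≤ leftCount c R ∧
        (NoRedLeft c N ∨ NoBlueLeft c N) := by
  induction j with
  | zero =>
    intro c hc hj
    refine ⟨0, M, ⟨rfl, hM⟩, Nat.zero_le _, Nat.zero_le _, Or.inl fun e he h => ?_⟩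
    have h1 := filter_eq_empty_iff.1 (card_eq_zero.1 hj)
    exact h1 (mem_union_right _ (hM.1 e he).2) h.1
  | succ j ih =>
    intro c hc hj
    obtain ⟨p, hp, hmax⟩ := exists_max_image ((B ∪ R).filter fun q => q.1 < c) Prod.fst
      (card_pos.1 (by unfold leftCount at hj; omega))
    obtain ⟨hpm, hpc⟩ := mem_filter.1 hp
    obtain ⟨a, hap, ha⟩ : ∃ a < p.1, ∀ q ∈ B ∪ R, q.1 < c → q ≠ p → q.1 ≤ a := by
      rcases (((B ∪ R).filter fun q => q.1 < c).erase p).eq_empty_or_nonempty with h | h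
      · refine ⟨p.1 - 1, by linarith, fun q hq hqc hne => ?_⟩
        exact absurd (mem_erase.2 ⟨hne, mem_filter.2 ⟨hq, hqc⟩⟩) (by rw [h]; simp)
      · obtain ⟨m, hm, hm'⟩ := exists_max_image _ Prod.fst h
        obtain ⟨hmp, hm⟩ := mem_erase.1 hm
        refine ⟨m.1, lt_of_le_of_ne (hmax m hm) fun h => hmp ?_, fun q hq hqc hne => ?_⟩
        · exact hx m (mem_filter.1 hm).1 p hpm h
        · exact hm' q (mem_erase.2 ⟨hne, mem_filter.2 ⟨hq, hqc⟩⟩)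
    obtain ⟨c', hac', hc'p, hc'⟩ := hP.exists_generic hap
    have hq : ∀ q ∈ B ∪ R, q ≠ p → (q.1 < c ↔ q.1 < c') := fun q hq hne =>
      ⟨fun h => (ha q hq h hne).trans_lt hac', fun h => h.trans (hc'p.trans hpc)⟩
    obtain ⟨s, N, h1, h2, h3, h4⟩ := ih c' hc' (by
      have := leftCount_insert hpm hc'p hpc hq
      omega)
    rcases mem_union.1 hpm with hpB | hpR
    · have e1 := leftCount_insert hpB hc'p hpc fun q hqB => hq q (mem_union_left _ hqB)
      have e2 : leftCount c R = leftCount c' R := leftCount_congr fun q hqR =>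
        hq q (mem_union_right _ hqR) fun h => hP.disj p hpB (h ▸ hqR)
      obtain ⟨K, k1, k2, k3⟩ := sweep_blue hP h1.right hc hc' hpB hc'p hpc hq h4
      rcases k2 with rfl | ⟨k2, k4⟩
      · exact ⟨s, K, h1, by omega, by omega, k3⟩
      · exact ⟨s + 1, K, ⟨N, h1, k1, k2⟩, by omega, by omega, k3⟩
    · have e1 := leftCount_insert hpR hc'p hpc fun q hqR => hq q (mem_union_right _ hqR)
      have e2 : leftCount c B = leftCount c' B := leftCount_congr fun q hqB =>
        hq q (mem_union_left _ hqB) fun h => hP.disj p (h ▸ hqB) hpR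
      obtain ⟨K, k1, k2, k3⟩ := sweep_red hP h1.right hc hc' hpR hc'p hpc hq h4
      rcases k2 with rfl | ⟨k2, k4⟩
      · exact ⟨s, K, h1, by omega, by omega, k3⟩
      · exact ⟨s + 1, K, ⟨N, h1, k1, k2⟩, by omega, by omega, k3⟩

/-- Every matching can be moved off a balanced line. -/
lemma exists_separated (hP : Bichromatic B R) (hM : IsBRMatching B R M)
    (hx : ∀ p ∈ B ∪ R, ∀ q ∈ B ∪ R, p.1 = q.1 → p = q) (hc : GenericLine (B ∪ R) c)
    (hk : leftCount c B = leftCount c R) :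
    ∃ N, Reach B R (leftCount c B) M N ∧ ∀ e ∈ N, e.1.1 < c ↔ e.2.1 < c := by
  obtain ⟨s, N, h1, h2, -, h4⟩ := exists_sweep hP hM hx _ c hc rfl
  refine ⟨N, h1.mono h2, ?_⟩
  have hN := h1.right
  have hU : NoRedLeft c N := by
    by_contra hU
    exact (leftCount_lt hN hc (h4.resolve_left hU) hU).ne hk
  have hV : NoBlueLeft c N := by
    by_contra hV
    exact (leftCount_lt' hN hc hU hV).ne' hk
  intro e he
  have o1 := hc.off _ (mem_union_left _ (hN.1 e he).1)
  have o2 := hc.off _ (mem_union_right _ (hN.1 e he).2)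
  exact ⟨fun h => lt_of_le_of_ne (not_lt.1 fun h' => hV e he ⟨h, h'⟩) o2,
    fun h => lt_of_le_of_ne (not_lt.1 fun h' => hU e he ⟨h, h'⟩) o1⟩

end

lemma exists_gap_right (S : Finset ℝ) (x : ℝ) : ∃ y > x, ∀ s ∈ S, x < s → y < s := by
  rcases (S.filter fun s => x < s).eq_empty_or_nonempty with h | h
  · exact ⟨x + 1, by linarith, fun s hs hxs => absurd hxs (filter_eq_empty_iff.1 h hs)⟩
  · obtain ⟨m, hm, hm'⟩ := exists_min_image _ id h
    have h1 := (mem_filter.1 hm).2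
    exact ⟨(x + m) / 2, by linarith, fun s hs hxs => by
      have := hm' s (mem_filter.2 ⟨hs, hxs⟩)
      simp only [id] at this
      linarith⟩

lemma exists_gap_left (S : Finset ℝ) (x : ℝ) : ∃ y < x, ∀ s ∈ S, s < x → s < y := by
  obtain ⟨y, hy, h⟩ := exists_gap_right (S.image Neg.neg) (-x)
  refine ⟨-y, by linarith, fun s hs hsx => ?_⟩
  have := h (-s) (mem_image_of_mem _ hs) (by linarith)
  linarith

/-- In a pencil of functions that jointly separate the points, nearly all are injective. -/
lemma exists_pencil_injective (P : Finset Pt) (φ ψ : Pt → ℝ)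
    (h : ∀ p ∈ P, ∀ q ∈ P, φ p = φ q → ψ p = ψ q → p = q) {a b : ℝ} (hab : a < b) :
    ∃ t, a < t ∧ t < b ∧ ∀ p ∈ P, ∀ q ∈ P, φ p + t * ψ p = φ q + t * ψ q → p = q := by
  obtain ⟨t, ht, htF⟩ := (Set.Ioo_infinite hab).exists_notMem_finset
    ((P ×ˢ P).image fun x => (φ x.2 - φ x.1) / (ψ x.1 - ψ x.2))
  refine ⟨t, ht.1, ht.2, fun p hp q hq hpq => ?_⟩
  by_cases hψ : ψ p = ψ q
  · exact h p hp q hq (by rw [hψ] at hpq; linarith) hψ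
  · refine absurd (mem_image.2 ⟨(p, q), mem_product.2 ⟨hp, hq⟩, ?_⟩) htF
    rw [div_eq_iff (sub_ne_zero.2 hψ)]
    dsimp only
    linarith

lemma exists_balanced_prefix {X Y : Finset Pt} {σ : Pt → ℝ}
    (hσ : ∀ p ∈ X ∪ Y, ∀ q ∈ X ∪ Y, σ p = σ q → p = q) (hd : ∀ p ∈ X, p ∉ Y)
    (hcard : X.card < Y.card) :
    ∃ a ∈ X ∪ Y,
      (X.filter fun q => σ q ≤ σ a).card = (Y.filter fun q => σ q ≤ σ a).card ∨
      (X.filter fun q => σ q ≤ σ a).card = 0 ∧ (Y.filter fun q => σ q ≤ σ a).card = 1 := by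
  set S := (X ∪ Y).filter fun a =>
    (X.filter fun q => σ q ≤ σ a).card ≤ (Y.filter fun q => σ q ≤ σ a).card with hS
  have hne : S.Nonempty := by
    obtain ⟨y, hy⟩ : Y.Nonempty := card_pos.1 (by omega)
    obtain ⟨m, hm, hmax⟩ := exists_max_image (X ∪ Y) σ ⟨y, mem_union_right _ hy⟩
    refine ⟨m, mem_filter.2 ⟨hm, ?_⟩⟩
    rw [filter_true_of_mem fun q hq => hmax q (mem_union_left _ hq),
      filter_true_of_mem fun q hq => hmax q (mem_union_right _ hq)]
    exact hcard.le
  obtain ⟨a, ha, hmin⟩ := exists_min_image S σ hne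
  obtain ⟨haXY, hle⟩ := mem_filter.1 ha
  have hpre : (X.filter fun q => σ q < σ a).card = 0 ∧ (Y.filter fun q => σ q < σ a).card = 0 ∨
      (Y.filter fun q => σ q < σ a).card < (X.filter fun q => σ q < σ a).card := by
    rcases ((X ∪ Y).filter fun q => σ q < σ a).eq_empty_or_nonempty with h | h
    · rw [filter_union, union_eq_empty] at h
      exact Or.inl ⟨by rw [h.1]; rfl, by rw [h.2]; rfl⟩
    · right
      obtain ⟨b, hb, hmax⟩ := exists_max_image _ σ h
      obtain ⟨hb, hba⟩ := mem_filter.1 hb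
      have hiff : ∀ q ∈ X ∪ Y, (σ q < σ a ↔ σ q ≤ σ b) := fun q hq =>
        ⟨fun h => hmax q (mem_filter.2 ⟨hq, h⟩), fun h => h.trans_lt hba⟩
      rw [filter_congr fun q hq => hiff q (mem_union_left _ hq),
        filter_congr fun q hq => hiff q (mem_union_right _ hq)]
      by_contra! hcon
      exact (hmin b (mem_filter.2 ⟨hb, hcon⟩)).not_gt hba
  have hcase : ∀ Z ⊆ X ∪ Y, (Z.filter fun q => σ q ≤ σ a).card =
      (Z.filter fun q => σ q < σ a).card + if a ∈ Z then 1 else 0 := by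
    intro Z hZ
    have hlt : ∀ q ∈ Z, q ≠ a → (σ q ≤ σ a ↔ σ q < σ a) := fun q hq hne =>
      ⟨fun h => lt_of_le_of_ne h fun h' => hne (hσ q (hZ hq) a haXY h'), le_of_lt⟩
    split_ifs with h
    · have : (Z.filter fun q => σ q ≤ σ a) = insert a (Z.filter fun q => σ q < σ a) := by
        ext q
        simp only [mem_filter, mem_insert]
        by_cases hqa : q = a
        · subst hqa; simp [h]
        · simp only [hqa, false_or]
          exact and_congr_right fun hq => hlt q hq hqa
      rw [this, card_insert_of_notMem (by simp)]
    · rw [filter_congr fun q hq => hlt q hq fun h' => h (h' ▸ hq), add_zero]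
  have h1 := hcase X subset_union_left
  have h2 := hcase Y subset_union_right
  refine ⟨a, haXY, ?_⟩
  rcases mem_union.1 haXY with haX | haY
  · rw [if_pos haX] at h1
    rw [if_neg (hd a haX)] at h2
    omega
  · rw [if_neg fun h => hd a h haY] at h1
    rw [if_pos haY] at h2
    omega

/-- The line `α x + β y = γ` cuts off `k` blue and `k` red points, and is parallel to no line
through two points. -/
structure Balanced (B R : Finset Pt) (k : ℕ) (α β γ : ℝ) : Prop where
  inj : ∀ p ∈ B ∪ R, ∀ q ∈ B ∪ R, α * p.1 + β * p.2 = α * q.1 + β * q.2 → p = q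
  off : ∀ p ∈ B ∪ R, α * p.1 + β * p.2 ≠ γ
  blue : (B.filter fun p => α * p.1 + β * p.2 < γ).card = k
  red : (R.filter fun p => α * p.1 + β * p.2 < γ).card = k

lemma exists_balanced_of_min {B R : Finset Pt} (hP : Bichromatic B R) {n : ℕ} (hB : B.card = n)
    (hR : R.card = n) (hn : 2 ≤ n) {t : ℝ} {p : Pt} (hp : p ∈ B)
    (hmin : ∀ q ∈ B ∪ R, q ≠ p → p.1 + t * p.2 < q.1 + t * q.2)
    (ht : ∀ q ∈ B ∪ R, ∀ r ∈ B ∪ R, q.1 + t * q.2 = r.1 + t * r.2 → q = r) :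
    ∃ k α β γ, 1 ≤ k ∧ k < n ∧ Balanced B R k α β γ := by
  set f : Pt → ℝ := fun q => q.1 + t * q.2 with hf
  set σ : Pt → ℝ := fun q => (q.2 - p.2) / (f q - f p) with hσ
  have hpos : ∀ q ∈ B ∪ R, q ≠ p → 0 < f q - f p := fun q hq h => sub_pos.2 (hmin q hq h)
  have hsub : (B.erase p) ∪ R ⊆ B ∪ R := union_subset_union (erase_subset _ _) (subset_refl _)
  have hnep : ∀ q ∈ (B.erase p) ∪ R, q ≠ p := by
    intro q hq h
    rcases mem_union.1 hq with hq | hq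
    · exact (mem_erase.1 hq).1 h
    · exact hP.disj p hp (h ▸ hq)
  have hinj : ∀ q ∈ (B.erase p) ∪ R, ∀ r ∈ (B.erase p) ∪ R, σ q = σ r → q = r := by
    intro q hq r hr h
    by_contra hne
    refine hP.gen p (mem_union_left _ hp) q (hsub hq) r (hsub hr) (hnep q hq).symm
      (hnep r hr).symm hne ?_
    have h1 := hpos q (hsub hq) (hnep q hq)
    have h2 := hpos r (hsub hr) (hnep r hr)
    rw [hσ] at h
    dsimp only at h
    rw [div_eq_div_iff h1.ne' h2.ne'] at h
    simp only [hf] at h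
    simp only [cr, Prod.fst_sub, Prod.snd_sub]
    linarith
  obtain ⟨a, ha, hcount⟩ := exists_balanced_prefix hinj
    (fun q hq => hP.disj q (mem_erase.1 hq).2) (by rw [card_erase_of_mem hp]; omega)
  obtain ⟨m, ham, hm⟩ := exists_gap_right (((B.erase p) ∪ R).image σ) (σ a)
  obtain ⟨θ, haθ, hθm, hθ⟩ := exists_pencil_injective (B ∪ R) (fun q => q.2) (fun q => -f q)
    (fun q hq r hr _ h => ht q hq r hr (neg_injective h)) ham
  set h : Pt → ℝ := fun q => -θ * q.1 + (1 - θ * t) * q.2 with hh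
  have hform : ∀ q, h q = q.2 + θ * -f q := fun q => by simp only [hh, hf]; ring
  have hhinj : ∀ q ∈ B ∪ R, ∀ r ∈ B ∪ R, h q = h r → q = r := fun q hq r hr e =>
    hθ q hq r hr (by rw [← hform, ← hform]; exact e)
  have hlt : ∀ q ∈ (B.erase p) ∪ R, (h q < h p ↔ σ q ≤ σ a) := by
    intro q hq
    have h1 := hpos q (hsub hq) (hnep q hq)
    have h2 : h q < h p ↔ σ q < θ := by
      rw [hσ]
      dsimp only
      rw [div_lt_iff₀ h1, hform, hform]
      constructor <;> intro h <;> linarith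
    rw [h2]
    constructor
    · intro h3
      by_contra! h4
      linarith [hm (σ q) (mem_image_of_mem _ hq) h4]
    · exact fun h3 => h3.trans_lt haθ
  have key : ∀ γ, (∀ q ∈ (B.erase p) ∪ R, h q ≠ γ ∧ (h q < γ ↔ h q < h p)) →
      (B.erase p).filter (fun q => h q < γ) = (B.erase p).filter (fun q => σ q ≤ σ a) ∧
      R.filter (fun q => h q < γ) = R.filter (fun q => σ q ≤ σ a) := fun γ hγ =>
    ⟨filter_congr fun q hq => (hγ q (mem_union_left _ hq)).2.trans (hlt q (mem_union_left _ hq)),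
      filter_congr fun q hq => (hγ q (mem_union_right _ hq)).2.trans (hlt q (mem_union_right _ hq))⟩
  have hoff : ∀ γ, h p ≠ γ → (∀ q ∈ (B.erase p) ∪ R, h q ≠ γ ∧ (h q < γ ↔ h q < h p)) →
      ∀ q ∈ B ∪ R, h q ≠ γ := by
    intro γ h1 h2 q hq
    by_cases hqp : q = p
    · rwa [hqp]
    · refine (h2 q ?_).1
      rcases mem_union.1 hq with hq | hq
      · exact mem_union_left _ (mem_erase.2 ⟨hqp, hq⟩)
      · exact mem_union_right _ hq
  have hne : ∀ q ∈ (B.erase p) ∪ R, h q ≠ h p := fun q hq e =>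
    hnep q hq (hhinj q (hsub hq) p (mem_union_left _ hp) e)
  rcases hcount with hcount | ⟨h0, h1⟩
  · obtain ⟨γ, hγp, hγ⟩ := exists_gap_left ((B ∪ R).image h) (h p)
    have hγ' : ∀ q ∈ (B.erase p) ∪ R, h q ≠ γ ∧ (h q < γ ↔ h q < h p) := by
      intro q hq
      have h1 := hγ (h q) (mem_image_of_mem _ (hsub hq))
      exact ⟨fun e => lt_irrefl γ (e ▸ h1 (e ▸ hγp)), fun h2 => h2.trans hγp, h1⟩
    obtain ⟨k1, k2⟩ := key γ hγ'
    have k3 : B.filter (fun q => h q < γ) = (B.erase p).filter (fun q => h q < γ) := by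
      ext q
      simp only [mem_filter, mem_erase]
      constructor
      · exact fun ⟨h1, h2⟩ => ⟨⟨fun e => (e ▸ h2).not_gt hγp, h1⟩, h2⟩
      · exact fun ⟨h1, h2⟩ => ⟨h1.2, h2⟩
    refine ⟨((B.erase p).filter fun q => σ q ≤ σ a).card, -θ, 1 - θ * t, γ, ?_, ?_, hhinj,
      hoff γ hγp.ne' hγ', congrArg card (k3.trans k1), (congrArg card k2).trans hcount.symm⟩
    · rcases mem_union.1 ha with ha | ha
      · exact card_pos.2 ⟨a, mem_filter.2 ⟨ha, le_rfl⟩⟩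
      · rw [hcount]
        exact card_pos.2 ⟨a, mem_filter.2 ⟨ha, le_rfl⟩⟩
    · have := card_filter_le (B.erase p) fun q => σ q ≤ σ a
      rw [card_erase_of_mem hp] at this
      omega
  · obtain ⟨γ, hγp, hγ⟩ := exists_gap_right ((B ∪ R).image h) (h p)
    have hγ' : ∀ q ∈ (B.erase p) ∪ R, h q ≠ γ ∧ (h q < γ ↔ h q < h p) := by
      intro q hq
      have h1 := hγ (h q) (mem_image_of_mem _ (hsub hq))
      have h2 := hne q hq
      refine ⟨fun e => lt_irrefl γ (e ▸ h1 (e ▸ hγp)), fun h3 => ?_, fun h3 => h3.trans hγp⟩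
      exact lt_of_le_of_ne (not_lt.1 fun h4 => (h1 h4).not_gt h3) h2
    obtain ⟨k1, k2⟩ := key γ hγ'
    have k3 : B.filter (fun q => h q < γ) = insert p ((B.erase p).filter fun q => h q < γ) := by
      ext q
      simp only [mem_filter, mem_erase, mem_insert]
      constructor
      · rintro ⟨h1, h2⟩
        by_cases e : q = p
        · exact Or.inl e
        · exact Or.inr ⟨⟨e, h1⟩, h2⟩
      · rintro (rfl | ⟨h1, h2⟩)
        · exact ⟨hp, hγp⟩
        · exact ⟨h1.2, h2⟩
    refine ⟨1, -θ, 1 - θ * t, γ, le_rfl, by omega, hhinj, hoff γ hγp.ne hγ', ?_, ?_⟩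
    · change (B.filter fun q => h q < γ).card = 1
      rw [k3, k1, card_eq_zero.1 h0]; rfl
    · change (R.filter fun q => h q < γ).card = 1
      rw [k2, h1]

lemma Balanced.swap {B R : Finset Pt} {k : ℕ} {α β γ : ℝ} (h : Balanced R B k α β γ) :
    Balanced B R k α β γ :=
  ⟨by rw [union_comm]; exact h.inj, by rw [union_comm]; exact h.off, h.red, h.blue⟩

lemma Balanced.neg {B R : Finset Pt} {k n : ℕ} {α β γ : ℝ} (h : Balanced B R k α β γ)
    (hB : B.card = n) (hR : R.card = n) : Balanced B R (n - k) (-α) (-β) (-γ) := by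
  have key : ∀ S ⊆ B ∪ R, S.card = n → (S.filter fun p => α * p.1 + β * p.2 < γ).card = k →
      (S.filter fun p => -α * p.1 + -β * p.2 < -γ).card = n - k := by
    intro S hS hn hk
    have h1 := card_filter_add_card_filter_not (s := S) fun p => α * p.1 + β * p.2 < γ
    have h2 : (S.filter fun p => -α * p.1 + -β * p.2 < -γ) =
        S.filter fun p => ¬ α * p.1 + β * p.2 < γ := by
      refine filter_congr fun p hp => ?_
      have := h.off p (hS hp)
      constructor
      · intro h3; linarith
      · intro h3
        have := lt_of_le_of_ne (not_lt.1 h3) this.symm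
        linarith
    rw [h2]
    omega
  refine ⟨fun p hp q hq e => h.inj p hp q hq (by linarith), fun p hp e => h.off p hp (by linarith),
    key B subset_union_left hB h.blue, key R subset_union_right hR h.red⟩

/-- A nontrivial balanced line exists. -/
lemma exists_balanced {B R : Finset Pt} (hP : Bichromatic B R) {n : ℕ} (hB : B.card = n)
    (hR : R.card = n) (hn : 2 ≤ n) : ∃ k α β γ, 1 ≤ k ∧ 2 * k ≤ n ∧ Balanced B R k α β γ := by
  have main : ∃ k α β γ, 1 ≤ k ∧ k < n ∧ Balanced B R k α β γ := by
    obtain ⟨t, -, -, ht⟩ := exists_pencil_injective (B ∪ R) Prod.fst Prod.snd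
      (fun p _ q _ h1 h2 => Prod.ext h1 h2) (zero_lt_one (α := ℝ))
    obtain ⟨b, hb⟩ : B.Nonempty := card_pos.1 (by omega)
    obtain ⟨p, hp, hmin⟩ := exists_min_image (B ∪ R) (fun q => q.1 + t * q.2)
      ⟨b, mem_union_left _ hb⟩
    have hmin' : ∀ q ∈ B ∪ R, q ≠ p → p.1 + t * p.2 < q.1 + t * q.2 := fun q hq hne =>
      lt_of_le_of_ne (hmin q hq) fun e => hne (ht q hq p hp e.symm)
    rcases mem_union.1 hp with hpB | hpR
    · exact exists_balanced_of_min hP hB hR hn hpB hmin' ht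
    · rw [union_comm] at hmin' ht
      obtain ⟨k, α, β, γ, h1, h2, h3⟩ := exists_balanced_of_min hP.swap hR hB hn hpR hmin' ht
      exact ⟨k, α, β, γ, h1, h2, h3.swap⟩
  obtain ⟨k, α, β, γ, h1, h2, h3⟩ := main
  by_cases hk : 2 * k ≤ n
  · exact ⟨k, α, β, γ, h1, hk, h3⟩
  · exact ⟨n - k, -α, -β, -γ, by omega, by omega, h3.neg hB hR⟩

/-- The similarity `(x, y) ↦ (α x + β y, -β x + α y)`. -/
noncomputable def similarity (α β : ℝ) (h : α * α + β * β ≠ 0) : Pt ≃ₗ[ℝ] Pt where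
  toFun z := (α * z.1 + β * z.2, -β * z.1 + α * z.2)
  map_add' x y := by ext <;> simp only [Prod.fst_add, Prod.snd_add] <;> ring
  map_smul' t x := by
    ext <;> simp only [Prod.smul_fst, Prod.smul_snd, smul_eq_mul, RingHom.id_apply] <;> ring
  invFun w := ((α * w.1 - β * w.2) / (α * α + β * β), (β * w.1 + α * w.2) / (α * α + β * β))
  left_inv z := by ext <;> dsimp only <;> rw [div_eq_iff h] <;> ring
  right_inv w := by
    ext <;> dsimp only <;> rw [mul_div_assoc', mul_div_assoc', ← add_div, div_eq_iff h] <;> ring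

@[simp] lemma similarity_fst (α β : ℝ) (h : α * α + β * β ≠ 0) (z : Pt) :
    (similarity α β h z).1 = α * z.1 + β * z.2 := rfl

/-- Every matching on `B ∪ R` reaches `C` in `n` steps. -/
def IsHub (B R : Finset Pt) (n : ℕ) (C : Finset (Pt × Pt)) : Prop :=
  ∀ M, IsBRMatching B R M → Reach B R n M C

lemma IsHub.of_image {B R : Finset Pt} {n : ℕ} {C : Finset (Pt × Pt)} {L : Pt ≃ₗ[ℝ] Pt}
    (h : IsHub (B.image L) (R.image L) n C) : IsHub B R n (moved L.symm C) := fun M hM => by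
  simpa only [image_symm_image, moved_symm_moved] using (h _ hM.moved).moved (L := L.symm)

lemma isHub_union {B R : Finset Pt} {n k : ℕ} {c : ℝ} {C₁ C₂ : Finset (Pt × Pt)}
    (hP : Bichromatic B R) (hx : ∀ p ∈ B ∪ R, ∀ q ∈ B ∪ R, p.1 = q.1 → p = q)
    (hc : GenericLine (B ∪ R) c) (hB : leftCount c B = k) (hR : leftCount c R = k)
    (hkn : 2 * k ≤ n)
    (h₁ : IsHub (B.filter fun p => p.1 < c) (R.filter fun p => p.1 < c) k C₁)
    (h₂ : IsHub (B.filter fun p => ¬ p.1 < c) (R.filter fun p => ¬ p.1 < c) (n - k) C₂) :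
    IsHub B R n (C₁ ∪ C₂) := by
  intro M hM
  obtain ⟨N, hMN, hN⟩ := exists_separated hP hM hx hc (hB.trans hR.symm)
  rw [hB] at hMN
  have r₁ := (h₁ _ (isBRMatching_filter hMN.right _ hN)).mono (show k ≤ n - k by omega)
  have r₂ := h₂ _ (isBRMatching_filter hMN.right (fun p => ¬ p.1 < c) fun e he =>
    not_congr (hN e he))
  have r := Reach.union (c := c) (fun p hp => by
      rw [← filter_union] at hp
      exact (mem_filter.1 hp).2) (fun p hp => by
      rw [← filter_union] at hp
      obtain ⟨hp, hpc⟩ := mem_filter.1 hp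
      exact lt_of_le_of_ne (not_lt.1 hpc) (hc.off p hp).symm) r₁ r₂
  rw [filter_union_filter_not_eq, filter_union_filter_not_eq, filter_union_filter_not_eq] at r
  exact (hMN.trans r).mono (by omega)

lemma exists_isHub (n : ℕ) : ∀ B R : Finset Pt, Bichromatic B R → B.card = n → R.card = n →
    ∃ C, IsHub B R n C := by
  induction n using Nat.strong_induction_on with
  | _ n ih =>
    intro B R hP hB hR
    rcases Nat.lt_or_ge n 2 with hn | hn
    · by_cases hex : ∃ M, IsBRMatching B R M
      · obtain ⟨C, hC⟩ := hex
        have hone : ∀ S : Finset Pt, S.card = n → ∀ p ∈ S, ∀ q ∈ S, p = q := fun S hS =>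
          fun p hp q hq => card_le_one.1 (by omega) p hp q hq
        have hsub : ∀ M N, IsBRMatching B R M → IsBRMatching B R N → M ⊆ N := by
          intro M N hM hN e he
          obtain ⟨f, ⟨hf, h1⟩, -⟩ := hN.2.1 e.1 (hM.1 e he).1
          have h2 := hone R hR _ (hN.1 f hf).2 _ (hM.1 e he).2
          rwa [← Prod.ext h1 h2]
        refine ⟨C, fun M hM => Reach.mono ?_ (Nat.zero_le n)⟩
        exact ⟨(hsub M C hM hC).antisymm (hsub C M hC hM), hM⟩
      · exact ⟨∅, fun M hM => absurd ⟨M, hM⟩ hex⟩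
    · obtain ⟨k, α, β, γ, hk, hkn, hbal⟩ := exists_balanced hP hB hR hn
      have hαβ : α * α + β * β ≠ 0 := by
        intro h0
        have hα : α = 0 := by nlinarith [mul_self_nonneg α, mul_self_nonneg β]
        have hβ : β = 0 := by nlinarith [mul_self_nonneg α, mul_self_nonneg β]
        obtain ⟨p, hp, q, hq, hpq⟩ := one_lt_card.1 (show 1 < B.card by omega)
        exact hpq (hbal.inj p (mem_union_left _ hp) q (mem_union_left _ hq) (by simp [hα, hβ]))
      set L := similarity α β hαβ with hL
      suffices h : ∃ C, IsHub (B.image L) (R.image L) n C by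
        obtain ⟨C, hC⟩ := h
        exact ⟨_, hC.of_image⟩
      have hP' : Bichromatic (B.image L) (R.image L) := hP.image
      obtain ⟨y, hy, hgap⟩ := exists_gap_right ((B ∪ R).image fun p => (L p).1) γ
      obtain ⟨c, hγc, hcy, hc⟩ := hP'.exists_generic hy
      have hcount : ∀ S ⊆ B ∪ R, (S.filter fun p => α * p.1 + β * p.2 < γ).card = k →
          leftCount c (S.image L) = k := by
        intro S hS hSk
        rw [leftCount, filter_image, card_image_of_injective _ L.injective, ← hSk]
        refine congrArg card (filter_congr fun p hp => ?_)
        have h1 := hgap _ (mem_image_of_mem (fun p => (L p).1) (hS hp))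
        have h2 := hbal.off p (hS hp)
        simp only [hL, similarity_fst] at h1 ⊢
        constructor
        · intro h3
          by_contra h4
          linarith [h1 (lt_of_le_of_ne (not_lt.1 h4) h2.symm)]
        · exact fun h3 => h3.trans hγc
      have hkB := hcount B subset_union_left hbal.blue
      have hkR := hcount R subset_union_right hbal.red
      have hx : ∀ p ∈ B.image L ∪ R.image L, ∀ q ∈ B.image L ∪ R.image L, p.1 = q.1 → p = q := by
        rw [← image_union]
        simp only [forall_mem_image]
        intro p hp q hq h
        rw [hbal.inj p hp q hq h]
      have hcB : (B.image L).card = n := by rw [card_image_of_injective _ L.injective, hB]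
      have hcR : (R.image L).card = n := by rw [card_image_of_injective _ L.injective, hR]
      have hright : ∀ S : Finset Pt, S.card = n → leftCount c S = k →
          (S.filter fun p => ¬ p.1 < c).card = n - k := by
        intro S h1 h2
        have := card_filter_add_card_filter_not (s := S) fun p => p.1 < c
        unfold leftCount at h2
        omega
      obtain ⟨C₁, h₁⟩ := ih k (by omega) _ _ (hP'.mono (filter_subset _ _) (filter_subset _ _))
        hkB hkR
      obtain ⟨C₂, h₂⟩ := ih (n - k) (by omega) _ _
        (hP'.mono (filter_subset _ _) (filter_subset _ _)) (hright _ hcB hkB) (hright _ hcR hkR)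
      exact ⟨_, isHub_union hP' hx hc hkB hkR hkn h₁ h₂⟩

end BRPlane

/-- Any two BR-matchings on a bichromatic set of `2n` points in general
position (with `n` blue and `n` red points) are `2n`-compatible; in particular the
transformation graph of BR-matchings is connected with diameter at most `2n`. -/
theorem brMatchings_two_n_compatible (n : ℕ) (B R : Finset Pt)
    (hdisj : B ∩ R = ∅) (hB : B.card = n) (hR : R.card = n)
    (hgen : GenPos (B ∪ R))
    (M M' : Finset (Pt × Pt))
    (hM : IsBRMatching B R M) (hM' : IsBRMatching B R M') :
    TCompatible B R (2 * n) M M' := by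
  have hP : BRPlane.Bichromatic B R :=
    ⟨fun p hp hp' => notMem_empty p (hdisj ▸ mem_inter.2 ⟨hp, hp'⟩), BRPlane.GenPos.cr_ne hgen⟩
  obtain ⟨C, hC⟩ := BRPlane.exists_isHub n B R hP hB hR
  rw [two_mul]
  exact ((hC M hM).trans (hC M' hM').symm).tCompatible
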